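/- Let 𝔪 ⊆ S be the ideal generated by all the variables (the maximal homogeneous ideal). Then the top nonvanishing local cohomology module H^{2n+1}_I(S) is isomorphic as an S-module to H^{n(2n+1)}_𝔪(S) (which is the injective hull of the residue field K over S; note that n(2n+1) is the number of variables of S). -/

import Mathlib

section Homological

open CategoryTheory Limits Opposite

noncomputable section ConnectingMap

variable {C D : Type*} [Category* C] [Category* D] [Abelian C] [Abelian D]
  [HasProjectiveResolutions C]

/-- Three additive functors with a short exact sequence between them on projective objects. -/
structure ProjShortExact (F₁ F₂ F₃ : C ⥤ D) [F₁.Additive] [F₂.Additive] [F₃.Additive] where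
  f : F₁ ⟶ F₂
  g : F₂ ⟶ F₃
  zero : ∀ X, f.app X ≫ g.app X = 0
  shortExact : ∀ P [Projective P], (ShortComplex.mk (f.app P) (g.app P) (zero P)).ShortExact

namespace ProjShortExact

variable {F₁ F₂ F₃ : C ⥤ D} [F₁.Additive] [F₂.Additive] [F₃.Additive]
  (S : ProjShortExact F₁ F₂ F₃)

/-- The short complex of chain complexes attached to a projective resolution. -/
def complexes (K : ChainComplex C ℕ) : ShortComplex (ChainComplex D ℕ) :=
  ShortComplex.mk ((NatTrans.mapHomologicalComplex S.f _).app K)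
    ((NatTrans.mapHomologicalComplex S.g _).app K) (by
      ext i
      exact S.zero (K.X i))

/-- Functoriality of `complexes`. -/
def complexesMap {K L : ChainComplex C ℕ} (φ : K ⟶ L) : S.complexes K ⟶ S.complexes L where
  τ₁ := (F₁.mapHomologicalComplex _).map φ
  τ₂ := (F₂.mapHomologicalComplex _).map φ
  τ₃ := (F₃.mapHomologicalComplex _).map φ
  comm₁₂ := (NatTrans.mapHomologicalComplex S.f _).naturality φ
  comm₂₃ := (NatTrans.mapHomologicalComplex S.g _).naturality φ

omit [HasProjectiveResolutions C] in
lemma complexes_shortExact {X : C} (P : ProjectiveResolution X) :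
    (S.complexes P.complex).ShortExact :=
  HomologicalComplex.shortExact_of_degreewise_shortExact _ fun i =>
    S.shortExact (P.complex.X i)

/-- The connecting morphism in homology, for a fixed projective resolution. -/
def resConn {X : C} (P : ProjectiveResolution X) (n : ℕ) :
    (HomologicalComplex.homologyFunctor D _ (n + 1)).obj
        ((F₃.mapHomologicalComplex (ComplexShape.down ℕ)).obj P.complex) ⟶
      (HomologicalComplex.homologyFunctor D _ n).obj
        ((F₁.mapHomologicalComplex (ComplexShape.down ℕ)).obj P.complex) :=
  (S.complexes_shortExact P).δ (n + 1) n (by simp)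

omit [HasProjectiveResolutions C] in
lemma resConn_naturality {X Y : C} (P : ProjectiveResolution X) (Q : ProjectiveResolution Y)
    (φ : P.complex ⟶ Q.complex) (n : ℕ) :
    S.resConn P n ≫ (F₁.mapHomologicalComplex _ ⋙
        HomologicalComplex.homologyFunctor _ _ n).map φ =
      (F₃.mapHomologicalComplex _ ⋙ HomologicalComplex.homologyFunctor _ _ (n + 1)).map φ ≫
        S.resConn Q n :=
  HomologicalComplex.HomologySequence.δ_naturality (S.complexesMap φ)
    (S.complexes_shortExact P) (S.complexes_shortExact Q) (n + 1) n (by simp)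

omit [HasProjectiveResolutions C] in
lemma resConn_comp {X : C} (P : ProjectiveResolution X) (n : ℕ) :
    S.resConn P n ≫ (HomologicalComplex.homologyFunctor D (ComplexShape.down ℕ) n).map
        ((NatTrans.mapHomologicalComplex S.f _).app P.complex) = 0 :=
  (S.complexes_shortExact P).δ_comp (n + 1) n (by simp)

omit [HasProjectiveResolutions C] in
lemma resConn_exact {X : C} (P : ProjectiveResolution X) (n : ℕ) :
    (ShortComplex.mk _ _ (S.resConn_comp P n)).Exact :=
  (S.complexes_shortExact P).homology_exact₁ (n + 1) n (by simp)

/-- The connecting morphism between left derived functors. -/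
def conn (n : ℕ) : F₃.leftDerived (n + 1) ⟶ F₁.leftDerived n where
  app X := ((projectiveResolution X).isoLeftDerivedObj F₃ (n + 1)).hom ≫
    S.resConn (projectiveResolution X) n ≫
    ((projectiveResolution X).isoLeftDerivedObj F₁ n).inv
  naturality X Y f := by
    have comm := ProjectiveResolution.lift_commutes_zero f (projectiveResolution X)
      (projectiveResolution Y)
    rw [ProjectiveResolution.isoLeftDerivedObj_hom_naturality_assoc f _ _ _ comm]
    simp only [Category.assoc]
    rw [ProjectiveResolution.isoLeftDerivedObj_inv_naturality f _ _ _ comm,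
      ← reassoc_of% S.resConn_naturality]
    rfl

variable (hF₂ : ∀ n X, IsZero ((F₂.leftDerived (n + 1)).obj X))

include hF₂ in
lemma isZero_homology {X : C} (P : ProjectiveResolution X) (n : ℕ) :
    IsZero ((S.complexes P.complex).X₂.homology (n + 1)) :=
  (hF₂ n X).of_iso (P.isoLeftDerivedObj F₂ (n + 1)).symm

include hF₂ in
lemma isIso_conn (n : ℕ) : IsIso (S.conn (n + 1)) := by
  have : ∀ X, IsIso ((S.conn (n + 1)).app X) := fun X => by
    have : IsIso (S.resConn (projectiveResolution X) (n + 1)) :=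
      (S.complexes_shortExact (projectiveResolution X)).isIso_δ _ _ _
        (S.isZero_homology hF₂ _ _) (S.isZero_homology hF₂ _ _)
    dsimp only [conn]
    infer_instance
  exact NatIso.isIso_of_isIso_app _

include hF₂ in
lemma mono_conn_zero (X : C) : Mono ((S.conn 0).app X) := by
  have : Mono (S.resConn (projectiveResolution X) 0) :=
    (S.complexes_shortExact (projectiveResolution X)).mono_δ _ _ _ (S.isZero_homology hF₂ _ _)
  exact @mono_comp _ _ _ _ _ _ _ _ (mono_comp _ _)

lemma conn_zero_comp (X : C) : (S.conn 0).app X ≫ (NatTrans.leftDerived S.f 0).app X = 0 := by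
  rw [ProjectiveResolution.leftDerived_app_eq S.f (projectiveResolution X)]
  dsimp only [conn]
  simp only [Category.assoc, Iso.inv_hom_id_assoc]
  rw [reassoc_of% S.resConn_comp]
  simp

lemma conn_zero_exact (X : C) : (ShortComplex.mk _ _ (S.conn_zero_comp X)).Exact := by
  refine (ShortComplex.exact_iff_of_iso (ShortComplex.isoMk
    ((projectiveResolution X).isoLeftDerivedObj F₃ 1)
    ((projectiveResolution X).isoLeftDerivedObj F₁ 0)
    ((projectiveResolution X).isoLeftDerivedObj F₂ 0) ?_ ?_)).2
    (S.resConn_exact (projectiveResolution X) 0)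
  · dsimp only [conn]
    simp
  · dsimp only
    rw [ProjectiveResolution.leftDerived_app_eq S.f (projectiveResolution X)]
    simp only [Category.assoc, Iso.inv_hom_id, Category.comp_id]

/-- The connecting morphism in degree zero, with values in the functor itself. -/
def connZero : F₃.leftDerived 1 ⟶ F₁ := S.conn 0 ≫ F₁.fromLeftDerivedZero

lemma leftDerived_zero_comp_fromLeftDerivedZero (X : C) :
    (NatTrans.leftDerived S.f 0).app X ≫ F₂.fromLeftDerivedZero.app X =
      F₁.fromLeftDerivedZero.app X ≫ S.f.app X := by
  rw [ProjectiveResolution.leftDerived_app_eq S.f (projectiveResolution X),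
    ProjectiveResolution.fromLeftDerivedZero_eq (projectiveResolution X),
    ProjectiveResolution.fromLeftDerivedZero_eq (projectiveResolution X)]
  simp only [Category.assoc, Iso.inv_hom_id_assoc]
  congr 1
  have h : HomologicalComplex.opcyclesMap
      ((NatTrans.mapHomologicalComplex S.f (ComplexShape.down ℕ)).app
        (projectiveResolution X).complex) 0 ≫
        (projectiveResolution X).fromLeftDerivedZero' F₂ =
      (projectiveResolution X).fromLeftDerivedZero' F₁ ≫ S.f.app X := by
    rw [← cancel_epi (HomologicalComplex.pOpcycles _ _),
      HomologicalComplex.p_opcyclesMap_assoc,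
      ProjectiveResolution.pOpcycles_comp_fromLeftDerivedZero',
      ProjectiveResolution.pOpcycles_comp_fromLeftDerivedZero'_assoc]
    exact (S.f.naturality _).symm
  refine Eq.trans ?_ (Category.assoc _ _ _).symm
  refine Eq.trans ?_ (congrArg _ h)
  exact HomologicalComplex.homologyι_naturality_assoc _ _ _

lemma connZero_comp (X : C) : S.connZero.app X ≫ S.f.app X = 0 := by
  rw [connZero, NatTrans.comp_app, Category.assoc,
    ← leftDerived_zero_comp_fromLeftDerivedZero, reassoc_of% S.conn_zero_comp, zero_comp]

lemma connZero_exact [PreservesFiniteColimits F₁] [PreservesFiniteColimits F₂] (X : C) :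
    (ShortComplex.mk _ _ (S.connZero_comp X)).Exact := by
  refine (ShortComplex.exact_iff_of_iso
    (ShortComplex.isoMk (S₁ := ShortComplex.mk _ _ (S.conn_zero_comp X))
      (S₂ := ShortComplex.mk _ _ (S.connZero_comp X)) (Iso.refl _)
    (asIso (F₁.fromLeftDerivedZero.app X)) (asIso (F₂.fromLeftDerivedZero.app X)) ?_ ?_)).1
    (S.conn_zero_exact X)
  · simp [connZero]
  · exact (S.leftDerived_zero_comp_fromLeftDerivedZero X).symm

include hF₂ in
lemma mono_connZero [PreservesFiniteColimits F₁] (X : C) : Mono (S.connZero.app X) := by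
  have := S.mono_conn_zero hF₂ X
  rw [connZero, NatTrans.comp_app]
  exact mono_comp _ _

end ProjShortExact
end ConnectingMap

noncomputable section ExtShift

universe u
variable {R : Type u} [CommRing R]

/-- The functor `Hom(-, Y)`, with values in the opposite category. -/
abbrev homOp (Y : ModuleCat.{u} R) : ModuleCat.{u} R ⥤ (ModuleCat.{u} R)ᵒᵖ :=
  ((linearYoneda R (ModuleCat.{u} R)).obj Y).rightOp

instance (Y : ModuleCat.{u} R) : PreservesFiniteColimits (homOp Y) := by
  have : PreservesLimits ((linearYoneda R (ModuleCat.{u} R)).obj Y) := by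
    have : PreservesLimits ((linearYoneda R (ModuleCat.{u} R)).obj Y ⋙ forget _) :=
      inferInstanceAs (PreservesLimits (yoneda.obj Y))
    exact preservesLimits_of_reflects_of_preserves _ (forget _)
  have : PreservesFiniteLimits ((linearYoneda R (ModuleCat.{u} R)).obj Y) := inferInstance
  exact preservesFiniteColimits_rightOp _

variable (T : ShortComplex (ModuleCat.{u} R)) (hT : T.ShortExact)

lemma homShortExact (hT : T.ShortExact) (P : ModuleCat.{u} R) [Projective P] :
    (T.map ((linearCoyoneda R (ModuleCat.{u} R)).obj (op P))).ShortExact := by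
  have := hT.mono_f
  have := hT.epi_g
  refine
    { exact := ?_
      mono_f := ?_
      epi_g := ?_ }
  · rw [ShortComplex.moduleCat_exact_iff]
    intro a ha
    exact ⟨hT.exact.lift a ha, hT.exact.lift_f a ha⟩
  · rw [ModuleCat.mono_iff_injective]
    intro a b h
    exact (cancel_mono T.f).1 h
  · rw [ModuleCat.epi_iff_surjective]
    intro a
    exact ⟨Projective.factorThru (show P ⟶ T.X₃ from a) T.g,
      Projective.factorThru_comp (show P ⟶ T.X₃ from a) T.g⟩

/-- The short exact sequence of `Hom` functors induced by a short exact sequence of modules. -/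
def homProjShortExact : ProjShortExact (homOp T.X₃) (homOp T.X₂) (homOp T.X₁) where
  f := NatTrans.rightOp ((linearYoneda R (ModuleCat.{u} R)).map T.g)
  g := NatTrans.rightOp ((linearYoneda R (ModuleCat.{u} R)).map T.f)
  zero X := by
    apply Quiver.Hom.unop_inj
    ext x
    change ((show X ⟶ T.X₁ from x) ≫ T.f) ≫ T.g = 0
    rw [Category.assoc, T.zero, comp_zero]
  shortExact P _ := (homShortExact T hT P).op

lemma isZero_leftDerived_homOp (Q : ModuleCat.{u} R) [Injective Q] (n : ℕ) (X : ModuleCat.{u} R) :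
    IsZero (((homOp Q).leftDerived (n + 1)).obj X) := by
  let P := projectiveResolution X
  refine IsZero.of_iso ?_ (P.isoLeftDerivedObj (homOp Q) (n + 1))
  refine HomologicalComplex.ExactAt.isZero_homology ?_
  rw [HomologicalComplex.exactAt_iff' _ (n + 2) (n + 1) n (by simp) (by simp)]
  have hP := (HomologicalComplex.exactAt_iff' _ (n + 2) (n + 1) n (by simp) (by simp)).1
    (P.complex_exactAt_succ n)
  rw [← ShortComplex.exact_unop_iff, ShortComplex.moduleCat_exact_iff]
  intro a ha
  exact ⟨hP.descToInjective (show P.complex.X (n + 1) ⟶ Q from a) ha,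
    hP.comp_descToInjective (show P.complex.X (n + 1) ⟶ Q from a) ha⟩

instance (n : ℕ) [Injective T.X₂] : IsIso ((homProjShortExact T hT).conn (n + 1)) :=
  (homProjShortExact T hT).isIso_conn (isZero_leftDerived_homOp T.X₂) n

/-- Dimension shifting for `Ext`. -/
def extShift (n : ℕ) [Injective T.X₂] :
    (Ext R (ModuleCat.{u} R) (n + 2)).flip.obj T.X₁ ≅
      (Ext R (ModuleCat.{u} R) (n + 1)).flip.obj T.X₃ :=
  (NatIso.ofComponents (fun X => (asIso (((homProjShortExact T hT).conn (n + 1)).app X.unop)).unop)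
    fun f => (NatTrans.leftOp ((homProjShortExact T hT).conn (n + 1))).naturality f).symm

/-- The surjection from `Hom` to the first `Ext`. -/
def homToExtOne : (linearYoneda R (ModuleCat.{u} R)).obj T.X₃ ⟶
    (Ext R (ModuleCat.{u} R) 1).flip.obj T.X₁ :=
  NatTrans.leftOp (homProjShortExact T hT).connZero

lemma homToExtOne_surjective (X : (ModuleCat.{u} R)ᵒᵖ) [Injective T.X₂] :
    Function.Surjective ((homToExtOne T hT).app X) := by
  rw [← ModuleCat.epi_iff_surjective]
  have := (homProjShortExact T hT).mono_connZero (isZero_leftDerived_homOp T.X₂) X.unop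
  exact inferInstanceAs (Epi ((homProjShortExact T hT).connZero.app X.unop).unop)

lemma homToExtOne_eq_zero_iff {X : (ModuleCat.{u} R)ᵒᵖ} (a : X.unop ⟶ T.X₃) :
    (homToExtOne T hT).app X a = 0 ↔ ∃ b : X.unop ⟶ T.X₂, b ≫ T.g = a := by
  have h := ((homProjShortExact T hT).connZero_exact X.unop).unop
  refine ⟨fun ha => (ShortComplex.moduleCat_exact_iff _).1 h a ha, ?_⟩
  rintro ⟨b, rfl⟩
  exact ConcreteCategory.congr_hom (ShortComplex.mk _ _
    ((homProjShortExact T hT).connZero_comp X.unop)).unop.zero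
    (show (linearYoneda R (ModuleCat.{u} R)).obj T.X₂ |>.obj X from b)

end ExtShift

noncomputable section LocalCohomologyShift

universe u
variable {R : Type u} [CommRing R]

/-- The submodule of elements killed by a power of the ideal `I`. -/
def powerTorsion (I : Ideal R) (M : Type*) [AddCommGroup M] [Module R M] : Submodule R M where
  carrier := {m | ∃ t : ℕ, ∀ a ∈ I ^ t, a • m = 0}
  zero_mem' := ⟨0, fun a _ => smul_zero a⟩
  add_mem' := by
    rintro x y ⟨s, hs⟩ ⟨t, ht⟩
    refine ⟨s + t, fun a ha => ?_⟩
    rw [smul_add, hs a (Ideal.pow_le_pow_right (Nat.le_add_right s t) ha),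
      ht a (Ideal.pow_le_pow_right (Nat.le_add_left t s) ha), add_zero]
  smul_mem' := by
    rintro r x ⟨s, hs⟩
    exact ⟨s, fun a ha => by rw [smul_comm, hs a ha, smul_zero]⟩

lemma colimit_iso_of_cocone {J : Type u} [SmallCategory J] [IsFiltered J]
    {G : J ⥤ ModuleCat.{u} R} (c : Cocone G)
    (hsurj : ∀ q : c.pt, ∃ j, ∃ z : G.obj j, c.ι.app j z = q)
    (hinj : ∀ j (z : G.obj j), c.ι.app j z = 0 → ∃ k, ∃ f : j ⟶ k, G.map f z = 0) :
    Nonempty (colimit G ≅ c.pt) := by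
  have h : Function.Bijective (colimit.desc G c) := by
    constructor
    · rw [injective_iff_map_eq_zero]
      intro a ha
      obtain ⟨j, z, rfl⟩ := Concrete.colimit_exists_rep G a
      have hz : c.ι.app j z = 0 := by
        rw [← ha, ← ModuleCat.comp_apply, colimit.ι_desc]
      obtain ⟨k, f, hf⟩ := hinj j z hz
      rw [← colimit.w G f, ModuleCat.comp_apply, hf, map_zero]
    · intro q
      obtain ⟨j, z, rfl⟩ := hsurj q
      exact ⟨colimit.ι G j z, by rw [← ModuleCat.comp_apply, colimit.ι_desc]⟩
  have : IsIso (colimit.desc G c) := (ConcreteCategory.isIso_iff_bijective _).2 h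
  exact ⟨asIso (colimit.desc G c)⟩

/-- Local cohomology of a module as a colimit of modules. -/
def localCohomologyObjIso (I : Ideal R) (i : ℕ) (M : ModuleCat.{u} R) :
    (localCohomology I i).obj M ≅ colimit
      ((localCohomology.ringModIdeals (localCohomology.idealPowersDiagram I)).op ⋙
        (Ext R (ModuleCat.{u} R) i).flip.obj M) :=
  have := localCohomology.hasColimitDiagram.{u, 0} (localCohomology.idealPowersDiagram I) i
  colimitObjIsoColimitCompEvaluation
    (localCohomology.diagram (localCohomology.idealPowersDiagram I) i) M

variable (T : ShortComplex (ModuleCat.{u} R)) (hT : T.ShortExact)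

lemma localCohomology_shift [Injective T.X₂] (hT : T.ShortExact) (I : Ideal R) (n : ℕ) :
    Nonempty ((localCohomology I (n + 2)).obj T.X₁ ≅ (localCohomology I (n + 1)).obj T.X₃) :=
  ⟨localCohomologyObjIso I (n + 2) T.X₁ ≪≫
    HasColimit.isoOfNatIso (Functor.isoWhiskerLeft _ (extShift T hT n)) ≪≫
    (localCohomologyObjIso I (n + 1) T.X₃).symm⟩

/-- Evaluation at `1` of a morphism from a quotient of `R` by a power of `I`. -/
def evalOne (I : Ideal R) (t : ℕ) (M : ModuleCat.{u} R) :
    (ModuleCat.of R (R ⧸ I ^ t) ⟶ M) →ₗ[R] powerTorsion I M where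
  toFun h := ⟨h (Ideal.Quotient.mk (I ^ t) 1), t, fun a ha => by
    rw [← map_smul, show a • (Ideal.Quotient.mk (I ^ t) 1) = Ideal.Quotient.mk (I ^ t) (a * 1) from
      rfl, mul_one, Ideal.Quotient.eq_zero_iff_mem.2 ha, map_zero]⟩
  map_add' _ _ := rfl
  map_smul' _ _ := rfl

/-- The morphism from a quotient of `R` determined by a torsion element. -/
def homOfTorsion {I : Ideal R} {t : ℕ} {M : ModuleCat.{u} R} (m : M)
    (hm : ∀ a ∈ I ^ t, a • m = 0) : ModuleCat.of R (R ⧸ I ^ t) ⟶ M :=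
  ModuleCat.ofHom (Submodule.liftQ (I ^ t) (LinearMap.toSpanSingleton R M m) hm)

lemma homOfTorsion_mk {I : Ideal R} {t : ℕ} {M : ModuleCat.{u} R} (m : M)
    (hm : ∀ a ∈ I ^ t, a • m = 0) (r : R) :
    homOfTorsion m hm (Ideal.Quotient.mk (I ^ t) r) = r • m := rfl

lemma quotientHom_ext {I : Ideal R} {t : ℕ} {M : ModuleCat.{u} R}
    {g h : ModuleCat.of R (R ⧸ I ^ t) ⟶ M}
    (H : g (Ideal.Quotient.mk (I ^ t) 1) = h (Ideal.Quotient.mk (I ^ t) 1)) : g = h := by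
  refine ModuleCat.hom_ext (LinearMap.ext fun x => ?_)
  obtain ⟨r, rfl⟩ := Ideal.Quotient.mk_surjective x
  have : Ideal.Quotient.mk (I ^ t) r = r • Ideal.Quotient.mk (I ^ t) 1 :=
    congrArg (Ideal.Quotient.mk (I ^ t)) (mul_one r).symm
  rw [this]
  exact (map_smul g.hom _ _).trans ((congrArg (r • ·) H).trans (map_smul h.hom _ _).symm)

/-- The quotient of torsion submodules computing the first local cohomology. -/
abbrev torsionQuotient (I : Ideal R) {M N : Type*} [AddCommGroup M] [Module R M] [AddCommGroup N]
    [Module R N] (g : M →ₗ[R] N) : Type _ :=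
  powerTorsion I N ⧸ ((powerTorsion I M).map g).submoduleOf (powerTorsion I N)

lemma exists_factor_surjective {A E Q : Type*} [AddCommGroup A] [Module R A] [AddCommGroup E]
    [Module R E] [AddCommGroup Q] [Module R Q] (p : A →ₗ[R] E) (hp : Function.Surjective p)
    (u : A →ₗ[R] Q) (h : ∀ a, p a = 0 → u a = 0) : ∃ φ : E →ₗ[R] Q, ∀ a, φ (p a) = u a :=
  ⟨(LinearMap.ker p).liftQ u h ∘ₗ (p.quotKerEquivOfSurjective hp).symm.toLinearMap, fun a => by
    rw [← p.quotKerEquivOfSurjective_apply_mk hp]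
    simp only [LinearMap.comp_apply, LinearEquiv.coe_coe, LinearEquiv.symm_apply_apply]
    exact Submodule.liftQ_apply _ _ _⟩

end LocalCohomologyShift

noncomputable section LocalCohomologyOne

variable {R : Type} [CommRing R] (T : ShortComplex (ModuleCat.{0} R))

lemma localCohomology_one [Injective T.X₂] (hT : T.ShortExact) (I : Ideal R) :
    Nonempty ((localCohomology I 1).obj T.X₁ ≅ ModuleCat.of R (torsionQuotient I T.g.hom)) := by
  let p := homToExtOne T hT
  have hp : ∀ t, Function.Surjective (p.app (op (ModuleCat.of R (R ⧸ I ^ t)))).hom := fun t =>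
    homToExtOne_surjective T hT _
  have key : ∀ (t : ℕ) (a : ModuleCat.of R (R ⧸ I ^ t) ⟶ T.X₃),
      (p.app (op (ModuleCat.of R (R ⧸ I ^ t)))).hom a = 0 →
      Submodule.mkQ (((powerTorsion I T.X₂).map T.g.hom).submoduleOf (powerTorsion I T.X₃))
        (evalOne I t T.X₃ a) = 0 := by
    intro t a ha
    obtain ⟨b, rfl⟩ := (homToExtOne_eq_zero_iff T hT a).1 ha
    rw [Submodule.mkQ_apply, Submodule.Quotient.mk_eq_zero]
    exact ⟨_, (evalOne I t T.X₂ b).2, rfl⟩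
  choose φ hφ using fun t => exists_factor_surjective
    (p.app (op (ModuleCat.of R (R ⧸ I ^ t)))).hom (hp t)
    (Submodule.mkQ (((powerTorsion I T.X₂).map T.g.hom).submoduleOf (powerTorsion I T.X₃)) ∘ₗ
      evalOne I t T.X₃) (key t)
  let G := (localCohomology.ringModIdeals (localCohomology.idealPowersDiagram I)).op ⋙
        (Ext R (ModuleCat.{0} R) 1).flip.obj T.X₁
  let c : Cocone G :=
    { pt := ModuleCat.of R (torsionQuotient I T.g.hom)
      ι :=
        { app := fun j => ModuleCat.ofHom (φ j.unop.unop)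
          naturality := fun j k f => by
            ext z
            obtain ⟨a, rfl⟩ := hp j.unop.unop z
            have := ConcreteCategory.congr_hom (p.naturality
              ((localCohomology.ringModIdeals (localCohomology.idealPowersDiagram I)).map
                f.unop).op) a
            refine (congrArg (φ k.unop.unop) this.symm).trans ((hφ _ _).trans ?_)
            exact (hφ j.unop.unop a).symm } }
  refine (colimit_iso_of_cocone c ?_ ?_).map fun e => localCohomologyObjIso I 1 T.X₁ ≪≫ e
  · intro q
    obtain ⟨⟨m, t, hm⟩, rfl⟩ := Submodule.mkQ_surjective _ q
    refine ⟨op (op t), (p.app _).hom (homOfTorsion m hm), ?_⟩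
    refine (hφ t _).trans (congrArg _ (Subtype.ext ?_))
    exact (homOfTorsion_mk m hm 1).trans (one_smul R m)
  · intro j z hz
    obtain ⟨a, rfl⟩ := hp j.unop.unop z
    have h := (hφ j.unop.unop a).symm.trans hz
    obtain ⟨q, ⟨s, hs⟩, hq⟩ := (Submodule.Quotient.mk_eq_zero _).1 h
    let r := max s j.unop.unop
    have hr : ∀ a ∈ I ^ r, a • q = 0 := fun a ha =>
      hs a (Ideal.pow_le_pow_right (le_max_left _ _) ha)
    let f : j.unop.unop ⟶ r := homOfLE (le_max_right _ _)
    refine ⟨op (op r), f.op.op, ?_⟩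
    let ρ : ModuleCat.of R (R ⧸ I ^ r) ⟶ ModuleCat.of R (R ⧸ I ^ j.unop.unop) :=
      (localCohomology.ringModIdeals (localCohomology.idealPowersDiagram I)).map f.op
    let a' : ModuleCat.of R (R ⧸ I ^ j.unop.unop) ⟶ T.X₃ := a
    have h1 : (p.app (op (ModuleCat.of R (R ⧸ I ^ r)))) (ρ ≫ a') = G.map f.op.op
        ((p.app _).hom a) := ConcreteCategory.congr_hom (p.naturality ρ.op) a
    refine h1.symm.trans ((homToExtOne_eq_zero_iff T hT (ρ ≫ a')).2 ⟨homOfTorsion q hr, ?_⟩)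
    refine quotientHom_ext ?_
    refine (congrArg T.g.hom (homOfTorsion_mk q hr 1)).trans ?_
    rw [one_smul, hq]
    rfl

end LocalCohomologyOne

noncomputable section Cosyzygy

variable {R : Type} [CommRing R]

/-- The cokernel of an embedding into an injective module. -/
def injectiveCokernel (M : ModuleCat.{0} R) : ModuleCat.{0} R :=
  ModuleCat.of R (((Injective.under M : ModuleCat.{0} R) : Type) ⧸
    LinearMap.range (Injective.ι M).hom)

/-- The iterated cosyzygies of a module. -/
def cosyzygy (M : ModuleCat.{0} R) : ℕ → ModuleCat.{0} R
  | 0 => M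
  | j + 1 => injectiveCokernel (cosyzygy M j)

/-- The short exact sequence defining a cosyzygy. -/
def cosyzygySeq (M : ModuleCat.{0} R) (j : ℕ) : ShortComplex (ModuleCat.{0} R) where
  X₁ := cosyzygy M j
  X₂ := Injective.under (cosyzygy M j)
  X₃ := cosyzygy M (j + 1)
  f := Injective.ι (cosyzygy M j)
  g := ModuleCat.ofHom (LinearMap.range (Injective.ι (cosyzygy M j)).hom).mkQ
  zero := by
    refine ModuleCat.hom_ext (LinearMap.ext fun x => ?_)
    exact (Submodule.Quotient.mk_eq_zero _).2 (LinearMap.mem_range_self _ x)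

instance (M : ModuleCat.{0} R) (j : ℕ) : Injective (cosyzygySeq M j).X₂ :=
  inferInstanceAs (Injective (Injective.under (cosyzygy M j)))

lemma cosyzygySeq_shortExact (M : ModuleCat.{0} R) (j : ℕ) : (cosyzygySeq M j).ShortExact where
  exact := (ShortComplex.moduleCat_exact_iff _).2 fun _ hx =>
    (Submodule.Quotient.mk_eq_zero (LinearMap.range (Injective.ι (cosyzygy M j)).hom)).1 hx
  mono_f := inferInstanceAs (Mono (Injective.ι (cosyzygy M j)))
  epi_g := (ModuleCat.epi_iff_surjective _).2 (Submodule.mkQ_surjective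
    (LinearMap.range (Injective.ι (cosyzygy M j)).hom))

lemma localCohomology_cosyzygy (M : ModuleCat.{0} R) (I : Ideal R) (n j : ℕ) :
    Nonempty ((localCohomology I (n + 1)).obj (cosyzygy M j) ≅
      ModuleCat.of R (torsionQuotient I (cosyzygySeq M (n + j)).g.hom)) := by
  induction n generalizing j with
  | zero =>
    rw [Nat.zero_add, Nat.zero_add]
    exact localCohomology_one _ (cosyzygySeq_shortExact M j) I
  | succ n ih =>
    obtain ⟨e⟩ := localCohomology_shift _ (cosyzygySeq_shortExact M j) I n
    obtain ⟨e'⟩ := ih (j + 1)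
    rw [Nat.add_right_comm n 1 j, Nat.add_assoc n j 1]
    exact ⟨e ≪≫ e'⟩

end Cosyzygy

section ListTorsion

variable {S : Type*} [CommRing S]

/-- Elements killed by a power of each member of a list. -/
def listTorsion (l : List S) (M : Type*) [AddCommGroup M] [Module S M] : Submodule S M where
  carrier := {m | ∀ f ∈ l, ∃ t : ℕ, f ^ t • m = 0}
  zero_mem' := fun _ _ => ⟨0, smul_zero _⟩
  add_mem' := by
    intro x y hx hy f hf
    obtain ⟨s, hs⟩ := hx f hf
    obtain ⟨t, ht⟩ := hy f hf
    refine ⟨s + t, ?_⟩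
    rw [smul_add, pow_add, mul_smul _ _ y, ht, smul_zero, mul_comm, mul_smul, hs, smul_zero,
      add_zero]
  smul_mem' := by
    intro r x hx f hf
    obtain ⟨s, hs⟩ := hx f hf
    exact ⟨s, by rw [smul_comm, hs, smul_zero]⟩

variable {M N : Type*} [AddCommGroup M] [Module S M] [AddCommGroup N] [Module S N]

lemma listTorsion_cons {a : S} {l : List S} {m : M} :
    m ∈ listTorsion (a :: l) M ↔ (∃ t : ℕ, a ^ t • m = 0) ∧ m ∈ listTorsion l M :=
  List.forall_mem_cons

lemma map_mem_listTorsion {l : List S} (g : M →ₗ[S] N) {m : M} (hm : m ∈ listTorsion l M) :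
    g m ∈ listTorsion l N := fun f hf =>
  let ⟨t, ht⟩ := hm f hf
  ⟨t, by rw [← map_smul, ht, map_zero]⟩

lemma mem_listTorsion_of_map {l : List S} (g : M →ₗ[S] N) (hg : Function.Injective g) {m : M}
    (hm : g m ∈ listTorsion l N) : m ∈ listTorsion l M := fun f hf =>
  let ⟨t, ht⟩ := hm f hf
  ⟨t, hg (by rw [map_smul, ht, map_zero])⟩

lemma listTorsion_eq_powerTorsion (l : List S) :
    listTorsion l M = powerTorsion (Ideal.span {f : S | f ∈ l}) M := by
  ext m
  constructor
  · intro hm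
    obtain ⟨k, hk⟩ := Ideal.exists_pow_le_of_le_radical_of_fg
      (J := LinearMap.ker (LinearMap.toSpanSingleton S M m)) (I := Ideal.span {f : S | f ∈ l}) (by
        rw [Ideal.span_le]
        intro f hf
        obtain ⟨t, ht⟩ := hm f hf
        exact ⟨t, ht⟩) (Submodule.fg_span l.finite_toSet)
    exact ⟨k, fun a ha => hk ha⟩
  · rintro ⟨t, ht⟩ f hf
    exact ⟨t, ht _ (Ideal.pow_mem_pow (Ideal.subset_span (show f ∈ {f : S | f ∈ l} from hf)) t)⟩

end ListTorsion

section Divisible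

lemma exists_extend_of_injective {S : Type} [CommRing S] {A Y Q : Type} [AddCommGroup A]
    [Module S A] [AddCommGroup Y] [Module S Y] [AddCommGroup Q] [Module S Q]
    [Module.Injective S Q] (p : A →ₗ[S] Y) (u : A →ₗ[S] Q) (h : LinearMap.ker p ≤ LinearMap.ker u) :
    ∃ g : Y →ₗ[S] Q, ∀ a, g (p a) = u a := by
  obtain ⟨g, hg⟩ := Module.Injective.out ((LinearMap.ker p).liftQ p le_rfl)
    (LinearMap.ker_eq_bot.1 (Submodule.ker_liftQ_eq_bot _ _ _ le_rfl)) ((LinearMap.ker p).liftQ u h)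
  exact ⟨g, fun a => hg (Submodule.Quotient.mk a)⟩

lemma exists_smul_eq_of_mem_listTorsion {S : Type} [CommRing S] [IsDomain S] [IsNoetherianRing S]
    {Q : Type} [AddCommGroup Q] [Module S Q] [Module.Injective S Q] {l : List S} {a : S}
    (ha : a ≠ 0) {q : Q} (hq : q ∈ listTorsion l Q) : ∃ q' ∈ listTorsion l Q, a • q' = q := by
  rw [listTorsion_eq_powerTorsion] at hq ⊢
  obtain ⟨t, ht⟩ := hq
  set J := Ideal.span {f : S | f ∈ l}
  obtain ⟨k, hk⟩ := Ideal.exists_pow_inf_eq_pow_smul J (Ideal.span {a} : Submodule S S)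
  have hk := hk (k + t) (Nat.le_add_right k t)
  rw [Nat.add_sub_cancel_left] at hk
  obtain ⟨g, hg⟩ := exists_extend_of_injective
    (LinearMap.toSpanSingleton S (S ⧸ J ^ (k + t)) (Ideal.Quotient.mk _ a))
    (LinearMap.toSpanSingleton S Q q) (by
      intro r hr
      have hra : r * a ∈ J ^ (k + t) := Ideal.Quotient.eq_zero_iff_mem.1 hr
      have h1 : r * a ∈ (J ^ t • (Ideal.span {a} : Submodule S S) : Submodule S S) := by
        refine Submodule.smul_mono le_rfl inf_le_right (hk.le ⟨?_, ?_⟩)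
        · simpa using hra
        · exact Ideal.mul_mem_left _ _ (Ideal.mem_span_singleton_self a)
      rw [smul_eq_mul, mul_comm, Ideal.mem_span_singleton_mul] at h1
      obtain ⟨b, hb, hab⟩ := h1
      have : b = r := mul_left_cancel₀ ha (hab.trans (mul_comm _ _))
      exact ht r (this ▸ hb))
  refine ⟨g (Ideal.Quotient.mk _ 1), ⟨k + t, fun b hb => ?_⟩, ?_⟩
  · rw [← map_smul, show b • (Ideal.Quotient.mk (J ^ (k + t)) 1) = Ideal.Quotient.mk _ (b * 1) from
      rfl, mul_one, Ideal.Quotient.eq_zero_iff_mem.2 hb, map_zero]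
  · rw [← map_smul, show a • (Ideal.Quotient.mk (J ^ (k + t)) 1) = Ideal.Quotient.mk _ (a * 1) from
      rfl, mul_one]
    simpa using hg 1

end Divisible

end Homological

section LocalizedParts

variable {S : Type*} [CommRing S] {V : Type*} [AddCommGroup V] [Module S V]

/-- The elements carried into a submodule by a power of `a`. -/
def Submodule.divPow (a : S) (N : Submodule S V) : Submodule S V where
  carrier := {x | ∃ t : ℕ, a ^ t • x ∈ N}
  zero_mem' := ⟨0, by simp⟩
  add_mem' := by
    rintro x y ⟨s, hs⟩ ⟨t, ht⟩
    refine ⟨s + t, ?_⟩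
    rw [smul_add]
    refine N.add_mem ?_ ?_
    · rw [add_comm, pow_add, mul_smul]
      exact N.smul_mem _ hs
    · rw [pow_add, mul_smul]
      exact N.smul_mem _ ht
  smul_mem' := by
    rintro r x ⟨s, hs⟩
    exact ⟨s, by rw [smul_comm]; exact N.smul_mem _ hs⟩

lemma Submodule.mem_divPow {a : S} {N : Submodule S V} {x : V} :
    x ∈ N.divPow a ↔ ∃ t : ℕ, a ^ t • x ∈ N := Iff.rfl

variable (F : Type*) [Field F] [Algebra S F]

/-- The localization at the product of a list, inside the fraction field. -/
def localizedPart : List S → Submodule S F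
  | [] => LinearMap.range (Algebra.linearMap S F)
  | a :: l => (localizedPart l).divPow a

/-- The sum of the localizations at the products of all but one element of a list. -/
def boundaryPart : List S → Submodule S F
  | [] => ⊥
  | a :: l => (boundaryPart l).divPow a ⊔ localizedPart F l

end LocalizedParts

/-- A sequence of short exact sequences `0 → M j → Q j → M (j + 1) → 0` with injective middle
terms, starting at the ring. -/
structure InjectiveTower (S : Type) [CommRing S] where
  M : ℕ → Type
  Q : ℕ → Type
  [groupM : ∀ j, AddCommGroup (M j)]
  [groupQ : ∀ j, AddCommGroup (Q j)]
  [moduleM : ∀ j, Module S (M j)]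
  [moduleQ : ∀ j, Module S (Q j)]
  [injective : ∀ j, Module.Injective S (Q j)]
  ι : ∀ j, M j →ₗ[S] Q j
  π : ∀ j, Q j →ₗ[S] M (j + 1)
  ι_injective : ∀ j, Function.Injective (ι j)
  π_surjective : ∀ j, Function.Surjective (π j)
  π_ι : ∀ j m, π j (ι j m) = 0
  exact : ∀ j q, π j q = 0 → ∃ m, ι j m = q
  e : S ≃ₗ[S] M 0

namespace InjectiveTower

attribute [instance] groupM groupQ moduleM moduleQ injective

variable {S : Type} [CommRing S] (T : InjectiveTower S) (F : Type) [Field F] [Algebra S F]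

/-- The image of the torsion of the previous injective module. -/
def boundary : (l : List S) → Submodule S (T.M l.length)
  | [] => ⊥
  | a :: l => (listTorsion (a :: l) (T.Q l.length)).map (T.π l.length)

/-- The correspondence between fractions and torsion elements of a cosyzygy. -/
def rel : (l : List S) → Submodule S (F × T.M l.length)
  | [] => LinearMap.range ((Algebra.linearMap S F).prod T.e.toLinearMap)
  | a :: l =>
    { carrier := {z | ∃ t : ℕ, ∃ m, ∃ q ∈ listTorsion l (T.Q l.length),
        (a ^ t • z.1, m) ∈ rel l ∧ a ^ t • q = T.ι l.length m ∧ T.π l.length q = z.2}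
      zero_mem' := ⟨0, 0, 0, Submodule.zero_mem _, by
        rw [Prod.fst_zero, smul_zero]
        exact ⟨(rel l).zero_mem, by rw [smul_zero, map_zero], map_zero _⟩⟩
      add_mem' := by
        rintro ⟨x, b⟩ ⟨y, c⟩ ⟨s, m, q, hq, hm, hqm, hb⟩ ⟨t, m', q', hq', hm', hqm', hc⟩
        refine ⟨s + t, a ^ t • m + a ^ s • m', q + q', Submodule.add_mem _ hq hq', ?_, ?_, ?_⟩
        · convert (rel l).add_mem ((rel l).smul_mem (a ^ t) hm) ((rel l).smul_mem (a ^ s) hm')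
            using 1
          simp only [Prod.smul_mk, Prod.mk_add_mk, smul_smul, ← pow_add, smul_add]
          rw [add_comm t s]
        · rw [map_add, map_smul, map_smul, ← hqm, ← hqm', smul_smul, smul_smul, ← pow_add,
            ← pow_add, smul_add, add_comm t s]
        · rw [map_add, hb, hc]
          rfl
      smul_mem' := by
        rintro r ⟨x, b⟩ ⟨t, m, q, hq, hm, hqm, hb⟩
        refine ⟨t, r • m, r • q, Submodule.smul_mem _ _ hq, ?_, ?_, ?_⟩
        · convert (rel l).smul_mem r hm using 1
          simp only [Prod.smul_mk]
          rw [smul_comm]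
        · rw [map_smul, ← hqm, smul_comm]
        · rw [map_smul, hb]
          rfl }

variable {T F}

lemma mem_rel_cons {a : S} {l : List S} {x : F} {b : T.M (l.length + 1)} :
    (x, b) ∈ T.rel F (a :: l) ↔ ∃ t : ℕ, ∃ m, ∃ q ∈ listTorsion l (T.Q l.length),
        (a ^ t • x, m) ∈ T.rel F l ∧ a ^ t • q = T.ι l.length m ∧ T.π l.length q = b :=
  Iff.rfl

lemma rel_fst_mem (l : List S) {x : F} {b : T.M l.length} (h : (x, b) ∈ T.rel F l) :
    x ∈ localizedPart F l := by
  induction l generalizing x with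
  | nil =>
    obtain ⟨s, hs⟩ := h
    exact ⟨s, congrArg Prod.fst hs⟩
  | cons a l ih =>
    obtain ⟨t, m, q, -, hm, -⟩ := mem_rel_cons.1 h
    exact ⟨t, ih hm⟩

lemma rel_snd_mem (l : List S) {x : F} {b : T.M l.length} (h : (x, b) ∈ T.rel F l) :
    b ∈ listTorsion l (T.M l.length) := by
  cases l with
  | nil => exact fun f hf => by simp at hf
  | cons a l =>
    obtain ⟨t, m, q, hq, hm, hqm, rfl⟩ := mem_rel_cons.1 h
    refine listTorsion_cons.2 ⟨⟨t, ?_⟩, map_mem_listTorsion _ hq⟩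
    refine (map_smul (T.π l.length) _ _).symm.trans ?_
    rw [hqm, T.π_ι]

lemma boundary_le (l : List S) : T.boundary l ≤ listTorsion l (T.M l.length) := by
  cases l with
  | nil => exact bot_le
  | cons a l =>
    rintro _ ⟨q, hq, rfl⟩
    exact map_mem_listTorsion _ hq

variable [IsDomain S] [IsNoetherianRing S]

lemma boundary_divisible (l : List S) {c : S} (hc : c ≠ 0) {b : T.M l.length}
    (hb : b ∈ T.boundary l) : ∃ b' ∈ T.boundary l, c • b' = b := by
  cases l with
  | nil => exact ⟨0, Submodule.zero_mem _, (smul_zero c).trans ((Submodule.mem_bot S).1 hb).symm⟩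
  | cons a l =>
    obtain ⟨q, hq, rfl⟩ := hb
    obtain ⟨q', hq', rfl⟩ := exists_smul_eq_of_mem_listTorsion hc hq
    exact ⟨_, ⟨q', hq', rfl⟩, (map_smul (T.π l.length) _ _).symm⟩

/-- Torsion elements of high cosyzygies lift to torsion elements. -/
lemma exists_torsion_lift (l : List S) (hl : ∀ f ∈ l, f ≠ 0) (j : ℕ) (hj : l.length ≤ j)
    {b : T.M (j + 1)} (hb : b ∈ listTorsion l (T.M (j + 1))) :
    ∃ q ∈ listTorsion l (T.Q j), T.π j q = b := by
  induction l generalizing j with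
  | nil =>
    obtain ⟨q, rfl⟩ := T.π_surjective j b
    exact ⟨q, fun f hf => by simp at hf, rfl⟩
  | cons a l ih =>
    have ha : a ≠ 0 := hl a List.mem_cons_self
    have hl' : ∀ f ∈ l, f ≠ 0 := fun f hf => hl f (List.mem_cons_of_mem _ hf)
    obtain _ | j := j
    · simp at hj
    have hj' : l.length ≤ j := Nat.le_of_succ_le_succ hj
    obtain ⟨⟨t, ht⟩, hb'⟩ := listTorsion_cons.1 hb
    obtain ⟨q, hq, rfl⟩ := ih hl' (j + 1) (hj'.trans (Nat.le_succ j)) hb'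
    rw [← map_smul] at ht
    obtain ⟨m, hm⟩ := T.exact _ _ ht
    have hmt : m ∈ listTorsion l (T.M (j + 1)) := mem_listTorsion_of_map _ (T.ι_injective _)
      (hm ▸ Submodule.smul_mem _ _ hq)
    obtain ⟨q₁, hq₁, rfl⟩ := ih hl' j hj' hmt
    obtain ⟨q₂, hq₂, rfl⟩ := exists_smul_eq_of_mem_listTorsion (pow_ne_zero t ha) hq₁
    refine ⟨q - T.ι _ (T.π _ q₂), listTorsion_cons.2 ⟨⟨t, ?_⟩, Submodule.sub_mem _ hq
      (map_mem_listTorsion _ (map_mem_listTorsion _ hq₂))⟩, ?_⟩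
    · rw [smul_sub, ← map_smul, ← map_smul, hm, sub_self]
    · rw [map_sub, T.π_ι, sub_zero]

lemma exists_rel_of_fst (l : List S) (hl : ∀ f ∈ l, f ≠ 0) {x : F}
    (hx : x ∈ localizedPart F l) : ∃ b, (x, b) ∈ T.rel F l := by
  induction l generalizing x with
  | nil =>
    obtain ⟨s, rfl⟩ := hx
    exact ⟨T.e s, s, rfl⟩
  | cons a l ih =>
    obtain ⟨t, ht⟩ := hx
    obtain ⟨m, hm⟩ := ih (fun f hf => hl f (List.mem_cons_of_mem _ hf)) ht
    obtain ⟨q, hq, hqm⟩ := exists_smul_eq_of_mem_listTorsion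
      (pow_ne_zero t (hl a List.mem_cons_self))
      (map_mem_listTorsion (T.ι l.length) (rel_snd_mem l hm))
    exact ⟨T.π _ q, mem_rel_cons.2 ⟨t, m, q, hq, hm, hqm, rfl⟩⟩

variable [FaithfulSMul S F]

lemma exists_rel_of_snd (l : List S) (hl : ∀ f ∈ l, f ≠ 0) {b : T.M l.length}
    (hb : b ∈ listTorsion l (T.M l.length)) : ∃ x, (x, b) ∈ T.rel F l := by
  induction l with
  | nil =>
    obtain ⟨s, rfl⟩ := T.e.surjective b
    exact ⟨algebraMap S F s, s, rfl⟩
  | cons a l ih =>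
    have hl' : ∀ f ∈ l, f ≠ 0 := fun f hf => hl f (List.mem_cons_of_mem _ hf)
    obtain ⟨⟨t, ht⟩, hb'⟩ := listTorsion_cons.1 hb
    obtain ⟨q, hq, rfl⟩ := exists_torsion_lift l hl' l.length le_rfl hb'
    replace ht : T.π l.length (a ^ t • q) = 0 := (map_smul (T.π l.length) _ _).trans ht
    obtain ⟨m, hm⟩ := T.exact _ _ ht
    obtain ⟨y, hy⟩ := ih hl' (b := m) (mem_listTorsion_of_map _ (T.ι_injective _)
      (hm ▸ Submodule.smul_mem _ _ hq))
    have ha : algebraMap S F (a ^ t) ≠ 0 := by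
      rw [Ne, FaithfulSMul.algebraMap_eq_zero_iff S F]
      exact pow_ne_zero t (hl a List.mem_cons_self)
    refine ⟨(algebraMap S F (a ^ t))⁻¹ * y, mem_rel_cons.2 ⟨t, m, q, hq, ?_, hm.symm, rfl⟩⟩
    rw [Algebra.smul_def, mul_inv_cancel_left₀ ha]
    exact hy

lemma rel_boundary_iff (l : List S) (hl : ∀ f ∈ l, f ≠ 0) {x : F} {b : T.M l.length}
    (h : (x, b) ∈ T.rel F l) : x ∈ boundaryPart F l ↔ b ∈ T.boundary l := by
  induction l generalizing x with
  | nil =>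
    obtain ⟨s, hs⟩ := h
    obtain ⟨rfl, rfl⟩ := Prod.ext_iff.1 hs
    refine (Submodule.mem_bot S).trans (Iff.trans ?_ (Submodule.mem_bot S).symm)
    exact (FaithfulSMul.algebraMap_eq_zero_iff S F).trans T.e.map_eq_zero_iff.symm
  | cons a l ih =>
    have hl' : ∀ f ∈ l, f ≠ 0 := fun f hf => hl f (List.mem_cons_of_mem _ hf)
    have ha : a ≠ 0 := hl a List.mem_cons_self
    obtain ⟨t, m, q, hq, hm, hqm, rfl⟩ := mem_rel_cons.1 h
    constructor
    · intro hx
      obtain ⟨y, ⟨s, hs⟩, z, hz, rfl⟩ := Submodule.mem_sup.1 hx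
      obtain ⟨m', hm'⟩ := exists_rel_of_fst (T := T) l hl' hz
      have h1 := (T.rel F l).sub_mem ((T.rel F l).smul_mem (a ^ s) hm)
        ((T.rel F l).smul_mem (a ^ (s + t)) hm')
      have h2 := (ih hl' h1).1 (by
        have : a ^ s • a ^ t • (y + z) - a ^ (s + t) • z = a ^ t • a ^ s • y := by
          rw [smul_smul, ← pow_add, smul_add, add_sub_cancel_right, add_comm, pow_add, mul_smul]
        exact this ▸ Submodule.smul_mem _ _ hs)
      obtain ⟨β, hβ, hβm⟩ := boundary_divisible l (pow_ne_zero (s + t) ha) h2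
      have hβm : a ^ (s + t) • β = a ^ s • m - a ^ (s + t) • m' := hβm
      refine ⟨q - T.ι _ (m' + β), listTorsion_cons.2 ⟨⟨s + t, ?_⟩, Submodule.sub_mem _ hq
        (map_mem_listTorsion _ (Submodule.add_mem _ (rel_snd_mem l hm') (boundary_le l hβ)))⟩, ?_⟩
      · rw [smul_sub, ← map_smul, smul_add, hβm, add_sub_cancel, map_smul, ← hqm, smul_smul,
          pow_add, sub_self]
      · refine (map_sub (T.π l.length) _ _).trans ?_
        rw [T.π_ι, sub_zero]
    · rintro ⟨q', hq', hqq⟩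
      obtain ⟨⟨s, hs⟩, hq'l⟩ := listTorsion_cons.1 hq'
      have hqq : T.π l.length q' = T.π l.length q := hqq
      obtain ⟨m', hm'⟩ := T.exact l.length (q - q') (by rw [map_sub, hqq, sub_self])
      have hm't := mem_listTorsion_of_map _ (T.ι_injective _)
        (hm' ▸ Submodule.sub_mem _ hq hq'l : T.ι l.length m' ∈ listTorsion l _)
      obtain ⟨z, hz⟩ := exists_rel_of_snd (F := F) l hl' hm't
      have hmm : a ^ s • m - a ^ (s + t) • m' = 0 := by
        refine T.ι_injective _ ?_
        rw [map_sub, map_smul, map_smul, hm', ← hqm, smul_sub, smul_smul, ← pow_add,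
          add_comm s t, pow_add _ t s, mul_smul _ _ q', hs, smul_zero, sub_zero, sub_self, map_zero]
      have h1 := (T.rel F l).sub_mem ((T.rel F l).smul_mem (a ^ s) hm)
        ((T.rel F l).smul_mem (a ^ (s + t)) hz)
      have h2 := (ih hl' h1).2 (by
        change a ^ s • m - a ^ (s + t) • m' ∈ _
        exact hmm ▸ Submodule.zero_mem _)
      have h3 : a ^ (s + t) • (x - z) ∈ boundaryPart F l := by
        rw [smul_sub, pow_add, mul_smul _ _ x]
        rw [pow_add] at h2
        exact h2
      exact Submodule.mem_sup.2 ⟨x - z, ⟨s + t, h3⟩, z, rel_fst_mem l hz, sub_add_cancel x z⟩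

end InjectiveTower

section Tower

open CategoryTheory Limits Opposite

lemma Submodule.quotientEquiv_of_rel {S V W : Type*} [CommRing S] [AddCommGroup V] [Module S V]
    [AddCommGroup W] [Module S W] {A A' : Submodule S V} {B B' : Submodule S W}
    (R : Submodule S (V × W)) (h₁ : ∀ x b, (x, b) ∈ R → x ∈ A) (h₂ : ∀ x b, (x, b) ∈ R → b ∈ B)
    (h₃ : ∀ x ∈ A, ∃ b, (x, b) ∈ R) (h₄ : ∀ b ∈ B, ∃ x, (x, b) ∈ R)
    (h₅ : ∀ x b, (x, b) ∈ R → (x ∈ A' ↔ b ∈ B')) :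
    Nonempty ((A ⧸ A'.submoduleOf A) ≃ₗ[S] (B ⧸ B'.submoduleOf B)) := by
  let p : R →ₗ[S] A := ((LinearMap.fst S V W).comp R.subtype).codRestrict A
    fun z => h₁ _ _ z.2
  let q : R →ₗ[S] B := ((LinearMap.snd S V W).comp R.subtype).codRestrict B
    fun z => h₂ _ _ z.2
  have hp : Function.Surjective ((A'.submoduleOf A).mkQ ∘ₗ p) :=
    (Submodule.mkQ_surjective _).comp fun x =>
      let ⟨b, hb⟩ := h₃ _ x.2
      ⟨⟨(x, b), hb⟩, rfl⟩
  have hq : Function.Surjective ((B'.submoduleOf B).mkQ ∘ₗ q) :=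
    (Submodule.mkQ_surjective _).comp fun b =>
      let ⟨x, hx⟩ := h₄ _ b.2
      ⟨⟨(x, b), hx⟩, rfl⟩
  have hker : LinearMap.ker ((A'.submoduleOf A).mkQ ∘ₗ p) =
      LinearMap.ker ((B'.submoduleOf B).mkQ ∘ₗ q) := by
    ext ⟨⟨x, b⟩, hz⟩
    simp only [LinearMap.mem_ker, LinearMap.comp_apply, Submodule.mkQ_apply,
      Submodule.Quotient.mk_eq_zero]
    exact h₅ x b hz
  exact ⟨(LinearMap.quotKerEquivOfSurjective _ hp).symm ≪≫ₗ Submodule.quotEquivOfEq _ _ hker ≪≫ₗ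
    LinearMap.quotKerEquivOfSurjective _ hq⟩

/-- The tower of cosyzygies of a ring. -/
noncomputable def cosyzygyTower (S : Type) [CommRing S] : InjectiveTower S where
  M := fun j => cosyzygy (ModuleCat.of S S) j
  Q := fun j => (cosyzygySeq (ModuleCat.of S S) j).X₂
  injective := fun j => Module.injective_module_of_injective_object S _
    (inj := (inferInstance : Injective (cosyzygySeq (ModuleCat.of S S) j).X₂))
  ι := fun j => (cosyzygySeq (ModuleCat.of S S) j).f.hom
  π := fun j => (cosyzygySeq (ModuleCat.of S S) j).g.hom
  ι_injective := fun j => (ModuleCat.mono_iff_injective _).1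
    (cosyzygySeq_shortExact (ModuleCat.of S S) j).mono_f
  π_surjective := fun j => (ModuleCat.epi_iff_surjective _).1
    (cosyzygySeq_shortExact (ModuleCat.of S S) j).epi_g
  π_ι := fun j m => ConcreteCategory.congr_hom (cosyzygySeq (ModuleCat.of S S) j).zero m
  exact := fun j q hq => (ShortComplex.moduleCat_exact_iff _).1
    (cosyzygySeq_shortExact (ModuleCat.of S S) j).exact q hq
  e := LinearEquiv.refl S S

/-- The torsion quotient in terms of generators of the ideal. -/
noncomputable def torsionQuotientEquiv {S : Type} [CommRing S] (l : List S) {M N : Type*}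
    [AddCommGroup M] [Module S M] [AddCommGroup N] [Module S N] (g : M →ₗ[S] N) :
    torsionQuotient (Ideal.span {f : S | f ∈ l}) g ≃ₗ[S]
      (listTorsion l N ⧸ ((listTorsion l M).map g).submoduleOf (listTorsion l N)) := by
  rw [listTorsion_eq_powerTorsion, listTorsion_eq_powerTorsion]

/-- Local cohomology of a Noetherian domain in cohomological degree the number of generators. -/
lemma localCohomology_top {S : Type} [CommRing S] [IsDomain S] [IsNoetherianRing S]
    (F : Type) [Field F] [Algebra S F] [FaithfulSMul S F] (l : List S) (hl : ∀ f ∈ l, f ≠ 0)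
    (hl0 : l ≠ []) :
    Nonempty ((localCohomology (Ideal.span {f : S | f ∈ l}) l.length).obj (ModuleCat.of S S) ≅
      ModuleCat.of S (localizedPart F l ⧸ (boundaryPart F l).submoduleOf (localizedPart F l))) := by
  obtain _ | ⟨a, l⟩ := l
  · exact absurd rfl hl0
  obtain ⟨e⟩ := localCohomology_cosyzygy (ModuleCat.of S S)
    (Ideal.span {f : S | f ∈ a :: l}) l.length 0
  obtain ⟨e'⟩ := Submodule.quotientEquiv_of_rel (A := localizedPart F (a :: l))
    (A' := boundaryPart F (a :: l)) (B := listTorsion (a :: l) _)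
    (B' := (cosyzygyTower S).boundary (a :: l)) ((cosyzygyTower S).rel F (a :: l))
    (fun _ _ h => InjectiveTower.rel_fst_mem _ h) (fun _ _ h => InjectiveTower.rel_snd_mem _ h)
    (fun _ h => InjectiveTower.exists_rel_of_fst _ hl h)
    (fun _ h => InjectiveTower.exists_rel_of_snd _ hl h)
    (fun _ _ h => InjectiveTower.rel_boundary_iff _ hl h)
  let e'' : ModuleCat.of S (torsionQuotient (Ideal.span {f : S | f ∈ a :: l})
      (cosyzygySeq (ModuleCat.of S S) (l.length + 0)).g.hom) ≅ _ :=
    (torsionQuotientEquiv (a :: l) (cosyzygySeq (ModuleCat.of S S) l.length).g.hom ≪≫ₗ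
      e'.symm).toModuleIso
  exact ⟨e ≪≫ e''⟩

end Tower

open MvPolynomial

section DerivationExtension

variable {K S F : Type*} [Field K] [CommRing S] [Algebra K S] [Field F] [Algebra S F] [Algebra K F]
  [IsScalarTower K S F] [IsFractionRing S F]

omit [Algebra K S] [IsScalarTower K S F] in
lemma Derivation.ext_of_isFractionRing [IsDomain S] {D D' : Derivation K F F}
    (h : ∀ s, D (algebraMap S F s) = D' (algebraMap S F s)) : D = D' := by
  ext x
  obtain ⟨s, t, ht, rfl⟩ := IsFractionRing.div_surjective (A := S) x
  have ht0 : algebraMap S F t ≠ 0 := IsLocalization.to_map_ne_zero_of_mem_nonZeroDivisors F le_rfl ht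
  have key : ∀ E : Derivation K F F, algebraMap S F t * E (algebraMap S F s / algebraMap S F t) =
      E (algebraMap S F s) - algebraMap S F s / algebraMap S F t * E (algebraMap S F t) := by
    intro E
    have := E.leibniz (algebraMap S F t) (algebraMap S F s / algebraMap S F t)
    rw [mul_div_cancel₀ _ ht0, smul_eq_mul, smul_eq_mul] at this
    rw [this]
    ring
  exact mul_left_cancel₀ ht0 (by rw [key, key, h, h])

/-- A derivation extends to the fraction field. -/
lemma Derivation.exists_extension (d : Derivation K S S) :
    ∃ D : Derivation K F F, ∀ s, D (algebraMap S F s) = algebraMap S F (d s) := by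
  let f : S →ₐ[K] TrivSqZeroExt F F :=
    { toFun := fun s => TrivSqZeroExt.inl (algebraMap S F s) +
        TrivSqZeroExt.inr (algebraMap S F (d s))
      map_one' := by simp
      map_zero' := by simp
      map_mul' := fun x y => by
        refine TrivSqZeroExt.ext ?_ ?_
        · simp
        · simp only [map_mul, TrivSqZeroExt.snd_mul, TrivSqZeroExt.fst_add, TrivSqZeroExt.snd_add,
            TrivSqZeroExt.fst_inl, TrivSqZeroExt.snd_inl, TrivSqZeroExt.fst_inr,
            TrivSqZeroExt.snd_inr, op_smul_eq_smul, smul_eq_mul, Derivation.leibniz, map_add,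
            zero_add, add_zero]
      map_add' := fun x y => by
        refine TrivSqZeroExt.ext ?_ ?_ <;> simp [Algebra.smul_def]
      commutes' := fun c => by
        refine TrivSqZeroExt.ext ?_ ?_
        · simp [TrivSqZeroExt.algebraMap_eq_inl', ← IsScalarTower.algebraMap_apply]
        · simp [TrivSqZeroExt.algebraMap_eq_inl'] }
  have hf : ∀ y : nonZeroDivisors S, IsUnit (f y) := fun y => by
    rw [TrivSqZeroExt.isUnit_iff_isUnit_fst]
    have : (f y).fst = algebraMap S F y := by simp [f]
    rw [this]
    exact IsLocalization.map_units F y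
  let g : F →ₐ[K] TrivSqZeroExt F F := IsLocalization.liftAlgHom (f := f) (M := nonZeroDivisors S) hf
  have hg : ∀ s, g (algebraMap S F s) = f s := fun s => IsLocalization.lift_eq hf s
  have hfst : ∀ x, (g x).fst = x := by
    intro x
    have : ((TrivSqZeroExt.fstHom K F F).comp g) = AlgHom.id K F := by
      refine IsLocalization.algHom_ext (nonZeroDivisors S) (AlgHom.ext fun s => ?_)
      change (g (algebraMap S F s)).fst = algebraMap S F s
      rw [hg]
      simp [f]
    exact DFunLike.congr_fun this x
  refine ⟨Derivation.mk' ((TrivSqZeroExt.sndHom F F).restrictScalars K ∘ₗ g.toLinearMap)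
    fun a b => ?_, fun s => ?_⟩
  · change (g (a * b)).snd = a * (g b).snd + b * (g a).snd
    rw [map_mul, TrivSqZeroExt.snd_mul, hfst, hfst, op_smul_eq_smul, smul_eq_mul, smul_eq_mul]
  · change (g (algebraMap S F s)).snd = _
    rw [hg]
    exact (TrivSqZeroExt.snd_add _ _).trans (zero_add _)

end DerivationExtension

section DifferentialOperators

variable {σ K F : Type*} [Field K] [Field F] [Algebra (MvPolynomial σ K) F] [Algebra K F]
  [IsScalarTower K (MvPolynomial σ K) F]

/-- An algebra map from the polynomial ring determined by commuting elements. -/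
lemma exists_algHom_of_commute {A : Type*} [Ring A] [Algebra K A] (D : σ → A)
    (h : ∀ s t, D s * D t = D t * D s) :
    ∃ Θ : MvPolynomial σ K →ₐ[K] A, ∀ s, Θ (X s) = D s := by
  have := Algebra.isMulCommutative_adjoin K (s := Set.range D) (by
    rintro _ ⟨s, rfl⟩ _ ⟨t, rfl⟩
    exact h s t)
  let _ : CommRing (Algebra.adjoin K (Set.range D)) :=
    { (inferInstance : Ring (Algebra.adjoin K (Set.range D))) with mul_comm := this.is_comm.comm }
  refine ⟨(Algebra.adjoin K (Set.range D)).val.comp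
    (aeval fun s => ⟨D s, Algebra.subset_adjoin ⟨s, rfl⟩⟩), fun s => ?_⟩
  rw [AlgHom.comp_apply, aeval_X]
  rfl

variable (σ K F) in
/-- The partial derivatives on the fraction field of a polynomial ring, and the algebra map to
endomorphisms they generate. -/
structure PartialDerivatives where
  D : σ → Derivation K F F
  D_algebraMap : ∀ s p, D s (algebraMap (MvPolynomial σ K) F p) =
    algebraMap (MvPolynomial σ K) F (pderiv s p)
  Θ : MvPolynomial σ K →ₐ[K] Module.End K F
  Θ_X : ∀ s, Θ (X s) = (D s : F →ₗ[K] F)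

lemma exists_partialDerivatives [IsFractionRing (MvPolynomial σ K) F] :
    Nonempty (PartialDerivatives σ K F) := by
  classical
  choose D hD using fun s : σ => Derivation.exists_extension (F := F)
    (pderiv s : Derivation K (MvPolynomial σ K) (MvPolynomial σ K))
  have hcomm : ∀ s t, ⁅D s, D t⁆ = 0 := by
    intro s t
    refine Derivation.ext_of_isFractionRing (S := MvPolynomial σ K) fun p => ?_
    rw [Derivation.commutator_apply, hD, hD, hD, hD, ← map_sub, ← Derivation.commutator_apply]
    have : ⁅(pderiv s : Derivation K (MvPolynomial σ K) (MvPolynomial σ K)),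
        (pderiv t : Derivation K (MvPolynomial σ K) (MvPolynomial σ K))⁆ = 0 := by
      refine MvPolynomial.derivation_ext fun i => ?_
      rw [Derivation.commutator_apply, pderiv_X, pderiv_X]
      simp only [Pi.single_apply]
      split_ifs <;> simp
    rw [this]
    simp
  obtain ⟨Θ, hΘ⟩ := exists_algHom_of_commute (K := K)
    (fun s => ((D s : F →ₗ[K] F) : Module.End K F)) fun s t => by
      ext x
      have := DFunLike.congr_fun (hcomm s t) x
      rw [Derivation.commutator_apply] at this
      exact sub_eq_zero.1 this
  exact ⟨⟨D, hD, Θ, hΘ⟩⟩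

end DifferentialOperators

section Stability

variable {K S F : Type*} [Field K] [CommRing S] [Algebra K S] [Field F] [Algebra S F] [Algebra K F]
  {D : Derivation K F F} {d : Derivation K S S}

lemma Derivation.map_divPow_mem (hD : ∀ s, D (algebraMap S F s) = algebraMap S F (d s))
    {N : Submodule S F} (hN : ∀ x ∈ N, D x ∈ N) (a : S) {x : F} (hx : x ∈ N.divPow a) :
    D x ∈ N.divPow a := by
  obtain ⟨t, ht⟩ := hx
  refine ⟨t + 1, ?_⟩
  have h := D.leibniz (algebraMap S F (a ^ t)) x
  rw [hD, smul_eq_mul, smul_eq_mul, ← Algebra.smul_def] at h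
  have key : a ^ (t + 1) • D x = a • D (a ^ t • x) - (a * d (a ^ t)) • x := by
    rw [h, smul_add, pow_succ', mul_smul, mul_smul, mul_comm x, ← Algebra.smul_def,
      ← Algebra.smul_def, add_sub_cancel_right]
  have hd : a * d (a ^ t) = (t * d a) * a ^ t := by
    rw [Derivation.leibniz_pow]
    cases t with
    | zero => simp
    | succ t =>
      rw [Nat.add_sub_cancel, nsmul_eq_mul, smul_eq_mul]
      ring
  rw [key, hd, mul_smul]
  exact N.sub_mem (N.smul_mem _ (hN _ ht)) (N.smul_mem _ ht)

lemma Derivation.map_localizedPart_mem (hD : ∀ s, D (algebraMap S F s) = algebraMap S F (d s))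
    (l : List S) {x : F} (hx : x ∈ localizedPart F l) : D x ∈ localizedPart F l := by
  induction l generalizing x with
  | nil =>
    obtain ⟨s, rfl⟩ := hx
    exact ⟨d s, (hD s).symm⟩
  | cons a l ih => exact Derivation.map_divPow_mem hD (fun _ => ih) a hx

lemma Derivation.map_boundaryPart_mem (hD : ∀ s, D (algebraMap S F s) = algebraMap S F (d s))
    (l : List S) {x : F} (hx : x ∈ boundaryPart F l) : D x ∈ boundaryPart F l := by
  induction l generalizing x with
  | nil =>
    rw [(Submodule.mem_bot S).1 hx, map_zero]
    exact Submodule.zero_mem _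
  | cons a l ih =>
    obtain ⟨y, hy, z, hz, rfl⟩ := Submodule.mem_sup.1 hx
    rw [map_add]
    exact Submodule.add_mem_sup (Derivation.map_divPow_mem hD (fun _ => ih) a hy)
      (Derivation.map_localizedPart_mem hD l hz)

end Stability

section Membership

variable {S F : Type*} [CommRing S] [Field F] [Algebra S F]

lemma mem_localizedPart_iff (l : List S) {x : F} :
    x ∈ localizedPart F l ↔ ∃ t : ℕ, ∃ s, l.prod ^ t • x = algebraMap S F s := by
  induction l generalizing x with
  | nil =>
    constructor
    · rintro ⟨s, rfl⟩
      exact ⟨0, s, by simp⟩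
    · rintro ⟨t, s, hs⟩
      exact ⟨s, by simpa using hs.symm⟩
  | cons a l ih =>
    rw [localizedPart, Submodule.mem_divPow]
    constructor
    · rintro ⟨t, ht⟩
      obtain ⟨t', s, hs⟩ := ih.1 ht
      refine ⟨t + t', a ^ t' * l.prod ^ t * s, ?_⟩
      rw [map_mul, ← hs, ← Algebra.smul_def, smul_smul, smul_smul, List.prod_cons]
      ring_nf
    · rintro ⟨t, s, hs⟩
      exact ⟨t, ih.2 ⟨t, s, by rw [← hs, smul_smul, List.prod_cons, mul_pow, mul_comm]⟩⟩

lemma mem_boundaryPart_iff [FaithfulSMul S F] [IsDomain S] (l : List S) (hl : ∀ f ∈ l, f ≠ 0)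
    {x : F} : x ∈ boundaryPart F l ↔ ∃ t : ℕ, ∃ s ∈ Ideal.span {g | ∃ f ∈ l, g = f ^ t},
      l.prod ^ t • x = algebraMap S F s := by
  induction l generalizing x with
  | nil =>
    refine (Submodule.mem_bot S).trans ?_
    constructor
    · rintro rfl
      exact ⟨0, 0, Ideal.zero_mem _, by simp⟩
    · rintro ⟨t, s, hs, h⟩
      have : s = 0 := by simpa using hs
      simpa [this] using h
  | cons a l ih =>
    have hl' : ∀ f ∈ l, f ≠ 0 := fun f hf => hl f (List.mem_cons_of_mem _ hf)
    have hset : ∀ t : ℕ, {g : S | ∃ f ∈ a :: l, g = f ^ t} =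
        insert (a ^ t) {g | ∃ f ∈ l, g = f ^ t} := by
      intro t
      ext g
      simp
    simp only [hset]
    rw [boundaryPart]
    constructor
    · intro hx
      obtain ⟨y, ⟨s, hs⟩, z, hz, rfl⟩ := Submodule.mem_sup.1 hx
      obtain ⟨t, r, hr, hyr⟩ := (ih hl').1 hs
      obtain ⟨t', r', hzr⟩ := (mem_localizedPart_iff l).1 hz
      refine ⟨s + t + t', a ^ (s + t + t') * (l.prod ^ (s + t) * r') +
        a ^ (t + t') * (l.prod ^ (s + t') * r), ?_, ?_⟩
      · refine Ideal.add_mem _ (Ideal.mul_mem_right _ _ (Ideal.subset_span (Set.mem_insert _ _)))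
          (Ideal.mul_mem_left _ _ ?_)
        refine Ideal.span_mono (Set.subset_insert _ _) ?_
        have hle : Ideal.span {g | ∃ f ∈ l, g = f ^ t} ≤
            Submodule.comap (LinearMap.mulLeft S (l.prod ^ (s + t')))
              (Ideal.span {g | ∃ f ∈ l, g = f ^ (s + t + t')}) := by
          refine Ideal.span_le.2 ?_
          rintro _ ⟨f, hf, rfl⟩
          obtain ⟨c, hc⟩ := List.dvd_prod hf
          have : l.prod ^ (s + t') * f ^ t = c ^ (s + t') * f ^ (s + t + t') := by
            rw [hc]
            ring
          change l.prod ^ (s + t') * f ^ t ∈ Ideal.span {g | ∃ f ∈ l, g = f ^ (s + t + t')}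
          rw [this]
          exact Ideal.mul_mem_left _ _ (Ideal.subset_span ⟨f, hf, rfl⟩)
        exact hle hr
      · rw [map_add, map_mul, map_mul, map_mul, map_mul _ (_ ^ (s + t')), ← hyr, ← hzr]
        simp only [Algebra.smul_def, List.prod_cons, map_mul, map_pow]
        ring
    · rintro ⟨t, s, hs, hxs⟩
      obtain ⟨r, r', hr', rfl⟩ := Ideal.mem_span_insert.1 hs
      have hP : algebraMap S F (l.prod ^ t) ≠ 0 := by
        rw [Ne, FaithfulSMul.algebraMap_eq_zero_iff S F]
        exact pow_ne_zero t (List.prod_ne_zero fun h => hl' 0 h rfl)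
      let z : F := algebraMap S F r / algebraMap S F (l.prod ^ t)
      have hz : l.prod ^ t • z = algebraMap S F r := by
        rw [Algebra.smul_def, mul_div_cancel₀ _ hP]
      refine Submodule.mem_sup.2 ⟨x - z, ⟨t, (ih hl').2 ⟨t, r', hr', ?_⟩⟩, z,
        (mem_localizedPart_iff l).2 ⟨t, r, hz⟩, sub_add_cancel x z⟩
      rw [List.prod_cons, mul_pow, mul_comm, mul_smul] at hxs
      rw [smul_sub, smul_sub, hxs, smul_comm, hz, Algebra.smul_def, ← map_mul, ← map_sub,
        mul_comm r, add_sub_cancel_left]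

end Membership

namespace PartialDerivatives

variable {σ K F : Type*} [Field K] [Field F] [Algebra (MvPolynomial σ K) F] [Algebra K F]
  (P : PartialDerivatives σ K F)

lemma Θ_X_mul (s : σ) (g : MvPolynomial σ K) (x : F) : P.Θ (X s * g) x = P.D s (P.Θ g x) := by
  rw [map_mul, P.Θ_X]
  rfl

lemma Θ_C (c : K) (x : F) : P.Θ (C c) x = c • x := by
  rw [← algebraMap_eq, AlgHom.commutes]
  rfl

lemma Θ_mul (g h : MvPolynomial σ K) (x : F) : P.Θ (g * h) x = P.Θ g (P.Θ h x) := by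
  rw [map_mul]
  rfl

variable [IsScalarTower K (MvPolynomial σ K) F] in
lemma Θ_mem {N : Submodule (MvPolynomial σ K) F} (hN : ∀ s, ∀ x ∈ N, P.D s x ∈ N)
    (g : MvPolynomial σ K) {x : F} (hx : x ∈ N) : P.Θ g x ∈ N := by
  induction g using MvPolynomial.induction_on with
  | C c =>
    rw [Θ_C, ← algebraMap_smul (MvPolynomial σ K) c x]
    exact N.smul_mem _ hx
  | add p q hp hq =>
    rw [map_add]
    exact N.add_mem hp hq
  | mul_X p s hp =>
    rw [mul_comm, Θ_X_mul]
    exact hN s _ hp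

lemma D_smul (s : σ) (p : MvPolynomial σ K) (x : F) :
    P.D s (p • x) = p • P.D s x + pderiv s p • x := by
  rw [Algebra.smul_def, Derivation.leibniz, P.D_algebraMap, smul_eq_mul, smul_eq_mul,
    Algebra.smul_def, Algebra.smul_def, mul_comm x]

variable [IsScalarTower K (MvPolynomial σ K) F] in
lemma X_smul_Θ (s : σ) (g : MvPolynomial σ K) (x : F) :
    (X s : MvPolynomial σ K) • P.Θ g x =
      P.Θ g ((X s : MvPolynomial σ K) • x) - P.Θ (pderiv s g) x := by
  classical
  induction g using MvPolynomial.induction_on with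
  | C c => rw [pderiv_C, map_zero, Θ_C, Θ_C, LinearMap.zero_apply, sub_zero, smul_comm]
  | add p q hp hq =>
    simp only [map_add, LinearMap.add_apply, smul_add, hp, hq]
    abel
  | mul_X p t hp =>
    rw [mul_comm p, Θ_X_mul, Θ_X_mul, pderiv_mul, pderiv_X, map_add, LinearMap.add_apply, Θ_X_mul]
    have h := P.D_smul t (X s) (P.Θ p x)
    rw [hp, map_sub, pderiv_X] at h
    rw [Pi.single_apply] at h ⊢
    by_cases hst : s = t
    · subst hst
      rw [if_pos rfl] at h ⊢
      rw [one_smul] at h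
      rw [one_mul]
      linear_combination -h
    · rw [if_neg hst] at h
      rw [if_neg (Ne.symm hst)]
      rw [zero_smul, add_zero] at h
      rw [zero_mul, map_zero, LinearMap.zero_apply, zero_add, h]

/-- A pair of nested submodules whose quotient is generated freely over constant coefficient
differential operators by a class killed by the variables. -/
structure IsDual (A A' : Submodule (MvPolynomial σ K) F) (u : F) : Prop where
  mem : ∀ g, P.Θ g u ∈ A
  surj : ∀ x ∈ A, ∃ g, x - P.Θ g u ∈ A'
  inj : ∀ g, P.Θ g u ∈ A' → g = 0
  shift : ∀ s g, (X s : MvPolynomial σ K) • P.Θ g u + P.Θ (pderiv s g) u ∈ A'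

variable [IsScalarTower K (MvPolynomial σ K) F] in
lemma exists_smul_sub_mem (p : MvPolynomial σ K) : ∃ T : MvPolynomial σ K → MvPolynomial σ K,
    ∀ (A' : Submodule (MvPolynomial σ K) F) (u : F),
      (∀ s g, (X s : MvPolynomial σ K) • P.Θ g u + P.Θ (pderiv s g) u ∈ A') →
      ∀ y g, y - P.Θ g u ∈ A' → p • y - P.Θ (T g) u ∈ A' := by
  induction p using MvPolynomial.induction_on with
  | C c =>
    refine ⟨fun g => C c * g, fun A' u _ y g h => ?_⟩
    rw [Θ_mul, Θ_C, ← algebraMap_smul (MvPolynomial σ K) c, algebraMap_eq, ← smul_sub]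
    exact A'.smul_mem _ h
  | add p q hp hq =>
    obtain ⟨T, hT⟩ := hp
    obtain ⟨T', hT'⟩ := hq
    refine ⟨fun g => T g + T' g, fun A' u hs y g h => ?_⟩
    rw [map_add, LinearMap.add_apply, add_smul, add_sub_add_comm]
    exact A'.add_mem (hT A' u hs y g h) (hT' A' u hs y g h)
  | mul_X p s hp =>
    obtain ⟨T, hT⟩ := hp
    refine ⟨fun g => -pderiv s (T g), fun A' u hs y g h => ?_⟩
    have := A'.add_mem (A'.smul_mem (X s) (hT A' u hs y g h)) (hs s (T g))
    rwa [smul_sub, ← add_assoc, sub_add_cancel, smul_smul, mul_comm, ← sub_neg_eq_add,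
      ← LinearMap.neg_apply, ← map_neg] at this

variable {P}

variable [IsScalarTower K (MvPolynomial σ K) F] in
lemma IsDual.nonempty_equiv {A A' B B' : Submodule (MvPolynomial σ K) F} {u v : F}
    (hu : P.IsDual A A' u) (hv : P.IsDual B B' v) (hA : A' ≤ A) (hB : B' ≤ B) :
    Nonempty ((A ⧸ A'.submoduleOf A) ≃ₗ[MvPolynomial σ K] (B ⧸ B'.submoduleOf B)) := by
  let R : Submodule (MvPolynomial σ K) (F × F) :=
    { carrier := {z | ∃ g, z.1 - P.Θ g u ∈ A' ∧ z.2 - P.Θ g v ∈ B'}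
      zero_mem' := ⟨0, by simp⟩
      add_mem' := by
        rintro ⟨x, y⟩ ⟨x', y'⟩ ⟨g, h1, h2⟩ ⟨g', h1', h2'⟩
        refine ⟨g + g', ?_, ?_⟩
        · rw [map_add, LinearMap.add_apply, Prod.fst_add, add_sub_add_comm]
          exact A'.add_mem h1 h1'
        · rw [map_add, LinearMap.add_apply, Prod.snd_add, add_sub_add_comm]
          exact B'.add_mem h2 h2'
      smul_mem' := by
        rintro p ⟨x, y⟩ ⟨g, h1, h2⟩
        obtain ⟨T, hT⟩ := exists_smul_sub_mem P p
        exact ⟨T g, hT _ _ hu.shift _ _ h1, hT _ _ hv.shift _ _ h2⟩ }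
  refine Submodule.quotientEquiv_of_rel R ?_ ?_ ?_ ?_ ?_
  · rintro x y ⟨g, h1, -⟩
    exact (A.sub_mem_iff_left (hu.mem g)).1 (hA h1)
  · rintro x y ⟨g, -, h2⟩
    exact (B.sub_mem_iff_left (hv.mem g)).1 (hB h2)
  · intro x hx
    obtain ⟨g, hg⟩ := hu.surj x hx
    exact ⟨P.Θ g v, g, hg, by rw [sub_self]; exact B'.zero_mem⟩
  · intro y hy
    obtain ⟨g, hg⟩ := hv.surj y hy
    exact ⟨P.Θ g u, g, by rw [sub_self]; exact A'.zero_mem, hg⟩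
  · rintro x y ⟨g, h1, h2⟩
    constructor
    · intro hx
      obtain rfl := hu.inj g ((A'.sub_mem_iff_right hx).1 h1)
      simpa using h2
    · intro hy
      obtain rfl := hv.inj g ((B'.sub_mem_iff_right hy).1 h2)
      simpa using h1

end PartialDerivatives

section Monomials

variable {ι S : Type*} [Fintype ι] [CommRing S] (F : Type*) [Field F] [Algebra S F]

/-- The product of integral powers of a family of elements, in the fraction field. -/
def zpowProd (f : ι → S) (α : ι → ℤ) : F := ∏ i, algebraMap S F (f i) ^ α i

lemma zpowProd_natCast (f : ι → S) (m : ℕ) :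
    zpowProd F f (fun _ => (m : ℤ)) = algebraMap S F ((∏ i, f i) ^ m) := by
  simp [zpowProd, Finset.prod_pow]

lemma zpowProd_add [IsDomain S] [FaithfulSMul S F] {f : ι → S} (hf : ∀ i, f i ≠ 0) (α β : ι → ℤ) :
    zpowProd F f (α + β) = zpowProd F f α * zpowProd F f β := by
  rw [zpowProd, zpowProd, zpowProd, ← Finset.prod_mul_distrib]
  refine Finset.prod_congr rfl fun i _ => zpow_add₀ ?_ _ _
  rw [Ne, FaithfulSMul.algebraMap_eq_zero_iff S F]
  exact hf i

lemma smul_zpowProd_neg [IsDomain S] [FaithfulSMul S F] {f : ι → S} (hf : ∀ i, f i ≠ 0) (m : ℕ) :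
    (∏ i, f i) ^ m • zpowProd F f (fun _ => -(m : ℤ)) = 1 := by
  rw [Algebra.smul_def, ← zpowProd_natCast, ← zpowProd_add F hf]
  simp [zpowProd]

lemma exists_list_prod_eq_pow [DecidableEq ι] (f : ι → S) (m : ℕ) :
    ∃ w : List ι, (w.map f).prod = (∏ i, f i) ^ m ∧ ∀ i, w.count i = m := by
  induction m with
  | zero => exact ⟨[], by simp⟩
  | succ m ih =>
    obtain ⟨w, hw, hc⟩ := ih
    refine ⟨w ++ Finset.univ.toList, ?_, fun i => ?_⟩
    · rw [List.map_append, List.prod_append, hw, Finset.prod_map_toList, pow_succ]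
    · rw [List.count_append, hc, List.count_eq_one_of_mem (Finset.nodup_toList _) (by simp)]

end Monomials

namespace PartialDerivatives

variable {σ K F : Type*} [Field K] [Field F] [Algebra (MvPolynomial σ K) F] [Algebra K F]
  (P : PartialDerivatives σ K F) {ι : Type*} [Fintype ι] [DecidableEq ι]

/-- The operators `Θ (f i)` lower products of powers of the family, with coefficients that are
nonzero outside an intermediate range of degrees. -/
def Lowers (f : ι → MvPolynomial σ K) : Prop :=
  ∀ i (α : ι → ℤ), ∃ c : K,
    P.Θ (f i) (zpowProd F f α) = (c * α i) • zpowProd F f (α - Pi.single i 1) ∧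
    (1 ≤ ∑ j, α j ∨ ∑ j, α j ≤ -Fintype.card ι → c ≠ 0)

variable {P} {f : ι → MvPolynomial σ K}

lemma Lowers.list_prod [CharZero K] (h : P.Lowers f) (w : List ι) (α : ι → ℤ) : ∃ c : K,
    P.Θ (w.map f).prod (zpowProd F f α) = c • zpowProd F f (α - fun i => (w.count i : ℤ)) ∧
    ((∀ i, (w.count i : ℤ) ≤ α i) ∨ (∀ i, α i ≤ -1) → c ≠ 0) := by
  induction w with
  | nil =>
    refine ⟨1, ?_, fun _ => one_ne_zero⟩
    simp only [List.map_nil, List.prod_nil, map_one, Module.End.one_apply, List.count_nil,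
      Nat.cast_zero, one_smul]
    exact congrArg _ (sub_zero α).symm
  | cons i w ih =>
    obtain ⟨c, hc, hc0⟩ := ih
    set β : ι → ℤ := α - fun i => (w.count i : ℤ) with hβ
    obtain ⟨c', hc', hc0'⟩ := h i β
    refine ⟨c * (c' * β i), ?_, fun H => ?_⟩
    · rw [List.map_cons, List.prod_cons, Θ_mul, hc, map_smul, hc', smul_smul]
      congr 2
      ext j
      by_cases hij : i = j
      · subst hij
        simp only [hβ, Pi.sub_apply, List.count_cons_self, Pi.single_eq_same]
        push_cast
        ring
      · simp only [hβ, Pi.sub_apply, List.count_cons_of_ne hij,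
          Pi.single_eq_of_ne (Ne.symm hij), sub_zero]
    · obtain H | H := H
      · have hj : ∀ j, (w.count j : ℤ) ≤ α j := fun j =>
          le_trans (by exact_mod_cast List.count_le_count_cons) (H j)
        have hi : 1 ≤ β i := by
          have := H i
          rw [List.count_cons_self] at this
          simp only [hβ, Pi.sub_apply]
          push_cast at this
          linarith
        have hβ0 : ∀ j ∈ Finset.univ, 0 ≤ β j := fun j _ => sub_nonneg.2 (hj j)
        refine mul_ne_zero (hc0 (Or.inl hj)) (mul_ne_zero (hc0' (Or.inl ?_)) ?_)
        · exact hi.trans (Finset.single_le_sum hβ0 (Finset.mem_univ i))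
        · exact_mod_cast (zero_lt_one.trans_le hi).ne'
      · have hβ1 : ∀ j, β j ≤ -1 := fun j => by
          have := H j
          simp only [hβ, Pi.sub_apply]
          omega
        refine mul_ne_zero (hc0 (Or.inr H)) (mul_ne_zero (hc0' (Or.inr ?_)) ?_)
        · refine (Finset.sum_le_card_nsmul _ _ (-1) fun j _ => hβ1 j).trans ?_
          simp
        · have := hβ1 i
          exact_mod_cast (by omega : β i ≠ 0)

lemma Lowers.prod_pow_natCast [CharZero K] (h : P.Lowers f) (m : ℕ) : ∃ c : K, c ≠ 0 ∧
    P.Θ ((∏ i, f i) ^ m) (zpowProd F f fun _ => (m : ℤ)) = c • (1 : F) := by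
  obtain ⟨w, hw, hcount⟩ := exists_list_prod_eq_pow f m
  obtain ⟨c, hc, hc0⟩ := h.list_prod w fun _ => (m : ℤ)
  refine ⟨c, hc0 (Or.inl fun i => by rw [hcount]), ?_⟩
  rw [hw] at hc
  rw [hc]
  congr 1
  simp [zpowProd, hcount]

lemma Lowers.prod_pow_neg_one [CharZero K] (h : P.Lowers f) (m : ℕ) : ∃ c : K, c ≠ 0 ∧
    P.Θ ((∏ i, f i) ^ m) (zpowProd F f fun _ => -1) =
      c • zpowProd F f fun _ => -((m + 1 : ℕ) : ℤ) := by
  obtain ⟨w, hw, hcount⟩ := exists_list_prod_eq_pow f m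
  obtain ⟨c, hc, hc0⟩ := h.list_prod w fun _ => -1
  refine ⟨c, hc0 (Or.inr fun i => le_rfl), ?_⟩
  rw [hw] at hc
  rw [hc]
  congr 2
  ext i
  simp only [Pi.sub_apply, hcount]
  push_cast
  ring

lemma Lowers.pow_eq_zero (h : P.Lowers f) (i : ι) (m : ℕ) (α : ι → ℤ) (hα : α i = m) :
    P.Θ (f i ^ (m + 1)) (zpowProd F f α) = 0 := by
  induction m generalizing α with
  | zero =>
    obtain ⟨c, hc, -⟩ := h i α
    rw [zero_add, pow_one, hc, hα]
    simp
  | succ m ih =>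
    obtain ⟨c, hc, -⟩ := h i α
    rw [pow_succ, Θ_mul, hc, map_smul, ih, smul_zero]
    rw [Pi.sub_apply, Pi.single_eq_same, hα]
    push_cast
    ring

variable [IsFractionRing (MvPolynomial σ K) F] [CharZero K]

lemma Lowers.notMem_boundaryPart (h : P.Lowers f) (hf : ∀ i, f i ≠ 0) :
    zpowProd F f (fun _ => -1) ∉ boundaryPart F (Finset.univ.toList.map f) := by
  intro hu
  have hl : ∀ g ∈ Finset.univ.toList.map f, g ≠ 0 := by simpa using hf
  obtain ⟨t, s, hs, hst⟩ := (mem_boundaryPart_iff _ hl).1 hu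
  rw [Finset.prod_map_toList] at hst
  have hP : (∏ i, f i) * s = (∏ i, f i) ^ t := by
    refine FaithfulSMul.algebraMap_injective (MvPolynomial σ K) F ?_
    have := smul_zpowProd_neg F hf 1
    rw [map_mul, ← hst, ← Algebra.smul_def, smul_smul, mul_comm, mul_smul, ← pow_one (∏ i, f i)]
    rw [Nat.cast_one] at this
    rw [this, pow_one, Algebra.smul_def, mul_one]
  let J : Ideal (MvPolynomial σ K) :=
    { carrier := {r | P.Θ r (zpowProd F f fun _ => (t : ℤ)) = 0}
      zero_mem' := by simp
      add_mem' := fun {a b} ha hb => by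
        change P.Θ (a + b) _ = 0
        rw [map_add, LinearMap.add_apply, show P.Θ a _ = 0 from ha, show P.Θ b _ = 0 from hb,
          add_zero]
      smul_mem' := fun r a ha => by
        change P.Θ (r * a) _ = 0
        rw [Θ_mul, show P.Θ a _ = 0 from ha, map_zero] }
  have hJ : Ideal.span {g | ∃ b ∈ Finset.univ.toList.map f, g = b ^ t} ≤
      Submodule.comap (LinearMap.mulLeft (MvPolynomial σ K) (∏ i, f i)) J := by
    refine Ideal.span_le.2 ?_
    rintro _ ⟨b, hb, rfl⟩
    obtain ⟨i, -, rfl⟩ := List.mem_map.1 hb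
    change (∏ i, f i) * f i ^ t ∈ J
    rw [← Finset.mul_prod_erase _ _ (Finset.mem_univ i), mul_right_comm, ← pow_succ', mul_comm]
    exact J.mul_mem_left _ (h.pow_eq_zero i t _ rfl)
  have h0 : P.Θ ((∏ i, f i) * s) (zpowProd F f fun _ => (t : ℤ)) = 0 := hJ hs
  obtain ⟨c, hc0, hc⟩ := h.prod_pow_natCast t
  rw [hP, hc] at h0
  exact smul_ne_zero hc0 one_ne_zero h0

variable [IsScalarTower K (MvPolynomial σ K) F]

omit [IsFractionRing (MvPolynomial σ K) F] in
lemma eq_zero_of_Θ_mem {A' : Submodule (MvPolynomial σ K) F} {u : F} (hu : u ∉ A')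
    (hshift : ∀ s g, (X s : MvPolynomial σ K) • P.Θ g u + P.Θ (pderiv s g) u ∈ A')
    (g : MvPolynomial σ K) (hg : P.Θ g u ∈ A') : g = 0 := by
  classical
  suffices H : ∀ N : ℕ, ∀ g : MvPolynomial σ K, P.Θ g u ∈ A' →
      (∀ m, coeff m g ≠ 0 → m.degree < N) → g = 0 by
    refine H (g.totalDegree + 1) g hg fun m hm => Nat.lt_succ_of_le ?_
    exact le_totalDegree (mem_support_iff.2 hm)
  intro N
  induction N with
  | zero =>
    intro g _ hN
    ext m
    by_contra hm
    exact absurd (hN m hm) (Nat.not_lt_zero _)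
  | succ N ih =>
    intro g hg hN
    have hd : ∀ s, pderiv s g = 0 := by
      intro s
      refine ih _ ?_ fun m hm => ?_
      · exact (A'.add_mem_iff_right (A'.smul_mem _ hg)).1 (hshift s g)
      · rw [coeff_pderiv] at hm
        have := hN _ (left_ne_zero_of_mul hm)
        rw [map_add, Finsupp.degree_single] at this
        exact Nat.lt_of_succ_lt_succ this
    have hC : g = C (coeff 0 g) := by
      ext m
      by_cases hm : m = 0
      · simp [hm]
      · rw [coeff_C, if_neg (Ne.symm hm)]
        obtain ⟨s, hs⟩ := Finsupp.ne_iff.1 hm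
        have h0 := coeff_pderiv (i := s) g (m - Finsupp.single s 1)
        rw [hd, coeff_zero, tsub_add_cancel_of_le (by
          rw [Finsupp.single_le_iff]
          exact Nat.one_le_iff_ne_zero.2 hs)] at h0
        refine (mul_eq_zero.1 h0.symm).resolve_right ?_
        exact Nat.cast_add_one_ne_zero _
    rw [hC, Θ_C] at hg
    by_contra hne
    have hc : coeff 0 g ≠ 0 := fun h0 => hne (by rw [hC, h0, C_0])
    refine hu ?_
    have := A'.smul_mem (C (coeff 0 g)⁻¹) hg
    rwa [← algebraMap_eq, algebraMap_smul, smul_smul, inv_mul_cancel₀ hc, one_smul] at this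

/-- A criterion identifying the quotient of localizations with a module generated by constant
coefficient operators. -/
lemma Lowers.isDual (h : P.Lowers f) (hf : ∀ i, f i ≠ 0)
    (hX : ∀ s, X s * ∏ i, f i ∈ Ideal.span (Set.range fun i => f i ^ 2)) :
    P.IsDual (localizedPart F (Finset.univ.toList.map f))
      (boundaryPart F (Finset.univ.toList.map f)) (zpowProd F f fun _ => -1) := by
  have hl : ∀ g ∈ Finset.univ.toList.map f, g ≠ 0 := by simpa using hf
  have hu1 : (∏ i, f i) • zpowProd F f (fun _ => -1) = 1 := by
    simpa using smul_zpowProd_neg F hf 1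
  have hXu : ∀ s, (X s : MvPolynomial σ K) • zpowProd F f (fun _ => -1) ∈
      boundaryPart F (Finset.univ.toList.map f) := by
    intro s
    refine (mem_boundaryPart_iff _ hl).2 ⟨2, X s * ∏ i, f i, ?_, ?_⟩
    · refine Ideal.span_mono ?_ (hX s)
      rintro _ ⟨i, rfl⟩
      exact ⟨f i, by simp, rfl⟩
    · rw [Finset.prod_map_toList, smul_comm, pow_two, mul_smul, hu1, smul_smul, Algebra.smul_def,
        mul_one]
  have hshift : ∀ s g, (X s : MvPolynomial σ K) • P.Θ g (zpowProd F f fun _ => -1) +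
      P.Θ (pderiv s g) (zpowProd F f fun _ => -1) ∈
        boundaryPart F (Finset.univ.toList.map f) := by
    intro s g
    rw [X_smul_Θ, sub_add_cancel]
    exact P.Θ_mem (fun s x => Derivation.map_boundaryPart_mem (P.D_algebraMap s) _) _ (hXu s)
  refine ⟨fun g => ?_, fun x hx => ?_,
    fun g => eq_zero_of_Θ_mem (h.notMem_boundaryPart hf) hshift g, hshift⟩
  · refine P.Θ_mem (fun s x => Derivation.map_localizedPart_mem (P.D_algebraMap s) _) _ ?_
    exact (mem_localizedPart_iff _).2 ⟨1, 1, by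
      rw [Finset.prod_map_toList, pow_one, hu1, map_one]⟩
  · obtain ⟨t, s, hs⟩ := (mem_localizedPart_iff _).1 hx
    rw [Finset.prod_map_toList] at hs
    obtain ⟨c, hc0, hc⟩ := h.prod_pow_neg_one t
    obtain ⟨T, hT⟩ := P.exists_smul_sub_mem (C c⁻¹ * ((∏ i, f i) * s))
    refine ⟨T ((∏ i, f i) ^ t), ?_⟩
    have hxe : x = (C c⁻¹ * ((∏ i, f i) * s)) • P.Θ ((∏ i, f i) ^ t) (zpowProd F f fun _ => -1) := by
      rw [hc, mul_smul, ← algebraMap_eq, algebraMap_smul, smul_comm _ c, smul_smul,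
        inv_mul_cancel₀ hc0, one_smul]
      have h1 := smul_zpowProd_neg F hf (t + 1)
      rw [mul_smul, Algebra.smul_def s, ← hs, smul_mul_assoc, smul_smul, ← pow_succ',
        ← mul_smul_comm, h1, mul_one]
    rw [hxe]
    exact hT _ _ hshift _ _ (by rw [sub_self]; exact Submodule.zero_mem _)

end PartialDerivatives

section SubPfaffian

lemma two_mul_val_lt {n : ℕ} (i : Fin n) : 2 * (i : ℕ) < 2 * n := by omega

lemma two_mul_val_add_one_lt {n : ℕ} (i : Fin n) : 2 * (i : ℕ) + 1 < 2 * n := by omega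

variable {n : ℕ} {R : Type*} [CommRing R]

/-- The odd positions `2 i + 1` in `Fin (2 n + 1)`. -/
def oddPos (i : Fin n) : Fin (2 * n + 1) := ⟨2 * i + 1, by omega⟩

/-- The nonzero even positions `2 i + 2` in `Fin (2 n + 1)`. -/
def evenPos (i : Fin n) : Fin (2 * n + 1) := ⟨2 * i + 2, by omega⟩

lemma eq_zero_or_oddPos_or_evenPos (m : Fin (2 * n + 1)) :
    m = 0 ∨ ∃ i : Fin n, m = oddPos i ∨ m = evenPos i := by
  obtain ⟨m, hm⟩ := m
  by_cases h0 : m = 0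
  · exact Or.inl (by simp [h0])
  · refine Or.inr ⟨⟨(m - 1) / 2, by omega⟩, ?_⟩
    simp only [oddPos, evenPos, Fin.mk.injEq]
    omega

lemma oddPos_ne_zero (i : Fin n) : oddPos i ≠ 0 := by simp [oddPos, Fin.ext_iff]

lemma evenPos_ne_zero (i : Fin n) : evenPos i ≠ 0 := by simp [evenPos, Fin.ext_iff]

lemma oddPos_ne_evenPos (i j : Fin n) : oddPos i ≠ evenPos j := by
  simp only [oddPos, evenPos, Ne, Fin.mk.injEq]
  omega

lemma oddPos_injective : Function.Injective (oddPos (n := n)) := fun i j h => by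
  simp only [oddPos, Fin.mk.injEq] at h
  omega

lemma evenPos_injective : Function.Injective (evenPos (n := n)) := fun i j h => by
  simp only [evenPos, Fin.mk.injEq] at h
  omega

/-- The product of the entries of a matrix over the pairs of positions of a sequence. -/
def pairProd (B : Matrix (Fin (2 * n + 1)) (Fin (2 * n + 1)) R)
    (t : Fin (2 * n + 1) → Fin (2 * n + 1)) : R :=
  ∏ i : Fin n, B (t (oddPos i)) (t (evenPos i))

lemma pairProd_congr (B : Matrix (Fin (2 * n + 1)) (Fin (2 * n + 1)) R)
    {t t' : Fin (2 * n + 1) → Fin (2 * n + 1)} (h : ∀ m, m ≠ 0 → t m = t' m) :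
    pairProd B t = pairProd B t' :=
  Finset.prod_congr rfl fun i _ => by rw [h _ (oddPos_ne_zero i), h _ (evenPos_ne_zero i)]

/-- The signed and unnormalized sub-maximal Pfaffian of a matrix of odd size. -/
def subPf (B : Matrix (Fin (2 * n + 1)) (Fin (2 * n + 1)) R) (j : Fin (2 * n + 1)) : R :=
  ∑ τ : Equiv.Perm (Fin (2 * n + 1)),
    if τ 0 = j then (Equiv.Perm.sign τ : ℤ) • pairProd B τ else 0

lemma subPf_smul (B : Matrix (Fin (2 * n + 1)) (Fin (2 * n + 1)) R) (c : R)
    (j : Fin (2 * n + 1)) : subPf (c • B) j = c ^ n * subPf B j := by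
  simp only [subPf, Finset.mul_sum]
  refine Finset.sum_congr rfl fun τ _ => ?_
  split_ifs
  · simp only [pairProd, Matrix.smul_apply, smul_eq_mul, Finset.prod_mul_distrib,
      Finset.prod_const, Finset.card_univ, Fintype.card_fin, mul_smul_comm]
  · simp

lemma map_subPf {R' : Type*} [CommRing R'] (φ : R →+* R')
    (B : Matrix (Fin (2 * n + 1)) (Fin (2 * n + 1)) R) (j : Fin (2 * n + 1)) :
    φ (subPf B j) = subPf (B.map φ) j := by
  simp only [subPf, map_sum]
  refine Finset.sum_congr rfl fun τ _ => ?_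
  split_ifs
  · simp [pairProd]
  · simp

lemma subPf_eq_zero (B : Matrix (Fin (2 * n + 1)) (Fin (2 * n + 1)) R) {j k : Fin (2 * n + 1)}
    (hjk : j ≠ k) (h1 : ∀ a, B a k = 0) (h2 : ∀ a, B k a = 0) : subPf B j = 0 := by
  refine Finset.sum_eq_zero fun τ _ => ?_
  split_ifs with hτ
  · obtain h0 | ⟨i, hi⟩ := eq_zero_or_oddPos_or_evenPos (τ.symm k)
    · rw [Equiv.symm_apply_eq] at h0
      exact absurd (hτ.symm.trans h0.symm) hjk
    · rw [pairProd, Finset.prod_eq_zero (Finset.mem_univ i), smul_zero]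
      obtain hi | hi := hi
      · rw [← hi, Equiv.apply_symm_apply, h2]
      · rw [← hi, Equiv.apply_symm_apply, h1]
  · rfl

lemma subPf_eq_sum_perm (B : Matrix (Fin (2 * n + 1)) (Fin (2 * n + 1)) R)
    (k : Fin (2 * n + 1)) :
    subPf B k = (-1 : R) ^ (k : ℕ) * ∑ σ : Equiv.Perm (Fin (2 * n)), (Equiv.Perm.sign σ : ℤ) •
        ∏ i : Fin n, B.submatrix k.succAbove k.succAbove
          (σ ⟨2 * (i : ℕ), two_mul_val_lt i⟩) (σ ⟨2 * (i : ℕ) + 1, two_mul_val_add_one_lt i⟩) := by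
  rw [subPf, ← Equiv.sum_comp (Equiv.mulLeft (Fin.cycleRange k)⁻¹),
    ← Equiv.sum_comp Equiv.Perm.decomposeFin.symm, Fintype.sum_prod_type, Finset.sum_eq_single 0]
  · rw [Finset.mul_sum]
    refine Finset.sum_congr rfl fun σ _ => ?_
    have hs : ∀ m : Fin (2 * n), (Equiv.mulLeft (Fin.cycleRange k)⁻¹)
        (Equiv.Perm.decomposeFin.symm (0, σ)) m.succ = k.succAbove (σ m) := by
      intro m
      simp [Equiv.Perm.inv_def]
    have h0 : (Equiv.mulLeft (Fin.cycleRange k)⁻¹)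
        (Equiv.Perm.decomposeFin.symm (0, σ)) 0 = k := by
      simp [Equiv.Perm.inv_def]
    have hprod : pairProd B ((Equiv.mulLeft (Fin.cycleRange k)⁻¹)
        (Equiv.Perm.decomposeFin.symm (0, σ))) = ∏ i : Fin n,
          B.submatrix k.succAbove k.succAbove
            (σ ⟨2 * (i : ℕ), two_mul_val_lt i⟩) (σ ⟨2 * (i : ℕ) + 1, two_mul_val_add_one_lt i⟩) := by
      refine Finset.prod_congr rfl fun i _ => ?_
      rw [Matrix.submatrix_apply, ← hs, ← hs]
      rfl
    rw [if_pos h0, hprod, Equiv.coe_mulLeft, Equiv.Perm.sign_mul, Equiv.Perm.sign_inv,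
      Fin.sign_cycleRange, Equiv.Perm.decomposeFin.symm_sign]
    simp [mul_assoc]
  · intro p _ hp
    refine Finset.sum_eq_zero fun σ _ => if_neg ?_
    simp only [Equiv.coe_mulLeft, Equiv.Perm.mul_apply,
      Equiv.Perm.decomposeFin_symm_apply_zero, Equiv.Perm.inv_def, Equiv.symm_apply_eq,
      Fin.cycleRange_self]
    exact hp
  · simp

lemma Derivation.leibniz_finset_prod {A ι' : Type*} [CommRing A] [Algebra A R] [DecidableEq ι']
    (E : Derivation A R R) (s : Finset ι') (f : ι' → R) :
    E (∏ i ∈ s, f i) = ∑ i ∈ s, E (f i) * ∏ j ∈ s.erase i, f j := by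
  induction s using Finset.induction_on with
  | empty => simp
  | insert a s ha ih =>
    rw [Finset.prod_insert ha, E.leibniz, ih, Finset.sum_insert ha, Finset.erase_insert ha,
      smul_eq_mul, smul_eq_mul, Finset.mul_sum, add_comm, mul_comm (∏ i ∈ s, f i)]
    congr 1
    refine Finset.sum_congr rfl fun i hi => ?_
    have hia : a ≠ i := fun h => ha (h ▸ hi)
    rw [Finset.erase_insert_of_ne hia, Finset.prod_insert (fun h => ha (Finset.mem_of_mem_erase h))]
    ring

variable {A : Type*} [CommRing A] [Algebra A R]

/-- A derivation acting on the entries of a matrix as the elementary matrix replacing the index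
`e` by `c`. -/
def IsElementary (E : Derivation A R R) (B : Matrix (Fin (2 * n + 1)) (Fin (2 * n + 1)) R)
    (c e : Fin (2 * n + 1)) : Prop :=
  ∀ a b, E (B a b) = (if a = e then B c b else 0) + (if b = e then B a c else 0)

variable {E : Derivation A R R} {B : Matrix (Fin (2 * n + 1)) (Fin (2 * n + 1)) R}
  {c e : Fin (2 * n + 1)}

lemma IsElementary.map_pairProd (h : IsElementary E B c e) (τ : Equiv.Perm (Fin (2 * n + 1))) :
    E (pairProd B τ) =
      if τ 0 = e then 0 else pairProd B fun m => Function.update id e c (τ m) := by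
  classical
  rw [pairProd, E.leibniz_finset_prod]
  have key : ∀ i : Fin n, τ (oddPos i) ≠ e → τ (evenPos i) ≠ e →
      E (B (τ (oddPos i)) (τ (evenPos i))) = 0 := fun i h1 h2 => by
    rw [h, if_neg h1, if_neg h2, add_zero]
  have hne : ∀ m m', m ≠ m' → τ m = e → τ m' ≠ e := fun m m' hm h1 h2 =>
    hm (τ.injective (h1.trans h2.symm))
  split_ifs with h0
  · refine Finset.sum_eq_zero fun i _ => ?_
    rw [key i (hne _ _ (oddPos_ne_zero i).symm h0) (hne _ _ (evenPos_ne_zero i).symm h0), zero_mul]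
  · obtain h1 | ⟨i, hi⟩ := eq_zero_or_oddPos_or_evenPos (τ.symm e)
    · exact absurd ((Equiv.symm_apply_eq _).1 h1).symm h0
    · have hi' : e = τ (oddPos i) ∨ e = τ (evenPos i) := by
        rwa [Equiv.symm_apply_eq, Equiv.symm_apply_eq] at hi
      have hother : ∀ j, j ≠ i → τ (oddPos j) ≠ e ∧ τ (evenPos j) ≠ e := by
        intro j hj
        obtain hi' | hi' := hi'
        · exact ⟨hne _ _ (oddPos_injective.ne hj.symm) hi'.symm,
            hne _ _ (oddPos_ne_evenPos i j) hi'.symm⟩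
        · exact ⟨hne _ _ (oddPos_ne_evenPos j i).symm hi'.symm,
            hne _ _ (evenPos_injective.ne hj.symm) hi'.symm⟩
      rw [Finset.sum_eq_single i, pairProd, ← Finset.mul_prod_erase _ _ (Finset.mem_univ i)]
      · congr 1
        · rw [h]
          obtain hi' | hi' := hi'
          · have := hne _ _ (oddPos_ne_evenPos i i) hi'.symm
            simp [hi'.symm, this]
          · have := hne _ _ (oddPos_ne_evenPos i i).symm hi'.symm
            simp [hi'.symm, this]
        · refine Finset.prod_congr rfl fun j hj => ?_
          obtain ⟨h1, h2⟩ := hother j (Finset.ne_of_mem_erase hj)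
          rw [Function.update_of_ne h1, Function.update_of_ne h2, id, id]
      · intro j _ hj
        rw [key j (hother j hj).1 (hother j hj).2, zero_mul]
      · simp

/-- Sub-maximal Pfaffians are covariant under elementary matrices. -/
lemma IsElementary.map_subPf [IsAddTorsionFree R] (h : IsElementary E B c e)
    (j : Fin (2 * n + 1)) :
    E (subPf B j) = (if c = e then subPf B j else 0) - (if c = j then subPf B e else 0) := by
  have hE : E (subPf B j) = if j = e then 0 else ∑ τ : Equiv.Perm (Fin (2 * n + 1)),
      if τ 0 = j then (Equiv.Perm.sign τ : ℤ) •
        pairProd B (fun m => Function.update id e c (τ m)) else 0 := by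
    rw [subPf, map_sum]
    split_ifs with hj
    · subst hj
      refine Finset.sum_eq_zero fun τ _ => ?_
      split_ifs with h0
      · rw [map_zsmul, h.map_pairProd, if_pos h0, smul_zero]
      · exact map_zero E
    · refine Finset.sum_congr rfl fun τ _ => ?_
      split_ifs with h0
      · rw [map_zsmul, h.map_pairProd, if_neg (h0 ▸ hj)]
      · exact map_zero E
  rw [hE]
  by_cases hj : j = e
  · subst hj
    simp
  rw [if_neg hj]
  by_cases hce : c = e
  · subst hce
    have hid : Function.update (id : Fin (2 * n + 1) → _) c c = id := Function.update_eq_self c id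
    rw [if_neg (Ne.symm hj), if_pos rfl, sub_zero, subPf]
    simp only [hid, id]
  rw [if_neg hce, zero_sub]
  by_cases hcj : c = j
  · subst hcj
    rw [if_pos rfl, subPf, ← Equiv.sum_comp (Equiv.mulLeft (Equiv.swap e c)), ← Finset.sum_neg_distrib]
    refine Finset.sum_congr rfl fun τ _ => ?_
    have h0 : (Equiv.mulLeft (Equiv.swap e c)) τ 0 = c ↔ τ 0 = e := by
      rw [Equiv.coe_mulLeft, Equiv.Perm.mul_apply, ← Equiv.eq_symm_apply, Equiv.symm_swap,
        Equiv.swap_apply_right]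
    simp only [h0]
    split_ifs with hτ
    · rw [Equiv.coe_mulLeft, Equiv.Perm.sign_mul, Equiv.Perm.sign_swap (Ne.symm hce)]
      rw [pairProd_congr B (t' := τ)]
      · simp
      · intro m hm
        have hm' : τ m ≠ e := fun h1 => hm (τ.injective (h1.trans hτ.symm))
        rw [Equiv.Perm.mul_apply]
        by_cases hmc : τ m = c
        · rw [hmc, Equiv.swap_apply_right, Function.update_self]
        · rw [Equiv.swap_apply_of_ne_of_ne hm' hmc, Function.update_of_ne hm', id]
    · exact neg_zero.symm
  · rw [if_neg hcj, neg_zero, ← self_eq_neg]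
    nth_rewrite 1 [← Equiv.sum_comp (Equiv.mulLeft (Equiv.swap c e))]
    rw [← Finset.sum_neg_distrib]
    refine Finset.sum_congr rfl fun τ _ => ?_
    have h0 : (Equiv.mulLeft (Equiv.swap c e)) τ 0 = j ↔ τ 0 = j := by
      rw [Equiv.coe_mulLeft, Equiv.Perm.mul_apply, ← Equiv.eq_symm_apply, Equiv.symm_swap,
        Equiv.swap_apply_of_ne_of_ne (Ne.symm hcj) hj]
    simp only [h0]
    split_ifs with hτ
    · rw [Equiv.coe_mulLeft, Equiv.Perm.sign_mul, Equiv.Perm.sign_swap hce]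
      rw [pairProd_congr B (t' := fun m => Function.update id e c (τ m))]
      · simp
      · intro m hm
        rw [Equiv.Perm.mul_apply]
        by_cases hmc : τ m = c
        · rw [hmc, Equiv.swap_apply_left, Function.update_self, Function.update_of_ne hce, id]
        by_cases hme : τ m = e
        · rw [hme, Equiv.swap_apply_right, Function.update_self, Function.update_of_ne hce, id]
        · rw [Equiv.swap_apply_of_ne_of_ne hmc hme]
    · exact neg_zero.symm

end SubPfaffian

/-- The entries of a skew-symmetric matrix together with the partial derivatives with respect to
them. -/
structure SkewPartials (K F ι : Type*) [CommRing K] [Field F] [Algebra K F] [DecidableEq ι] where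
  /-- The entries. -/
  x : Matrix ι ι F
  /-- The partial derivatives. -/
  d : ι → ι → Derivation K F F
  x_swap : ∀ a b, x b a = -x a b
  d_swap : ∀ a b, d b a = -d a b
  d_x : ∀ a b c e, d a b (x c e) =
    (if a = c ∧ b = e then 1 else 0) - (if a = e ∧ b = c then 1 else 0)

namespace SkewPartials

variable {K F ι : Type*} [CommRing K] [Field F] [CharZero F] [Algebra K F] [DecidableEq ι]
  [Fintype ι]

section Covariant

variable (Q : SkewPartials K F ι)

/-- A family of functions transforming like the sub-maximal Pfaffians. -/
structure Covariant (q : ι → F) : Prop where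
  sum_mul_d : ∀ c e j, ∑ b, Q.x c b * Q.d e b (q j) =
    (if c = e then q j else 0) - (if c = j then q e else 0)
  ne_zero : ∀ j, q j ≠ 0

/-- The matrix of logarithmic derivatives of the `k`-th member of a family. -/
def logGrad (q : ι → F) (k : ι) : Matrix ι ι F := fun a b => (q k)⁻¹ * Q.d a b (q k)

omit [CharZero F] [Fintype ι] in
lemma logGrad_swap (q : ι → F) (k a b : ι) : Q.logGrad q k b a = -Q.logGrad q k a b := by
  rw [logGrad, Q.d_swap, Derivation.neg_apply, mul_neg]
  rfl

variable {Q} {q : ι → F} (hq : Q.Covariant q) (k : ι)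

namespace Covariant

include hq

omit [CharZero F] in
lemma x_mul_logGrad (c e : ι) : ∑ b, Q.x c b * Q.logGrad q k b e =
    (if c = k then q e * (q k)⁻¹ else 0) - if c = e then 1 else 0 := by
  have h := congrArg ((q k)⁻¹ * ·) (hq.sum_mul_d c e k)
  simp only [Finset.mul_sum] at h
  rw [← neg_inj, ← Finset.sum_neg_distrib]
  refine Eq.trans (Finset.sum_congr rfl fun b _ => ?_) (h.trans ?_)
  · rw [Q.logGrad_swap, logGrad]
    ring
  · rw [mul_sub, neg_sub]
    congr 1
    · split_ifs
      · exact inv_mul_cancel₀ (hq.ne_zero k)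
      · exact mul_zero _
    · split_ifs
      · exact mul_comm _ _
      · exact mul_zero _

omit [CharZero F] in
lemma logGrad_mul_x (c e : ι) : ∑ b, Q.logGrad q k c b * Q.x b e =
    (if e = k then q c * (q k)⁻¹ else 0) - if c = e then 1 else 0 := by
  simp only [eq_comm (a := c), ← hq.x_mul_logGrad k e c]
  refine Finset.sum_congr rfl fun b _ => ?_
  rw [Q.logGrad_swap, Q.x_swap]
  ring

omit [CharZero F] in
/-- Multiplying by the logarithmic gradient inverts the skew-symmetric matrix. -/
lemma sum_logGrad_mul_sum_x (c : ι) (v : ι → F) :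
    ∑ b, Q.logGrad q k c b * ∑ e, Q.x b e * v e = q c * (q k)⁻¹ * v k - v c := by
  have : ∑ b, Q.logGrad q k c b * ∑ e, Q.x b e * v e =
      ∑ e, (∑ b, Q.logGrad q k c b * Q.x b e) * v e := by
    simp only [Finset.mul_sum, Finset.sum_mul, mul_assoc]
    exact Finset.sum_comm
  rw [this]
  simp [hq.logGrad_mul_x, sub_mul, Finset.sum_sub_distrib]

lemma logGrad_left (b : ι) : Q.logGrad q k k b = 0 := by
  have h := hq.sum_logGrad_mul_sum_x k b fun e => Q.d k e (q k)
  have h0 : Q.d k k (q k) = 0 := by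
    have := congrArg (fun E : Derivation K F F => E (q k)) (Q.d_swap k k)
    exact self_eq_neg.1 this
  simp only [hq.sum_mul_d, h0, sub_self, mul_zero, Finset.sum_const_zero, zero_sub] at h
  rw [logGrad, neg_eq_zero.1 h.symm, mul_zero]

lemma logGrad_right (b : ι) : Q.logGrad q k b k = 0 := by
  rw [Q.logGrad_swap, hq.logGrad_left, neg_zero]

lemma sum_x_mul (a : ι) : ∑ b, Q.x a b * q b = 0 := by
  have h1 : ∑ b, Q.x a b * ∑ c, Q.logGrad q a b c * Q.x c a = (q a)⁻¹ * ∑ b, Q.x a b * q b := by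
    have h0 : Q.x a a = 0 := self_eq_neg.1 (Q.x_swap a a)
    simp only [hq.logGrad_mul_x, if_true, mul_sub, Finset.sum_sub_distrib, mul_ite, mul_one,
      mul_zero, Finset.sum_ite_eq', Finset.mem_univ, h0, sub_zero, Finset.mul_sum]
    exact Finset.sum_congr rfl fun b _ => by ring
  have h2 : ∑ b, Q.x a b * ∑ c, Q.logGrad q a b c * Q.x c a = 0 := by
    rw [← self_eq_neg]
    simp only [Finset.mul_sum]
    nth_rewrite 1 [Finset.sum_comm]
    simp only [← Finset.sum_neg_distrib]
    refine Finset.sum_congr rfl fun b _ => Finset.sum_congr rfl fun c _ => ?_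
    rw [Q.logGrad_swap, Q.x_swap a b, Q.x_swap c a]
    ring
  exact (mul_eq_zero.1 (h1.symm.trans h2)).resolve_left (inv_ne_zero (hq.ne_zero a))

/-- The derivative of the inverse matrix. -/
lemma map_logGrad (E : Derivation K F F) (a b : ι) : E (Q.logGrad q k a b) =
    ∑ c, ∑ e, Q.logGrad q k a c * E (Q.x c e) * Q.logGrad q k e b := by
  have h1 : ∀ e, (∑ c, E (Q.logGrad q k a c) * Q.x c e) +
      (∑ c, Q.logGrad q k a c * E (Q.x c e)) = if e = k then E (q a * (q k)⁻¹) else 0 := by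
    intro e
    have h := congrArg E (hq.logGrad_mul_x k a e)
    rw [map_sum, map_sub, apply_ite E, apply_ite E, map_zero, Derivation.map_one_eq_zero, ite_self,
      sub_zero] at h
    rw [← h, ← Finset.sum_add_distrib]
    refine Finset.sum_congr rfl fun c _ => ?_
    rw [E.leibniz, smul_eq_mul, smul_eq_mul]
    ring
  have h2 : ∑ e, ((∑ c, E (Q.logGrad q k a c) * Q.x c e) +
      (∑ c, Q.logGrad q k a c * E (Q.x c e))) * Q.logGrad q k e b = 0 := by
    simp [h1, hq.logGrad_left]
  simp only [add_mul, Finset.sum_add_distrib, Finset.sum_mul] at h2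
  have h3 : ∑ e, ∑ c, E (Q.logGrad q k a c) * Q.x c e * Q.logGrad q k e b =
      -E (Q.logGrad q k a b) := by
    rw [Finset.sum_comm]
    simp only [mul_assoc, ← Finset.mul_sum, hq.x_mul_logGrad]
    simp [mul_sub, Finset.sum_sub_distrib, hq.logGrad_right]
  rw [h3, neg_add_eq_zero] at h2
  rw [h2, Finset.sum_comm]

lemma map_sub_mul (E : Derivation K F F) (l : ι) :
    E (q l) - q l * (q k)⁻¹ * E (q k) = ∑ a, ∑ b, Q.logGrad q k l a * E (Q.x a b) * q b := by
  have h1 : ∀ a, ∑ b, E (Q.x a b) * q b = -∑ b, Q.x a b * E (q b) := by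
    intro a
    have h := congrArg E (hq.sum_x_mul a)
    rw [map_sum, map_zero] at h
    rw [← add_eq_zero_iff_eq_neg, ← Finset.sum_add_distrib, ← h]
    refine Finset.sum_congr rfl fun c _ => ?_
    rw [E.leibniz, smul_eq_mul, smul_eq_mul]
    ring
  simp only [mul_assoc, ← Finset.mul_sum, h1, mul_neg, Finset.sum_neg_distrib]
  rw [hq.sum_logGrad_mul_sum_x]
  ring

lemma d_logGrad (a b c e : ι) : Q.d a b (Q.logGrad q k c e) =
    Q.logGrad q k c a * Q.logGrad q k b e - Q.logGrad q k c b * Q.logGrad q k a e := by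
  rw [hq.map_logGrad]
  simp only [Q.d_x, mul_sub, sub_mul, Finset.sum_sub_distrib, ite_and, mul_ite, ite_mul, mul_one,
    mul_zero, zero_mul, Finset.sum_ite_eq, Finset.mem_univ, if_true]
  congr 1
  simp

lemma d_sub_mul (a b l : ι) : Q.d a b (q l) - q l * (q k)⁻¹ * Q.d a b (q k) =
    Q.logGrad q k l a * q b - Q.logGrad q k l b * q a := by
  rw [hq.map_sub_mul]
  simp only [Q.d_x, mul_sub, sub_mul, Finset.sum_sub_distrib, ite_and, mul_ite, ite_mul, mul_one,
    mul_zero, zero_mul, Finset.sum_ite_eq, Finset.mem_univ, if_true]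
  congr 1
  simp

end Covariant

end Covariant

end SkewPartials

namespace SkewPartials

variable {K F ι : Type*} [CommRing K] [Field F] [CharZero F] [Algebra K F] [DecidableEq ι]
  [Fintype ι] (Q : SkewPartials K F ι)

/-- An algebra with elements multiplying like the products of pairs of anticommuting variables,
and a derivation contracting them with the partial derivatives. -/
structure GrassmannExtension (R : Type*) [CommRing R] [Algebra F R] where
  /-- The products of pairs of anticommuting variables. -/
  η : ι → ι → R
  /-- The derivation. -/
  D : Derivation ℤ R R
  η_swap : ∀ a b, η b a = -η a b
  η_mul : ∀ a b c e, η a b * η c e = -(η a c * η b e)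
  D_η : ∀ a b, D (η a b) = 0
  D_algebraMap : ∀ y, D (algebraMap F R y) = ∑ a, ∑ b, Q.d a b y • η a b

variable {Q} {R : Type*} [CommRing R] [Algebra F R] (G : Q.GrassmannExtension R)

namespace GrassmannExtension

omit [CharZero F] in
lemma D_smul (y : F) (r : R) : G.D (y • r) = y • G.D r + (∑ a, ∑ b, Q.d a b y • G.η a b) * r := by
  rw [Algebra.smul_def, G.D.leibniz, G.D_algebraMap, smul_eq_mul, smul_eq_mul, Algebra.smul_def]
  ring

/-- The logarithmic derivative of a member of a family. -/
def γ (q : ι → F) (k : ι) : R := ∑ a, ∑ b, Q.logGrad q k a b • G.η a b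

lemma sum_smul_η_self (v : ι → F) : ∑ a, ∑ b, (v a * v b) • G.η a b = 0 := by
  have h : ∑ a, ∑ b, (v a * v b) • G.η a b = -∑ a, ∑ b, (v a * v b) • G.η a b := by
    nth_rewrite 1 [Finset.sum_comm]
    simp only [← Finset.sum_neg_distrib]
    refine Finset.sum_congr rfl fun a _ => Finset.sum_congr rfl fun b _ => ?_
    rw [G.η_swap, smul_neg, mul_comm]
  have h2 : (2 : F) • ∑ a, ∑ b, (v a * v b) • G.η a b = 0 := by
    rw [two_smul]
    exact add_eq_zero_iff_eq_neg.2 h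
  exact (smul_eq_zero.1 h2).resolve_left two_ne_zero

lemma sum_smul_η_mul (u w v : ι → F) :
    (∑ a, ∑ b, (u a * v b) • G.η a b) * (∑ a, ∑ b, (w a * v b) • G.η a b) = 0 := by
  have h : (∑ a, ∑ b, (u a * v b) • G.η a b) * (∑ a, ∑ b, (w a * v b) • G.η a b) =
      -((∑ a, ∑ b, (u a * w b) • G.η a b) * ∑ a, ∑ b, (v a * v b) • G.η a b) := by
    simp only [Finset.sum_mul_sum, ← Finset.sum_neg_distrib]
    refine Finset.sum_congr rfl fun a _ => ?_
    rw [Finset.sum_comm]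
    refine Finset.sum_congr rfl fun b _ => Finset.sum_congr rfl fun c _ =>
      Finset.sum_congr rfl fun e _ => ?_
    rw [smul_mul_smul_comm, smul_mul_smul_comm, G.η_mul, smul_neg]
    congr 2
    ring
  rw [h, sum_smul_η_self, mul_zero, neg_zero]

variable {q : ι → F} (hq : Q.Covariant q)
include hq

lemma γ_sub (k l : ι) : G.γ q l - G.γ q k =
    ((q l)⁻¹ * 2) • ∑ a, ∑ b, (Q.logGrad q k l a * q b) • G.η a b := by
  have h1 : ∑ a, ∑ b, (Q.logGrad q k l b * q a) • G.η a b =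
      -∑ a, ∑ b, (Q.logGrad q k l a * q b) • G.η a b := by
    rw [Finset.sum_comm]
    simp only [← Finset.sum_neg_distrib]
    refine Finset.sum_congr rfl fun a _ => Finset.sum_congr rfl fun b _ => ?_
    rw [G.η_swap, smul_neg]
  have h2 : ∀ a b, Q.logGrad q l a b - Q.logGrad q k a b =
      (q l)⁻¹ * (Q.logGrad q k l a * q b - Q.logGrad q k l b * q a) := by
    intro a b
    rw [← hq.d_sub_mul, mul_sub, mul_assoc (q l), inv_mul_cancel_left₀ (hq.ne_zero l)]
    rfl
  rw [γ, γ, ← Finset.sum_sub_distrib]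
  simp only [← Finset.sum_sub_distrib, ← sub_smul, h2, mul_smul (q l)⁻¹, ← Finset.smul_sum]
  rw [two_smul]
  simp only [sub_smul, Finset.sum_sub_distrib, h1, sub_neg_eq_add]

lemma γ_sub_mul (k l m : ι) : (G.γ q l - G.γ q k) * (G.γ q m - G.γ q k) = 0 := by
  rw [G.γ_sub hq, G.γ_sub hq, smul_mul_smul_comm, sum_smul_η_mul, smul_zero]

lemma D_γ (k : ι) : G.D (G.γ q k) = 2 * G.γ q k ^ 2 := by
  have hη : ∀ a b c e, G.η c e * G.η a b = G.η a c * G.η e b := by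
    intro a b c e
    rw [G.η_mul, G.η_swap a c, neg_mul, neg_neg]
  have h1 : ∑ a, ∑ b, ∑ c, ∑ e,
      (Q.logGrad q k a c * Q.logGrad q k e b) • (G.η c e * G.η a b) = G.γ q k ^ 2 := by
    rw [pow_two, γ]
    simp only [Finset.sum_mul_sum]
    refine Finset.sum_congr rfl fun a _ => ?_
    rw [Finset.sum_comm, Finset.sum_congr rfl fun c _ => Finset.sum_comm, Finset.sum_comm]
    refine Finset.sum_congr rfl fun e _ => Finset.sum_congr rfl fun c _ =>
      Finset.sum_congr rfl fun b _ => ?_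
    rw [hη, smul_mul_smul_comm]
  have h2 : ∑ a, ∑ b, ∑ c, ∑ e,
      (Q.logGrad q k a e * Q.logGrad q k c b) • (G.η c e * G.η a b) = -G.γ q k ^ 2 := by
    rw [← h1]
    simp only [← Finset.sum_neg_distrib]
    refine Finset.sum_congr rfl fun a _ => Finset.sum_congr rfl fun b _ => ?_
    rw [Finset.sum_comm]
    refine Finset.sum_congr rfl fun c _ => Finset.sum_congr rfl fun e _ => ?_
    rw [G.η_swap c e, neg_mul, smul_neg]
  have h3 : G.D (G.γ q k) = G.γ q k ^ 2 - -G.γ q k ^ 2 := by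
    rw [← h2, ← h1, γ]
    simp only [map_sum, D_smul, D_η, smul_zero, zero_add, Finset.sum_mul, hq.d_logGrad,
      smul_mul_assoc, sub_smul, sub_mul, Finset.sum_sub_distrib]
  rw [h3]
  ring

lemma D_pow_γ (k : ι) (m : ℕ) : G.D (G.γ q k ^ m) = 2 * m * G.γ q k ^ (m + 1) := by
  obtain _ | m := m
  · simp
  · rw [G.D.leibniz_pow, G.D_γ hq, Nat.add_sub_cancel, smul_eq_mul, nsmul_eq_mul]
    ring

lemma sub_mul_pow_sub_pow (k l : ι) (m : ℕ) :
    (G.γ q l - G.γ q k) * (G.γ q l ^ m - G.γ q k ^ m) = 0 := by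
  obtain ⟨r, hr⟩ := sub_dvd_pow_sub_pow (G.γ q l) (G.γ q k) m
  rw [hr, ← mul_assoc, G.γ_sub_mul hq, zero_mul]

lemma sum_mul_sum_pow (α : ι → ℤ) (m : ℕ) :
    (∑ k, (α k : R) * G.γ q k) * ∑ k, (α k : R) * G.γ q k ^ m =
      (∑ k, (α k : R)) * ∑ k, (α k : R) * G.γ q k ^ (m + 1) := by
  have h : ∀ k l, (α k : R) * (α l : R) * ((G.γ q k - G.γ q l) * G.γ q l ^ m) =
      (α k : R) * (α l : R) * ((G.γ q k - G.γ q l) * G.γ q k ^ m) := by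
    intro k l
    have := G.sub_mul_pow_sub_pow hq l k m
    rw [mul_sub, sub_eq_zero] at this
    rw [this]
  have hsum : ∑ k, ∑ l, (α k : R) * (α l : R) * ((G.γ q k - G.γ q l) * G.γ q l ^ m) =
      -∑ k, ∑ l, (α k : R) * (α l : R) * ((G.γ q k - G.γ q l) * G.γ q l ^ m) := by
    nth_rewrite 1 [Finset.sum_comm]
    simp only [← Finset.sum_neg_distrib]
    refine Finset.sum_congr rfl fun k _ => Finset.sum_congr rfl fun l _ => ?_
    rw [h k l]
    ring
  have h2 : (2 : F) • ∑ k, ∑ l, (α k : R) * (α l : R) * ((G.γ q k - G.γ q l) * G.γ q l ^ m) = 0 := by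
    rw [two_smul]
    exact add_eq_zero_iff_eq_neg.2 hsum
  rw [← sub_eq_zero, ← (smul_eq_zero.1 h2).resolve_left two_ne_zero, Finset.sum_mul_sum,
    Finset.sum_mul_sum]
  simp only [← Finset.sum_sub_distrib]
  refine Finset.sum_congr rfl fun k _ => Finset.sum_congr rfl fun l _ => ?_
  ring

omit [CharZero F] in
lemma D_algebraMap_zpow (k : ι) (a : ℤ) :
    G.D (algebraMap F R (q k ^ a)) = algebraMap F R (q k ^ a) * (a * G.γ q k) := by
  have hd : ∀ b c, Q.d b c (q k ^ a) = q k ^ a * a * Q.logGrad q k b c := by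
    intro b c
    rw [Derivation.leibniz_zpow, zpow_sub_one₀ (hq.ne_zero k), zsmul_eq_mul, smul_eq_mul, logGrad]
    ring
  rw [G.D_algebraMap, γ]
  simp only [hd, mul_smul, ← Finset.smul_sum]
  rw [Algebra.smul_def, Algebra.smul_def, map_intCast]

omit [CharZero F] in
lemma D_algebraMap_prod_zpow (α : ι → ℤ) (s : Finset ι) :
    G.D (algebraMap F R (∏ k ∈ s, q k ^ α k)) =
      algebraMap F R (∏ k ∈ s, q k ^ α k) * ∑ k ∈ s, (α k : R) * G.γ q k := by
  induction s using Finset.induction_on with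
  | empty => simp
  | insert a s ha ih =>
    rw [Finset.prod_insert ha, Finset.sum_insert ha, map_mul, G.D.leibniz, ih,
      G.D_algebraMap_zpow hq, smul_eq_mul, smul_eq_mul]
    ring

/-- The iterates of the derivation on a product of powers. -/
lemma iterate_D (α : ι → ℤ) (m : ℕ) :
    G.D^[m + 1] (algebraMap F R (∏ k, q k ^ α k)) =
      ((∏ j ∈ Finset.range m, (∑ k, α k + 2 * (j + 1)) : ℤ) : R) *
      (algebraMap F R (∏ k, q k ^ α k) * ∑ k, (α k : R) * G.γ q k ^ (m + 1)) := by
  set y := ∏ k, q k ^ α k with hy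
  have hDy : G.D (algebraMap F R y) = algebraMap F R y * ∑ k, (α k : R) * G.γ q k :=
    G.D_algebraMap_prod_zpow hq α Finset.univ
  clear_value y
  induction m with
  | zero =>
    rw [zero_add, Function.iterate_one, hDy]
    simp
  | succ m ih =>
    rw [Function.iterate_succ_apply', ih, G.D.leibniz, Derivation.map_intCast, smul_zero, add_zero,
      G.D.leibniz, hDy, map_sum, smul_eq_mul, smul_eq_mul, smul_eq_mul,
      Finset.prod_range_succ]
    have hD : ∑ k, G.D ((α k : R) * G.γ q k ^ (m + 1)) =
        2 * (m + 1) * ∑ k, (α k : R) * G.γ q k ^ (m + 2) := by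
      rw [Finset.mul_sum]
      refine Finset.sum_congr rfl fun k _ => ?_
      rw [G.D.leibniz, Derivation.map_intCast, smul_zero, add_zero, G.D_pow_γ hq, smul_eq_mul]
      push_cast
      ring
    have hsum := G.sum_mul_sum_pow hq α (m + 1)
    rw [hD]
    push_cast
    linear_combination (∏ x ∈ Finset.range m, (∑ k, (α k : R) + 2 * ((x : R) + 1))) *
      algebraMap F R y * hsum

end GrassmannExtension

end SkewPartials

section PairSums

variable {n : ℕ}

/-- The coefficient of the product of all the anticommuting variables except the `j`-th in a
product of pairs of anticommuting variables. -/
def pairCoeff (j : Fin (2 * n + 1)) (t : Fin n → Fin (2 * n + 1) × Fin (2 * n + 1)) : ℤ :=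
  ∑ τ : Equiv.Perm (Fin (2 * n + 1)),
    if τ 0 = j ∧ ∀ m, t m = (τ (oddPos m), τ (evenPos m)) then (Equiv.Perm.sign τ : ℤ) else 0

lemma sum_pairCoeff_smul {R : Type*} [CommRing R]
    (B : Matrix (Fin (2 * n + 1)) (Fin (2 * n + 1)) R) (j : Fin (2 * n + 1)) :
    ∑ t : Fin n → Fin (2 * n + 1) × Fin (2 * n + 1),
      pairCoeff j t • ∏ m, B (t m).1 (t m).2 = subPf B j := by
  simp only [pairCoeff, Finset.sum_smul]
  rw [Finset.sum_comm]
  refine Finset.sum_congr rfl fun τ _ => ?_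
  rw [Finset.sum_eq_single fun m => (τ (oddPos m), τ (evenPos m))]
  · simp only [implies_true, and_true, ite_smul, zero_smul]
    rfl
  · intro t _ ht
    rw [if_neg, zero_smul]
    exact fun h => ht (funext h.2)
  · simp

/-- The sequence with first term `j` and remaining terms given by a sequence of pairs. -/
def pairSeq {ι : Type*} (j : ι) (t : Fin n → ι × ι) (p : Fin (2 * n + 1)) : ι :=
  if h : p = 0 then j else
    if (p : ℕ) % 2 = 1 then
      (t ⟨(p - 1) / 2, by have := p.2; have := Fin.val_ne_zero_iff.2 h; omega⟩).1
    else (t ⟨(p - 1) / 2, by have := p.2; have := Fin.val_ne_zero_iff.2 h; omega⟩).2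

lemma pairSeq_zero {ι : Type*} (j : ι) (t : Fin n → ι × ι) : pairSeq j t 0 = j := dif_pos rfl

lemma pairSeq_oddPos {ι : Type*} (j : ι) (t : Fin n → ι × ι) (m : Fin n) :
    pairSeq j t (oddPos m) = (t m).1 := by
  rw [pairSeq, dif_neg (oddPos_ne_zero m), if_pos (by simp [oddPos])]
  congr 3
  simp [oddPos]

lemma pairSeq_evenPos {ι : Type*} (j : ι) (t : Fin n → ι × ι) (m : Fin n) :
    pairSeq j t (evenPos m) = (t m).2 := by
  rw [pairSeq, dif_neg (evenPos_ne_zero m), if_neg (by simp [evenPos])]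
  congr 3
  simp only [evenPos]
  omega

lemma det_pairSeq {K : Type*} [CommRing K] (j : Fin (2 * n + 1))
    (t : Fin n → Fin (2 * n + 1) × Fin (2 * n + 1)) :
    Matrix.det (Matrix.of fun r => Pi.single (pairSeq j t r) (1 : K)) = (pairCoeff j t : K) := by
  rw [← Matrix.det_transpose, Matrix.det_apply, pairCoeff]
  push_cast
  refine Finset.sum_congr rfl fun τ _ => ?_
  have h : (∀ i, τ i = pairSeq j t i) ↔
      (τ 0 = j ∧ ∀ m, t m = (τ (oddPos m), τ (evenPos m))) := by
    refine ⟨fun h => ⟨(h 0).trans (pairSeq_zero j t), fun m => ?_⟩, fun h i => ?_⟩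
    · rw [h, h, pairSeq_oddPos, pairSeq_evenPos]
    · obtain rfl | ⟨m, rfl | rfl⟩ := eq_zero_or_oddPos_or_evenPos i
      · rw [h.1, pairSeq_zero]
      · rw [pairSeq_oddPos, h.2]
      · rw [pairSeq_evenPos, h.2]
  simp only [Matrix.transpose_apply, Matrix.of_apply, Pi.single_apply]
  rw [Finset.prod_boole]
  simp only [Finset.mem_univ, forall_true_left, h]
  split_ifs
  · simp [Units.smul_def]
  · simp

end PairSums

section Grassmann

variable (K : Type*) [CommRing K] (n : ℕ)

/-- The central elements of the Grassmann algebra on `n` generators. -/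
abbrev GrassmannCenter : Type _ := Subalgebra.center K (ExteriorAlgebra K (Fin n → K))

variable {n}

/-- The anticommuting generators. -/
def grassmannVar (a : Fin n) : ExteriorAlgebra K (Fin n → K) :=
  ExteriorAlgebra.ι K (Pi.single a 1)

/-- The product of two anticommuting generators. -/
def grassmannPair (a b : Fin n) : GrassmannCenter K n :=
  ⟨grassmannVar K a * grassmannVar K b, by
    rw [Subalgebra.mem_center_iff]
    have hswap : ∀ u v : Fin n → K, ExteriorAlgebra.ι K u * ExteriorAlgebra.ι K v =
        -(ExteriorAlgebra.ι K v * ExteriorAlgebra.ι K u) := fun u v =>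
      eq_neg_of_add_eq_zero_left (ExteriorAlgebra.ι_add_mul_swap u v)
    intro z
    induction z using ExteriorAlgebra.induction with
    | algebraMap r => exact Algebra.commutes _ _
    | ι v => rw [grassmannVar, grassmannVar, ← mul_assoc, hswap v, neg_mul, mul_assoc, hswap v,
        mul_neg, neg_neg, mul_assoc]
    | mul x y hx hy => rw [mul_assoc, hy, ← mul_assoc, hx, mul_assoc]
    | add x y hx hy => rw [add_mul, hx, hy, mul_add]⟩

lemma grassmannVar_swap (a b : Fin n) :
    grassmannVar K a * grassmannVar K b = -(grassmannVar K b * grassmannVar K a) :=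
  eq_neg_of_add_eq_zero_left (ExteriorAlgebra.ι_add_mul_swap _ _)

lemma grassmannPair_swap (a b : Fin n) : grassmannPair K b a = -grassmannPair K a b :=
  Subtype.ext (grassmannVar_swap K b a)

lemma grassmannPair_mul (a b c e : Fin n) : grassmannPair K a b * grassmannPair K c e =
    -(grassmannPair K a c * grassmannPair K b e) := by
  refine Subtype.ext ?_
  change grassmannVar K a * grassmannVar K b * (grassmannVar K c * grassmannVar K e) =
    -(grassmannVar K a * grassmannVar K c * (grassmannVar K b * grassmannVar K e))
  rw [mul_assoc, ← mul_assoc (grassmannVar K b), grassmannVar_swap K b c, neg_mul, mul_neg,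
    mul_assoc, mul_assoc]

/-- The coefficient of the product of all the generators except the `j`-th. -/
def grassmannCoeff (j : Fin n) : GrassmannCenter K n →ₗ[K] K :=
  ExteriorAlgebra.liftAlternating (Pi.single n Matrix.detRowAlternating) ∘ₗ
    LinearMap.mulLeft K (grassmannVar K j) ∘ₗ (Subalgebra.center K _).val.toLinearMap

lemma grassmannCoeff_apply (j : Fin n) (z : GrassmannCenter K n) : grassmannCoeff K j z =
    ExteriorAlgebra.liftAlternating (Pi.single n Matrix.detRowAlternating)
      (grassmannVar K j * (z : ExteriorAlgebra K (Fin n → K))) := by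
  rw [grassmannCoeff, LinearMap.comp_apply, LinearMap.comp_apply, LinearMap.mulLeft_apply,
    AlgHom.toLinearMap_apply, Subalgebra.coe_val]

lemma grassmannVar_mul_prod {n : ℕ} (j : Fin (2 * n + 1))
    (t : Fin n → Fin (2 * n + 1) × Fin (2 * n + 1)) :
    grassmannVar K j *
      ((∏ m, grassmannPair K (t m).1 (t m).2 : GrassmannCenter K _) : ExteriorAlgebra K _) =
    ExteriorAlgebra.ιMulti K (2 * n + 1) fun r => Pi.single (pairSeq j t r) 1 := by
  rw [ExteriorAlgebra.ιMulti_apply, List.ofFn_succ, List.prod_cons, pairSeq_zero, List.ofFn_mul',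
    List.prod_flatten, List.map_ofFn, ← List.prod_ofFn]
  congr 1
  change (Subalgebra.center K _).val _ = _
  rw [map_list_prod, List.map_ofFn]
  congr 2
  funext m
  have h1 := pairSeq_oddPos j t m
  have h2 := pairSeq_evenPos j t m
  simp only [oddPos, evenPos] at h1 h2
  simp [List.ofFn_succ, Fin.succ, h1, h2, grassmannPair, grassmannVar]

lemma grassmannCoeff_prod {n : ℕ} (j : Fin (2 * n + 1))
    (t : Fin n → Fin (2 * n + 1) × Fin (2 * n + 1)) :
    grassmannCoeff K j (∏ m, grassmannPair K (t m).1 (t m).2) = pairCoeff j t := by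
  rw [grassmannCoeff_apply, grassmannVar_mul_prod, ExteriorAlgebra.liftAlternating_apply_ιMulti,
    Pi.single_eq_same, ← det_pairSeq]
  rfl

end Grassmann

section TensorDerivation

open TensorProduct

variable {K F : Type*} [CommRing K] [CommRing F] [Algebra K F] (A : Type*) [CommRing A]
  [Algebra K A]

/-- The extension of a derivation to a base change which kills the other factor. -/
noncomputable def Derivation.extendTensor (d : Derivation K F F) :
    Derivation K (F ⊗[K] A) (F ⊗[K] A) :=
  Derivation.mk' ((d : F →ₗ[K] F).rTensor A) fun x y => by
    induction x with
    | zero => simp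
    | add x x' hx hx' => simp only [add_mul, map_add, hx, hx', smul_add, add_smul]; ring
    | tmul f a =>
      induction y with
      | zero => simp
      | add y y' hy hy' => simp only [mul_add, map_add, hy, hy', smul_add, add_smul]; ring
      | tmul g b =>
        simp [add_tmul, mul_comm a b]

lemma Derivation.extendTensor_tmul (d : Derivation K F F) (f : F) (a : A) :
    d.extendTensor A (f ⊗ₜ a) = d f ⊗ₜ a := rfl

end TensorDerivation

namespace SkewPartials

open TensorProduct

section

variable {K F : Type*} [CommRing K] [Field F] [Algebra K F] {N : ℕ}
  (Q : SkewPartials K F (Fin N))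

/-- The derivation given by the differential of a skew-symmetric matrix. -/
noncomputable def grassmannDerivation : Derivation K (F ⊗[K] GrassmannCenter K N)
    (F ⊗[K] GrassmannCenter K N) :=
  ∑ a, ∑ b, ((1 : F) ⊗ₜ[K] grassmannPair K a b) • (Q.d a b).extendTensor (GrassmannCenter K N)

lemma grassmannDerivation_tmul (y : F) (z : GrassmannCenter K N) :
    Q.grassmannDerivation (y ⊗ₜ z) = ∑ a, ∑ b, Q.d a b y ⊗ₜ (grassmannPair K a b * z) := by
  have hsum : ∀ d : Fin N → Derivation K (F ⊗[K] GrassmannCenter K N)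
      (F ⊗[K] GrassmannCenter K N), ∀ x, (∑ a, d a) x = ∑ a, d a x := fun d x => by
    have := congrFun (map_sum Derivation.coeFnAddMonoidHom d Finset.univ) x
    rwa [Finset.sum_apply] at this
  simp [grassmannDerivation, hsum, Derivation.extendTensor_tmul]

/-- The Grassmann extension of the field by central elements. -/
noncomputable def grassmannExtension : Q.GrassmannExtension (F ⊗[K] GrassmannCenter K N) where
  η a b := 1 ⊗ₜ grassmannPair K a b
  D := Derivation.mk' Q.grassmannDerivation.toLinearMap.toAddMonoidHom.toIntLinearMap fun x y =>
    Q.grassmannDerivation.leibniz x y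
  η_swap a b := by rw [grassmannPair_swap, tmul_neg]
  η_mul a b c e := by
    rw [Algebra.TensorProduct.tmul_mul_tmul, Algebra.TensorProduct.tmul_mul_tmul,
      grassmannPair_mul, tmul_neg]
  D_η a b := by
    refine (Q.grassmannDerivation_tmul _ _).trans ?_
    simp
  D_algebraMap y := by
    refine (Q.grassmannDerivation_tmul _ _).trans ?_
    simp [smul_tmul']

/-- The coefficient of the product of all the generators except the `j`-th. -/
noncomputable def grassmannEval (j : Fin N) : F ⊗[K] GrassmannCenter K N →ₗ[F] F :=
  (AlgebraTensorModule.rid K F F).toLinearMap ∘ₗ (grassmannCoeff K j).baseChange F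

end

variable {K F : Type*} [CommRing K] [Field F] [Algebra K F] {n : ℕ}
  (Q : SkewPartials K F (Fin (2 * n + 1)))

lemma grassmannEval_prod (j : Fin (2 * n + 1))
    (t : Fin n → Fin (2 * n + 1) × Fin (2 * n + 1)) :
    grassmannEval (K := K) (F := F) j (∏ m, Q.grassmannExtension.η (t m).1 (t m).2) =
      pairCoeff j t := by
  have : ∏ m, Q.grassmannExtension.η (t m).1 (t m).2 =
      (1 : F) ⊗ₜ[K] ∏ m, grassmannPair K (t m).1 (t m).2 := by
    change ∏ m, (Algebra.TensorProduct.includeRight : GrassmannCenter K (2 * n + 1) →ₐ[K] _) _ = _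
    rw [← map_prod]
    rfl
  rw [this, grassmannEval, LinearMap.comp_apply, LinearMap.baseChange_tmul, grassmannCoeff_prod]
  simp [Algebra.smul_def]

lemma grassmannEval_pow (j : Fin (2 * n + 1))
    (B : Matrix (Fin (2 * n + 1)) (Fin (2 * n + 1)) F) :
    grassmannEval (K := K) j ((∑ a, ∑ b, B a b • Q.grassmannExtension.η a b) ^ n) =
      subPf B j := by
  rw [← Finset.sum_product', Finset.univ_product_univ, Fintype.sum_pow]
  simp only [Finset.prod_smul, map_sum, map_smul, grassmannEval_prod]
  rw [← sum_pairCoeff_smul]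
  exact Finset.sum_congr rfl fun t _ => by rw [smul_eq_mul, zsmul_eq_mul, mul_comm]

variable {S : Type*} [CommRing S] (Θ : S →+* Module.End K F)
  (M : Matrix (Fin (2 * n + 1)) (Fin (2 * n + 1)) S) (h : ∀ a b y, Θ (M a b) y = Q.d a b y)

include h in
lemma iterate_D_algebraMap (m : ℕ) (y : F) :
    Q.grassmannExtension.D^[m] (algebraMap F _ y) =
      ∑ t : Fin m → Fin (2 * n + 1) × Fin (2 * n + 1), Θ (∏ i, M (t i).1 (t i).2) y •
        ∏ i, Q.grassmannExtension.η (t i).1 (t i).2 := by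
  induction m with
  | zero => simp [Algebra.algebraMap_eq_smul_one]
  | succ m ih =>
    rw [Function.iterate_succ_apply', ih, map_sum, ← (Fin.consEquiv _).sum_comp,
      Fintype.sum_prod_type_right]
    refine Finset.sum_congr rfl fun t _ => ?_
    have hD : Q.grassmannExtension.D (∏ i, Q.grassmannExtension.η (t i).1 (t i).2) = 0 := by
      rw [Derivation.leibniz_finset_prod]
      simp [Q.grassmannExtension.D_η]
    rw [GrassmannExtension.D_smul, hD, smul_zero, zero_add, ← Finset.sum_product',
      Finset.univ_product_univ, Finset.sum_mul]
    refine Finset.sum_congr rfl fun p _ => ?_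
    simp only [Fin.consEquiv_apply, Fin.prod_univ_succ, Fin.cons_zero, Fin.cons_succ, map_mul]
    rw [Module.End.mul_apply, h, smul_mul_assoc]

include h in
lemma grassmannEval_iterate_D (j : Fin (2 * n + 1)) (y : F) :
    grassmannEval (K := K) j (Q.grassmannExtension.D^[n] (algebraMap F _ y)) =
      Θ (subPf M j) y := by
  rw [Q.iterate_D_algebraMap Θ M h, map_sum, ← sum_pairCoeff_smul, map_sum, LinearMap.sum_apply]
  refine Finset.sum_congr rfl fun t _ => ?_
  rw [map_smul, grassmannEval_prod, map_zsmul, LinearMap.smul_apply, smul_eq_mul, zsmul_eq_mul,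
    mul_comm]

end SkewPartials

section PairMatrix

variable {n : ℕ}

lemma pairCoeff_eq_zero {j : Fin (2 * n + 1)} {t : Fin n → Fin (2 * n + 1) × Fin (2 * n + 1)}
    (ht : ¬Function.Injective t) : pairCoeff j t = 0 := by
  refine Finset.sum_eq_zero fun τ _ => if_neg fun h => ht fun m m' hm => ?_
  rw [h.2, h.2, Prod.mk.injEq] at hm
  exact oddPos_injective (τ.injective hm.1)

lemma pairCoeff_perm (τ : Equiv.Perm (Fin (2 * n + 1))) :
    pairCoeff (τ 0) (fun m => (τ (oddPos m), τ (evenPos m))) = Equiv.Perm.sign τ := by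
  rw [pairCoeff, Finset.sum_eq_single τ]
  · simp
  · intro τ' _ hne
    refine if_neg fun h => hne (Equiv.ext fun i => ?_)
    obtain rfl | ⟨m, rfl | rfl⟩ := eq_zero_or_oddPos_or_evenPos i
    · exact h.1
    · exact (Prod.ext_iff.1 (h.2 m)).1.symm
    · exact (Prod.ext_iff.1 (h.2 m)).2.symm
  · simp

lemma grassmannCoeff_pow {K : Type*} [CommRing K] (j : Fin (2 * n + 1))
    (B : Matrix (Fin (2 * n + 1)) (Fin (2 * n + 1)) K) :
    grassmannCoeff K j ((∑ a, ∑ b, B a b • grassmannPair K a b) ^ n) = subPf B j := by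
  rw [← Finset.sum_product', Finset.univ_product_univ, Fintype.sum_pow]
  simp only [Finset.prod_smul, map_sum, map_smul, grassmannCoeff_prod]
  rw [← sum_pairCoeff_smul]
  exact Finset.sum_congr rfl fun t _ => by rw [smul_eq_mul, zsmul_eq_mul, mul_comm]

/-- The skew-symmetric matrix of a perfect matching of the indices different from `τ 0`. -/
def pairMatrix (K : Type*) [CommRing K] (τ : Equiv.Perm (Fin (2 * n + 1))) :
    Matrix (Fin (2 * n + 1)) (Fin (2 * n + 1)) K := fun a b =>
  ∑ m : Fin n, ((if a = τ (oddPos m) ∧ b = τ (evenPos m) then 1 else 0) -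
    if a = τ (evenPos m) ∧ b = τ (oddPos m) then 1 else 0)

variable {K : Type*} [CommRing K] (τ : Equiv.Perm (Fin (2 * n + 1)))

lemma pairMatrix_swap (a b : Fin (2 * n + 1)) : pairMatrix K τ b a = -pairMatrix K τ a b := by
  rw [pairMatrix, pairMatrix, ← Finset.sum_neg_distrib]
  refine Finset.sum_congr rfl fun m _ => ?_
  rw [neg_sub]
  simp only [and_comm]

lemma pairMatrix_zero (b : Fin (2 * n + 1)) : pairMatrix K τ (τ 0) b = 0 := by
  simp [pairMatrix, (oddPos_ne_zero _).symm, (evenPos_ne_zero _).symm]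

lemma pairMatrix_oddPos (m : Fin n) (b : Fin (2 * n + 1)) :
    pairMatrix K τ (τ (oddPos m)) b = if b = τ (evenPos m) then 1 else 0 := by
  simp [pairMatrix, oddPos_injective.eq_iff, oddPos_ne_evenPos, ite_and]

lemma pairMatrix_evenPos (m : Fin n) (b : Fin (2 * n + 1)) :
    pairMatrix K τ (τ (evenPos m)) b = -if b = τ (oddPos m) then 1 else 0 := by
  simp [pairMatrix, evenPos_injective.eq_iff, (oddPos_ne_evenPos _ _).symm, ite_and]

lemma sum_pairMatrix_smul {A : Type*} [AddCommGroup A] [Module K A]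
    (η : Fin (2 * n + 1) → Fin (2 * n + 1) → A) (hη : ∀ a b, η b a = -η a b) :
    ∑ a, ∑ b, pairMatrix K τ a b • η a b =
      (2 : K) • ∑ m, η (τ (oddPos m)) (τ (evenPos m)) := by
  have : ∀ a, ∑ b, pairMatrix K τ a b • η a b = ∑ m : Fin n,
      ((if a = τ (oddPos m) then η a (τ (evenPos m)) else 0) -
        if a = τ (evenPos m) then η a (τ (oddPos m)) else 0) := fun a => by
    simp only [pairMatrix, Finset.sum_smul, sub_smul]
    rw [Finset.sum_comm]
    refine Finset.sum_congr rfl fun m _ => ?_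
    simp [ite_and]
  simp only [this]
  rw [Finset.sum_comm, Finset.smul_sum]
  refine Finset.sum_congr rfl fun m _ => ?_
  rw [Finset.sum_sub_distrib]
  simp [hη (τ (oddPos m)), two_smul]

lemma subPf_pairMatrix_ne_zero [CharZero K] [NoZeroDivisors K] :
    subPf (pairMatrix K τ) (τ 0) ≠ 0 := by
  classical
  have key : ∀ s : Fin n → Fin n, grassmannCoeff K (τ 0)
      (∏ m, grassmannPair K (τ (oddPos (s m))) (τ (evenPos (s m)))) =
      if Function.Injective s then ((Equiv.Perm.sign τ : ℤ) : K) else 0 := fun s => by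
    split_ifs with hs
    · rw [← pairCoeff_perm, ← grassmannCoeff_prod]
      exact congrArg _ ((Equiv.ofBijective s (Finite.injective_iff_bijective.1 hs)).prod_comp
        fun m => grassmannPair K (τ (oddPos m)) (τ (evenPos m)))
    · have := grassmannCoeff_prod K (τ 0) fun m => (τ (oddPos (s m)), τ (evenPos (s m)))
      rw [this, pairCoeff_eq_zero, Int.cast_zero]
      intro h
      exact hs fun m m' hm => h (by simp only [hm])
  rw [← grassmannCoeff_pow, sum_pairMatrix_smul τ _ (grassmannPair_swap K), smul_pow, map_smul,
    Fintype.sum_pow, map_sum]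
  simp only [key]
  rw [Finset.sum_ite, Finset.sum_const_zero, add_zero, Finset.sum_const, smul_eq_mul,
    nsmul_eq_mul]
  refine mul_ne_zero (pow_ne_zero _ two_ne_zero) (mul_ne_zero (Nat.cast_ne_zero.2 ?_)
    (Int.cast_ne_zero.2 (Units.ne_zero _)))
  exact Finset.card_ne_zero_of_mem (Finset.mem_filter.2
    ⟨Finset.mem_univ id, Function.injective_id⟩)

end PairMatrix

section SkewExtend

variable {ι A : Type*} [LinearOrder ι] [AddCommGroup A]

/-- The skew-symmetric matrix with given entries above the diagonal. -/
def skewExtend (f : {p : ι × ι // p.1 < p.2} → A) : Matrix ι ι A := fun a b =>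
  if h : a < b then f ⟨(a, b), h⟩ else if h : b < a then -f ⟨(b, a), h⟩ else 0

variable (f : {p : ι × ι // p.1 < p.2} → A)

lemma skewExtend_of_lt {a b : ι} (h : a < b) : skewExtend f a b = f ⟨(a, b), h⟩ := dif_pos h

lemma skewExtend_of_gt {a b : ι} (h : b < a) : skewExtend f a b = -f ⟨(b, a), h⟩ := by
  rw [skewExtend, dif_neg h.asymm, dif_pos h]

lemma skewExtend_self (a : ι) : skewExtend f a a = 0 := by simp [skewExtend]

lemma skewExtend_swap (a b : ι) : skewExtend f b a = -skewExtend f a b := by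
  obtain h | rfl | h := lt_trichotomy a b
  · rw [skewExtend_of_lt f h, skewExtend_of_gt f h]
  · simp [skewExtend_self]
  · rw [skewExtend_of_lt f h, skewExtend_of_gt f h, neg_neg]

lemma map_skewExtend {B : Type*} [AddCommGroup B] (φ : A →+ B) (a b : ι) :
    φ (skewExtend f a b) = skewExtend (fun p => φ (f p)) a b := by
  simp only [skewExtend]
  split_ifs <;> simp

lemma skewExtend_of_skew {J : Matrix ι ι A} [IsAddTorsionFree A] (hJ : ∀ a b, J b a = -J a b)
    (a b : ι) : skewExtend (fun p => J p.1.1 p.1.2) a b = J a b := by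
  obtain h | rfl | h := lt_trichotomy a b
  · rw [skewExtend_of_lt _ h]
  · rw [skewExtend_self, self_eq_neg.1 (hJ a a)]
  · rw [skewExtend_of_gt _ h, hJ, neg_neg]

end SkewExtend

section Polynomial

variable {K ι : Type*} [CommRing K] [LinearOrder ι]

/-- The partial derivatives with respect to the entries of the generic skew-symmetric matrix. -/
noncomputable def skewPderiv : Matrix ι ι (Derivation K (MvPolynomial {p : ι × ι // p.1 < p.2} K)
    (MvPolynomial {p : ι × ι // p.1 < p.2} K)) := skewExtend fun p => pderiv p

lemma skewPderiv_skewExtend_X (a b c e : ι) :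
    skewPderiv (K := K) a b (skewExtend X c e) =
      (if a = c ∧ b = e then 1 else 0) - (if a = e ∧ b = c then 1 else 0) := by
  have key : ∀ a b c e : ι, a < b → c < e → skewPderiv (K := K) a b (skewExtend X c e) =
      (if a = c ∧ b = e then 1 else 0) - (if a = e ∧ b = c then 1 else 0) := by
    intro a b c e hab hce
    rw [skewPderiv, skewExtend_of_lt _ hab, skewExtend_of_lt _ hce, pderiv_X, Pi.single_apply,
      if_neg (c := a = e ∧ b = c), sub_zero]
    · simp only [Subtype.mk.injEq, Prod.mk.injEq, eq_comm]
    · rintro ⟨rfl, rfl⟩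
      exact hab.asymm hce
  have key' : ∀ a b c e : ι, a < b → skewPderiv (K := K) a b (skewExtend X c e) =
      (if a = c ∧ b = e then 1 else 0) - (if a = e ∧ b = c then 1 else 0) := by
    intro a b c e hab
    obtain hce | rfl | hce := lt_trichotomy c e
    · exact key a b c e hab hce
    · rw [skewExtend_self, map_zero, sub_self]
    · rw [skewExtend_swap, map_neg, key a b e c hab hce, neg_sub]
  obtain hab | rfl | hab := lt_trichotomy a b
  · exact key' a b c e hab
  · rw [skewPderiv, skewExtend_self, Derivation.zero_apply]
    simp only [and_comm, sub_self]
  · rw [skewPderiv, skewExtend_swap, Derivation.neg_apply, ← skewPderiv, key' b a c e hab, neg_sub]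
    simp only [and_comm]

/-- The vector field given by an elementary matrix. -/
noncomputable def elementaryDerivation [Fintype ι] (c e : ι) :
    Derivation K (MvPolynomial {p : ι × ι // p.1 < p.2} K)
      (MvPolynomial {p : ι × ι // p.1 < p.2} K) :=
  ∑ b, skewExtend (X (R := K)) c b • skewPderiv e b

lemma elementaryDerivation_apply [Fintype ι] (c e : ι)
    (p : MvPolynomial {p : ι × ι // p.1 < p.2} K) :
    elementaryDerivation c e p = ∑ b, skewExtend X c b * skewPderiv e b p := by
  have := congrFun (map_sum Derivation.coeFnAddMonoidHom
    (fun b => skewExtend (X (R := K)) c b • skewPderiv e b) Finset.univ) p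
  rwa [Finset.sum_apply] at this

variable {n : ℕ}

lemma isElementary_elementaryDerivation (c e : Fin (2 * n + 1)) :
    IsElementary (elementaryDerivation (K := K) c e) (skewExtend X) c e := by
  intro a b
  rw [elementaryDerivation_apply]
  simp only [skewPderiv_skewExtend_X, mul_sub, Finset.sum_sub_distrib, mul_ite, mul_one, mul_zero,
    ite_and]
  rw [skewExtend_swap X c a]
  simp only [Finset.sum_ite_irrel, Finset.sum_ite_eq', Finset.mem_univ, if_true,
    Finset.sum_const_zero, eq_comm (a := e)]
  split_ifs <;> ring

variable (K n) in
/-- The sub-maximal Pfaffians of the generic skew-symmetric matrix, up to scalars. -/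
noncomputable def genericSubPf (j : Fin (2 * n + 1)) :
    MvPolynomial {p : Fin (2 * n + 1) × Fin (2 * n + 1) // p.1 < p.2} K :=
  subPf (skewExtend X) j

lemma sum_mul_skewPderiv_genericSubPf [IsDomain K] [CharZero K] (c e j : Fin (2 * n + 1)) :
    ∑ b, skewExtend X c b * skewPderiv e b (genericSubPf K n j) =
      (if c = e then genericSubPf K n j else 0) - (if c = j then genericSubPf K n e else 0) := by
  rw [← elementaryDerivation_apply]
  exact (isElementary_elementaryDerivation c e).map_subPf j

lemma isHomogeneous_genericSubPf (j : Fin (2 * n + 1)) : (genericSubPf K n j).IsHomogeneous n := by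
  have hX : ∀ a b : Fin (2 * n + 1), (skewExtend (X (R := K)) a b).IsHomogeneous 1 := by
    intro a b
    rw [skewExtend]
    split_ifs
    · exact isHomogeneous_X _ _
    · exact (isHomogeneous_X _ _).neg
    · exact isHomogeneous_zero _ _ _
  refine IsHomogeneous.sum _ _ _ fun τ _ => ?_
  split_ifs
  · rw [← mem_homogeneousSubmodule]
    refine zsmul_mem ?_ _
    rw [mem_homogeneousSubmodule]
    have := IsHomogeneous.prod Finset.univ (fun i : Fin n =>
      skewExtend (X (R := K)) (τ (oddPos i)) (τ (evenPos i))) (fun _ => 1) fun i _ => hX _ _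
    simpa [pairProd] using this
  · exact isHomogeneous_zero _ _ _

section Evaluation

variable {J : Matrix (Fin (2 * n + 1)) (Fin (2 * n + 1)) K} [IsAddTorsionFree K]
  (hJ : ∀ a b, J b a = -J a b)

include hJ in
lemma eval_skewExtend (a b : Fin (2 * n + 1)) :
    eval (fun p => J p.1.1 p.1.2) (skewExtend X a b) = J a b := by
  refine (map_skewExtend X (eval fun p => J p.1.1 p.1.2 : _ →+* K).toAddMonoidHom a b).trans ?_
  rw [← skewExtend_of_skew hJ]
  simp

include hJ in
lemma eval_genericSubPf (j : Fin (2 * n + 1)) :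
    eval (fun p => J p.1.1 p.1.2) (genericSubPf K n j) = subPf J j := by
  rw [genericSubPf, map_subPf]
  congr 1
  exact Matrix.ext fun a b => eval_skewExtend hJ a b

end Evaluation

lemma genericSubPf_ne_zero [IsDomain K] [CharZero K] (j : Fin (2 * n + 1)) :
    genericSubPf K n j ≠ 0 := by
  intro h
  have := subPf_pairMatrix_ne_zero (K := K) (Equiv.swap 0 j)
  rw [← eval_genericSubPf (pairMatrix_swap _), Equiv.swap_apply_left, h, map_zero] at this
  exact this rfl

end Polynomial

namespace SkewPartials

variable {K F : Type*} [CommRing K] [Field F] [CharZero F] [Algebra K F] {n : ℕ}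
  {Q : SkewPartials K F (Fin (2 * n + 1))} {q : Fin (2 * n + 1) → F} (hq : Q.Covariant q)
  {S : Type*} [CommRing S] (Θ : S →+* Module.End K F)
  {M : Matrix (Fin (2 * n + 1)) (Fin (2 * n + 1)) S} (h : ∀ a b y, Θ (M a b) y = Q.d a b y)

include hq

lemma Covariant.subPf_logGrad_of_ne {i k : Fin (2 * n + 1)} (hik : i ≠ k) :
    subPf (Q.logGrad q k) i = 0 :=
  subPf_eq_zero _ hik (hq.logGrad_right k) (hq.logGrad_left k)

include h

lemma Covariant.map_subPf_prod_zpow (hn : 1 ≤ n) (i : Fin (2 * n + 1))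
    (α : Fin (2 * n + 1) → ℤ) : Θ (subPf M i) (∏ k, q k ^ α k) =
      ((∏ j ∈ Finset.range (n - 1), (∑ k, α k + 2 * (j + 1)) : ℤ) : F) *
        ((∏ k, q k ^ α k) * (α i * subPf (Q.logGrad q i) i)) := by
  obtain ⟨m, rfl⟩ := Nat.exists_eq_add_of_le' hn
  have hcast : ∀ z : ℤ, algebraMap F (TensorProduct K F (GrassmannCenter K (2 * (m + 1) + 1))) z =
      z := map_intCast _
  rw [← Q.grassmannEval_iterate_D Θ M h, Q.grassmannExtension.iterate_D hq,
    ← hcast, ← Algebra.smul_def, ← Algebra.smul_def, map_smul, map_smul,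
    map_sum, Nat.add_sub_cancel, smul_eq_mul, smul_eq_mul]
  congr 2
  have key : ∀ k, grassmannEval (K := K) i
      ((α k : TensorProduct K F (GrassmannCenter K (2 * (m + 1) + 1))) *
        Q.grassmannExtension.γ q k ^ (m + 1)) = α k * subPf (Q.logGrad q k) i := fun k => by
    rw [← hcast, ← Algebra.smul_def, map_smul, smul_eq_mul,
      GrassmannExtension.γ, grassmannEval_pow]
  simp only [key]
  refine Finset.sum_eq_single i (fun k _ hk => ?_) (by simp)
  rw [hq.subPf_logGrad_of_ne hk.symm, mul_zero]

end SkewPartials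

/-- The ring of polynomials in the entries of the generic skew-symmetric matrix of odd size. -/
abbrev SkewRing (K : Type*) [CommRing K] (n : ℕ) : Type _ :=
  MvPolynomial {p : Fin (2 * n + 1) × Fin (2 * n + 1) // p.1 < p.2} K

namespace PartialDerivatives

variable {K F : Type*} [Field K] [Field F] [CharZero F] [Algebra K F] {n : ℕ}
  [Algebra (SkewRing K n) F]
  (P : PartialDerivatives {p : Fin (2 * n + 1) × Fin (2 * n + 1) // p.1 < p.2} K F)

omit [CharZero F] in
lemma skewExtend_D_algebraMap (a b : Fin (2 * n + 1)) (p : SkewRing K n) :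
    skewExtend P.D a b (algebraMap (SkewRing K n) F p) = algebraMap (SkewRing K n) F (skewPderiv a b p) := by
  simp only [skewPderiv, skewExtend]
  split_ifs <;> simp [P.D_algebraMap]

omit [CharZero F] in
lemma Θ_skewExtend_X (a b : Fin (2 * n + 1)) (y : F) :
    P.Θ (skewExtend X a b) y = skewExtend P.D a b y := by
  simp only [skewExtend]
  split_ifs <;> simp [P.Θ_X]

/-- The partial derivatives with respect to the entries of the generic skew-symmetric matrix, on
rational functions. -/
noncomputable def skewPartials : SkewPartials K F (Fin (2 * n + 1)) where
  x := Matrix.map (skewExtend X) (algebraMap (SkewRing K n) F)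
  d := skewExtend P.D
  x_swap a b := by
    rw [Matrix.map_apply, Matrix.map_apply, skewExtend_swap, map_neg]
  d_swap a b := skewExtend_swap _ a b
  d_x a b c e := by
    rw [Matrix.map_apply, P.skewExtend_D_algebraMap, skewPderiv_skewExtend_X]
    split_ifs <;> simp

variable [CharZero K] [FaithfulSMul (SkewRing K n) F]

omit [CharZero F] in
lemma covariant_genericSubPf :
    P.skewPartials.Covariant fun j => algebraMap (SkewRing K n) F (genericSubPf K n j) where
  sum_mul_d c e j := by
    simp only [skewPartials, Matrix.map_apply, P.skewExtend_D_algebraMap, ← map_mul, ← map_sum,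
      sum_mul_skewPderiv_genericSubPf]
    split_ifs <;> simp
  ne_zero j := by
    rw [Ne, FaithfulSMul.algebraMap_eq_zero_iff (SkewRing K n) F]
    exact genericSubPf_ne_zero j

end PartialDerivatives

section

variable {K : Type*} [Field K] [CharZero K] {n : ℕ}

lemma sum_skewExtend_X_mul_genericSubPf (j : Fin (2 * n + 1)) :
    ∑ b, skewExtend (X (R := K)) j b * genericSubPf K n b = 0 := by
  obtain ⟨P⟩ := exists_partialDerivatives (K := K) (F := FractionRing (SkewRing K n))
    (σ := {p : Fin (2 * n + 1) × Fin (2 * n + 1) // p.1 < p.2})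
  have : CharZero (FractionRing (SkewRing K n)) :=
    charZero_of_injective_algebraMap (algebraMap K (FractionRing (SkewRing K n))).injective
  refine FaithfulSMul.algebraMap_injective (SkewRing K n) (FractionRing (SkewRing K n)) ?_
  rw [map_sum, map_zero, ← P.covariant_genericSubPf.sum_x_mul j]
  simp only [map_mul]
  rfl

lemma X_mul_prod_genericSubPf_mem
    (s : {p : Fin (2 * n + 1) × Fin (2 * n + 1) // p.1 < p.2}) :
    (X s : SkewRing K n) * ∏ i, genericSubPf K n i ∈
      Ideal.span (Set.range fun i => genericSubPf K n i ^ 2) := by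
  have h := sum_skewExtend_X_mul_genericSubPf (K := K) s.1.1
  rw [← Finset.add_sum_erase _ _ (Finset.mem_univ s.1.2), add_eq_zero_iff_eq_neg,
    skewExtend_of_lt X s.2] at h
  rw [← Finset.mul_prod_erase _ _ (Finset.mem_univ s.1.2), ← mul_assoc, h, neg_mul,
    Finset.sum_mul]
  refine neg_mem (Ideal.sum_mem _ fun b hb => ?_)
  have hb' : b ∈ Finset.univ.erase s.1.2 :=
    Finset.mem_erase.2 ⟨Finset.ne_of_mem_erase hb, Finset.mem_univ b⟩
  rw [← Finset.mul_prod_erase _ _ hb', mul_assoc, ← mul_assoc (genericSubPf K n b), ← sq]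
  exact Ideal.mul_mem_left _ _ (Ideal.mul_mem_right _ _ (Ideal.subset_span ⟨b, rfl⟩))

end

section Gradient

variable {K : Type*} [CommRing K] [IsDomain K] [CharZero K] {n : ℕ}

variable (K) in
/-- The matrix of partial derivatives of a sub-maximal Pfaffian. -/
noncomputable def gradSubPf (i : Fin (2 * n + 1)) :
    Matrix (Fin (2 * n + 1)) (Fin (2 * n + 1)) (SkewRing K n) :=
  fun a b => skewPderiv a b (genericSubPf K n i)

lemma eval_gradSubPf (τ : Equiv.Perm (Fin (2 * n + 1)))
    (h : ∀ a, gradSubPf K (τ 0) a (τ 0) = 0) (a b : Fin (2 * n + 1)) :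
    eval (fun p => pairMatrix K τ p.1.1 p.1.2) (gradSubPf K (τ 0) a b) =
      subPf (pairMatrix K τ) (τ 0) * pairMatrix K τ a b := by
  have key := fun c => congrArg (eval fun p => pairMatrix K τ p.1.1 p.1.2)
    (sum_mul_skewPderiv_genericSubPf (K := K) c a (τ 0))
  simp only [map_sum, map_mul, map_sub, eval_skewExtend (pairMatrix_swap τ), apply_ite (eval _),
    eval_genericSubPf (pairMatrix_swap τ), map_zero] at key
  obtain ⟨k, rfl⟩ := τ.surjective b
  obtain rfl | ⟨m, rfl | rfl⟩ := eq_zero_or_oddPos_or_evenPos k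
  · rw [h, map_zero, pairMatrix_swap, pairMatrix_zero, neg_zero, mul_zero]
  · have := key (τ (evenPos m))
    simp only [pairMatrix_evenPos, neg_mul, ite_mul, one_mul, zero_mul, Finset.sum_neg_distrib,
      Finset.sum_ite_eq', Finset.mem_univ, if_true, τ.injective.eq_iff, evenPos_ne_zero, if_false,
      sub_zero] at this
    rw [pairMatrix_swap, pairMatrix_oddPos, gradSubPf, neg_eq_iff_eq_neg.1 this]
    simp only [eq_comm (a := a)]
    split_ifs <;> simp
  · have := key (τ (oddPos m))
    simp only [pairMatrix_oddPos, ite_mul, one_mul, zero_mul, Finset.sum_ite_eq',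
      Finset.mem_univ, if_true, τ.injective.eq_iff, oddPos_ne_zero, if_false,
      sub_zero] at this
    rw [pairMatrix_swap, pairMatrix_evenPos, gradSubPf, this]
    simp only [eq_comm (a := a)]
    split_ifs <;> simp

end Gradient

namespace PartialDerivatives

variable {K F : Type*} [Field K] [Field F] [Algebra K F] {n : ℕ}
  [Algebra (SkewRing K n) F]
  (P : PartialDerivatives {p : Fin (2 * n + 1) × Fin (2 * n + 1) // p.1 < p.2} K F)

lemma exists_isHomogeneous_Θ_prod (m r : ℕ) (t : Fin m → Fin (2 * n + 1) × Fin (2 * n + 1))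
    {p : SkewRing K n} (hp : p.IsHomogeneous (r + m)) : ∃ p' : SkewRing K n, p'.IsHomogeneous r ∧
      P.Θ (∏ i, skewExtend X (t i).1 (t i).2) (algebraMap (SkewRing K n) F p) =
        algebraMap (SkewRing K n) F p' := by
  induction m generalizing r with
  | zero => exact ⟨p, by simpa using hp, by simp⟩
  | succ m ih =>
    obtain ⟨p', hp', h⟩ := ih (r + 1) (fun i => t i.succ) (by rwa [add_right_comm, add_assoc])
    refine ⟨skewPderiv (t 0).1 (t 0).2 p', ?_, ?_⟩
    · simp only [skewPderiv, skewExtend]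
      split_ifs
      · exact hp'.pderiv
      · exact hp'.pderiv.neg
      · exact isHomogeneous_zero _ _ _
    · rw [Fin.prod_univ_succ, P.Θ_mul, h, P.Θ_skewExtend_X, P.skewExtend_D_algebraMap]

variable [IsScalarTower K (SkewRing K n) F]

lemma exists_Θ_genericSubPf_eq (i : Fin (2 * n + 1)) {p : SkewRing K n} (hp : p.IsHomogeneous n) :
    ∃ c : K, P.Θ (genericSubPf K n i) (algebraMap (SkewRing K n) F p) = algebraMap K F c := by
  have : ∀ t : Fin n → Fin (2 * n + 1) × Fin (2 * n + 1), ∃ c : K,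
      P.Θ (∏ i, skewExtend X (t i).1 (t i).2) (algebraMap (SkewRing K n) F p) =
        algebraMap K F c := fun t => by
    obtain ⟨p', hp', h⟩ := P.exists_isHomogeneous_Θ_prod n 0 t (by rwa [zero_add])
    refine ⟨coeff 0 p', ?_⟩
    rw [h, totalDegree_eq_zero_iff_eq_C.1 (hp'.totalDegree_le.antisymm bot_le),
      ← algebraMap_eq, ← IsScalarTower.algebraMap_apply, algebraMap_eq, coeff_C, if_pos rfl]
  choose c hc using this
  refine ⟨∑ t, pairCoeff i t * c t, ?_⟩
  rw [genericSubPf, ← sum_pairCoeff_smul, map_sum, LinearMap.sum_apply, map_sum]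
  refine Finset.sum_congr rfl fun t _ => ?_
  rw [map_zsmul, LinearMap.smul_apply, hc, zsmul_eq_mul, map_mul, map_intCast]

variable [CharZero K] [FaithfulSMul (SkewRing K n) F]

omit [IsScalarTower K (SkewRing K n) F] in
lemma subPf_logGrad_ne_zero [CharZero F] (i : Fin (2 * n + 1)) :
    subPf (P.skewPartials.logGrad
      (fun j => algebraMap (SkewRing K n) F (genericSubPf K n j)) i) i ≠ 0 := by
  have hq := P.covariant_genericSubPf
  set q := fun j => algebraMap (SkewRing K n) F (genericSubPf K n j) with hqdef
  have hlog : P.skewPartials.logGrad q i =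
      (q i)⁻¹ • (gradSubPf K i).map (algebraMap (SkewRing K n) F) := by
    ext a b
    rw [SkewPartials.logGrad, Matrix.smul_apply, Matrix.map_apply, smul_eq_mul, hqdef]
    exact congrArg _ (P.skewExtend_D_algebraMap a b _)
  have hright : ∀ a, gradSubPf K i a i = 0 := fun a => by
    have h := hq.logGrad_right i a
    rw [hlog, Matrix.smul_apply, Matrix.map_apply, smul_eq_mul] at h
    exact (FaithfulSMul.algebraMap_eq_zero_iff (SkewRing K n) F).1
      ((mul_eq_zero.1 h).resolve_left (inv_ne_zero (hq.ne_zero i)))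
  have hne : subPf (pairMatrix K (Equiv.swap 0 i)) i ≠ 0 := by
    simpa using subPf_pairMatrix_ne_zero (K := K) (Equiv.swap 0 i)
  rw [hlog, subPf_smul, ← map_subPf]
  refine mul_ne_zero (pow_ne_zero _ (inv_ne_zero (hq.ne_zero i))) fun h => ?_
  rw [FaithfulSMul.algebraMap_eq_zero_iff (SkewRing K n) F] at h
  have heval := congrArg (eval fun p => pairMatrix K (Equiv.swap 0 i) p.1.1 p.1.2) h
  rw [map_zero, map_subPf] at heval
  have hmap : (gradSubPf K i).map (eval fun p => pairMatrix K (Equiv.swap 0 i) p.1.1 p.1.2) =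
      subPf (pairMatrix K (Equiv.swap 0 i)) i • pairMatrix K (Equiv.swap 0 i) := by
    ext a b
    have := eval_gradSubPf (K := K) (Equiv.swap 0 i) (by simpa using hright) a b
    rw [Equiv.swap_apply_left] at this
    exact this
  rw [hmap, subPf_smul] at heval
  exact mul_ne_zero (pow_ne_zero _ hne) hne heval

lemma exists_subPf_logGrad (hn : 1 ≤ n) (i : Fin (2 * n + 1)) : ∃ κ : K, κ ≠ 0 ∧
    subPf (P.skewPartials.logGrad (fun j => algebraMap (SkewRing K n) F (genericSubPf K n j)) i) i =
      algebraMap K F κ * (algebraMap (SkewRing K n) F (genericSubPf K n i))⁻¹ := by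
  have : CharZero F := charZero_of_injective_algebraMap (algebraMap K F).injective
  have hq := P.covariant_genericSubPf
  set q := fun j => algebraMap (SkewRing K n) F (genericSubPf K n j) with hqdef
  have hqi : q i ≠ 0 := hq.ne_zero i
  obtain ⟨c, hc⟩ := P.exists_Θ_genericSubPf_eq i (isHomogeneous_genericSubPf (K := K) i)
  obtain ⟨N, hN, hNq⟩ : ∃ N : ℤ, N ≠ 0 ∧ algebraMap K F c =
      N * (q i * subPf (P.skewPartials.logGrad q i) i) := by
    have h := hq.map_subPf_prod_zpow (P.Θ : SkewRing K n →+* Module.End K F)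
      (M := skewExtend X) P.Θ_skewExtend_X hn i (Pi.single i 1)
    have hprod : ∏ k, q k ^ (Pi.single i 1 : Fin (2 * n + 1) → ℤ) k = q i := by
      rw [Finset.prod_eq_single i] <;> simp +contextual
    rw [hprod, Pi.single_eq_same, Int.cast_one, one_mul] at h
    exact ⟨_, Finset.prod_ne_zero_iff.2 fun j _ => by simp; omega, hc.symm.trans h⟩
  have hκ : subPf (P.skewPartials.logGrad q i) i = algebraMap K F ((N : K)⁻¹ * c) * (q i)⁻¹ := by
    have hN' : (N : F) ≠ 0 := Int.cast_ne_zero.2 hN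
    rw [map_mul, hNq, map_inv₀, map_intCast, inv_mul_cancel_left₀ hN', mul_comm (q i),
      mul_inv_cancel_right₀ hqi]
  refine ⟨(N : K)⁻¹ * c, fun h => P.subPf_logGrad_ne_zero i ?_, hκ⟩
  rw [h, map_zero, zero_mul] at hκ
  exact hκ

/-- The sub-maximal Pfaffians lower products of powers of sub-maximal Pfaffians. -/
lemma lowers_genericSubPf (hn : 1 ≤ n) : P.Lowers (genericSubPf K n) := by
  have : CharZero F := charZero_of_injective_algebraMap (algebraMap K F).injective
  intro i α
  obtain ⟨κ, hκ0, hκ⟩ := P.exists_subPf_logGrad hn i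
  refine ⟨((∏ j ∈ Finset.range (n - 1), (∑ k, α k + 2 * (j + 1)) : ℤ) : K) * κ, ?_, fun hα =>
    mul_ne_zero (Int.cast_ne_zero.2 (Finset.prod_ne_zero_iff.2 fun j hj => ?_)) hκ0⟩
  · have hz : zpowProd F (genericSubPf K n) (-Pi.single i 1) =
        (algebraMap (SkewRing K n) F (genericSubPf K n i))⁻¹ := by
      rw [zpowProd, Finset.prod_eq_single i] <;> simp +contextual
    refine (P.covariant_genericSubPf.map_subPf_prod_zpow (P.Θ : SkewRing K n →+* Module.End K F)
      (M := skewExtend X) P.Θ_skewExtend_X hn i α).trans ?_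
    rw [hκ, sub_eq_add_neg, zpowProd_add F genericSubPf_ne_zero, hz, Algebra.smul_def, zpowProd]
    simp only [map_mul, map_intCast]
    ring
  · rw [Fintype.card_fin] at hα
    have := Finset.mem_range.1 hj
    push_cast at hα
    omega

end PartialDerivatives

lemma boundaryPart_le_localizedPart {S : Type*} [CommRing S] [IsDomain S] (F : Type*) [Field F] [Algebra S F]
    [FaithfulSMul S F] {l : List S} (hl : ∀ f ∈ l, f ≠ 0) : boundaryPart F l ≤ localizedPart F l := by
  intro x hx
  obtain ⟨t, s, -, h⟩ := (mem_boundaryPart_iff l hl).1 hx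
  exact (mem_localizedPart_iff l).2 ⟨t, s, h⟩

namespace PartialDerivatives

variable {σ K F : Type*} [Fintype σ] [DecidableEq σ] [Field K] [Field F] [Algebra (MvPolynomial σ K) F]
  [Algebra K F] [FaithfulSMul (MvPolynomial σ K) F]
  (P : PartialDerivatives σ K F)

lemma lowers_X : P.Lowers (X : σ → MvPolynomial σ K) := by
  intro i α
  refine ⟨1, ?_, fun _ => one_ne_zero⟩
  have hX : ∀ s, algebraMap (MvPolynomial σ K) F (X s) ≠ 0 := fun s => by
    rw [Ne, FaithfulSMul.algebraMap_eq_zero_iff (MvPolynomial σ K) F]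
    exact X_ne_zero s
  rw [P.Θ_X, one_mul]
  change P.D i _ = _
  rw [zpowProd, Derivation.leibniz_finset_prod, Finset.sum_eq_single i]
  · rw [sub_eq_add_neg, zpowProd_add F X_ne_zero]
    have hz : zpowProd F (X : σ → MvPolynomial σ K) (-Pi.single i 1) =
        (algebraMap (MvPolynomial σ K) F (X i))⁻¹ := by
      rw [zpowProd, Finset.prod_eq_single i] <;> simp +contextual
    rw [hz, zpowProd, ← Finset.mul_prod_erase _ _ (Finset.mem_univ i), Derivation.leibniz_zpow,
      P.D_algebraMap, pderiv_X_self, map_one, zpow_sub_one₀ (hX i),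
      Int.cast_smul_eq_zsmul]
    simp only [smul_eq_mul, zsmul_eq_mul, mul_one]
    ring
  · intro s _ hs
    rw [Derivation.leibniz_zpow, P.D_algebraMap, pderiv_X_of_ne hs]
    simp
  · simp

end PartialDerivatives

lemma nonempty_localCohomology_iso {σ K ι κ : Type} [Field K] [CharZero K] [Fintype σ]
    [Fintype ι] [DecidableEq ι]
    [Nonempty ι] [Fintype κ] [DecidableEq κ] [Nonempty κ]
    (f : ι → MvPolynomial σ K) (g : κ → MvPolynomial σ K) (hf : ∀ i, f i ≠ 0) (hg : ∀ i, g i ≠ 0)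
    (hfX : ∀ s, X s * ∏ i, f i ∈ Ideal.span (Set.range fun i => f i ^ 2))
    (hgX : ∀ s, X s * ∏ i, g i ∈ Ideal.span (Set.range fun i => g i ^ 2))
    (P : PartialDerivatives σ K (FractionRing (MvPolynomial σ K)))
    (hPf : P.Lowers f) (hPg : P.Lowers g) :
    Nonempty ((localCohomology (Ideal.span (Set.range f)) (Fintype.card ι)).obj
      (ModuleCat.of (MvPolynomial σ K) (MvPolynomial σ K)) ≅
      (localCohomology (Ideal.span (Set.range g)) (Fintype.card κ)).obj
      (ModuleCat.of (MvPolynomial σ K) (MvPolynomial σ K))) := by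
  have key : ∀ {ι : Type} [Fintype ι] [Nonempty ι] (f : ι → MvPolynomial σ K), (∀ i, f i ≠ 0) →
      Nonempty ((localCohomology (Ideal.span (Set.range f)) (Fintype.card ι)).obj
        (ModuleCat.of (MvPolynomial σ K) (MvPolynomial σ K)) ≅
        ModuleCat.of _ (localizedPart (FractionRing (MvPolynomial σ K)) (Finset.univ.toList.map f) ⧸
          (boundaryPart (FractionRing (MvPolynomial σ K)) (Finset.univ.toList.map f)).submoduleOf
            (localizedPart (FractionRing (MvPolynomial σ K)) (Finset.univ.toList.map f)))) := by
    intro ι _ _ f hf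
    have h := localCohomology_top (FractionRing (MvPolynomial σ K)) (Finset.univ.toList.map f)
      (by simpa using hf)
      (by simp [Finset.univ_eq_empty_iff])
    have hspan : {p | p ∈ Finset.univ.toList.map f} = Set.range f := by ext; simp
    rw [hspan, List.length_map, Finset.length_toList, Finset.card_univ] at h
    exact h
  obtain ⟨e₁⟩ := key f hf
  obtain ⟨e₂⟩ := key g hg
  obtain ⟨e⟩ := (hPf.isDual hf hfX).nonempty_equiv (hPg.isDual hg hgX)
    (boundaryPart_le_localizedPart _ (by simpa using hf))
    (boundaryPart_le_localizedPart _ (by simpa using hg))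
  exact ⟨e₁ ≪≫ e.toModuleIso ≪≫ e₂.symm⟩

lemma card_lt_pairs (n : ℕ) :
    Fintype.card {p : Fin (2 * n + 1) × Fin (2 * n + 1) // p.1 < p.2} = n * (2 * n + 1) := by
  have h : Fintype.card {p : Fin (2 * n + 1) × Fin (2 * n + 1) // p.1 < p.2} =
      ∑ a : Fin (2 * n + 1), (2 * n + 1 - 1 - a : ℕ) := by
    rw [Fintype.card_subtype, ← Finset.univ_product_univ, Finset.card_filter, Finset.sum_product]
    refine Finset.sum_congr rfl fun a _ => ?_
    rw [← Finset.card_filter, Finset.filter_lt_eq_Ioi, Fin.card_Ioi]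
  rw [h, Fin.sum_univ_eq_sum_range (fun a => 2 * n + 1 - 1 - a), Finset.sum_range_reflect (fun a => a),
    Finset.sum_range_id, Nat.add_sub_cancel, mul_left_comm, Nat.mul_div_cancel_left _ two_pos,
    mul_comm]

/-- The generic sub-maximal Pfaffians agree up to scalars with the Pfaffians of the submatrices. -/
lemma span_range_smul_sum_perm {K : Type*} [Field K] [CharZero K] {n : ℕ} :
    Ideal.span (Set.range fun k : Fin (2 * n + 1) =>
      (((2 ^ n * Nat.factorial n : ℕ) : K)⁻¹) •
        ∑ σ : Equiv.Perm (Fin (2 * n)), (Equiv.Perm.sign σ : ℤ) •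
          ∏ i : Fin n, (Matrix.submatrix (skewExtend (X (R := K))) k.succAbove k.succAbove)
            (σ ⟨2 * (i : ℕ), two_mul_val_lt i⟩) (σ ⟨2 * (i : ℕ) + 1, two_mul_val_add_one_lt i⟩)) =
    Ideal.span (Set.range (genericSubPf K n)) := by
  have hc : ((2 ^ n * Nat.factorial n : ℕ) : K) ≠ 0 :=
    Nat.cast_ne_zero.2 (by positivity)
  refine le_antisymm (Ideal.span_le.2 ?_) (Ideal.span_le.2 ?_)
  · rintro _ ⟨k, rfl⟩
    refine Submodule.smul_of_tower_mem _ _ ?_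
    refine (Ideal.unit_mul_mem_iff_mem _ (y := (-1) ^ (k : ℕ)) (isUnit_one.neg.pow _)).1 ?_
    rw [← subPf_eq_sum_perm]
    exact Ideal.subset_span ⟨k, rfl⟩
  · rintro _ ⟨k, rfl⟩
    rw [genericSubPf, subPf_eq_sum_perm, SetLike.mem_coe]
    refine Ideal.mul_mem_left _ _ ?_
    rw [← inv_smul_smul₀ (inv_ne_zero hc) (∑ σ : Equiv.Perm (Fin (2 * n)), _)]
    exact Submodule.smul_of_tower_mem _ _ (Ideal.subset_span ⟨k, rfl⟩)

lemma X_mul_prod_X_mem {σ K : Type*} [Fintype σ] [CommRing K] (s : σ) :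
    (X s : MvPolynomial σ K) * ∏ i, X i ∈ Ideal.span (Set.range fun i => X i ^ 2) := by
  classical
  rw [← Finset.mul_prod_erase _ _ (Finset.mem_univ s), ← mul_assoc, ← sq]
  exact Ideal.mul_mem_right _ _ (Ideal.subset_span ⟨s, rfl⟩)

/-- The top nonvanishing local cohomology module `H^{2n+1}_I(S)` with support in the
ideal `I` of sub-maximal Pfaffians of the generic `(2n+1) × (2n+1)` skew-symmetric
matrix is isomorphic, as an `S`-module, to `H^{n(2n+1)}_𝔪(S)`, the local cohomology
with support in the maximal homogeneous ideal `𝔪` (the injective hull of the residue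
field). -/
theorem local_cohomology_submaximal_pfaffians_top
    (K : Type) [Field K] [CharZero K] (n : ℕ) (hn : 1 ≤ n)
    (X : Matrix (Fin (2 * n + 1)) (Fin (2 * n + 1))
      (MvPolynomial {p : Fin (2 * n + 1) × Fin (2 * n + 1) // p.1 < p.2} K))
    (hXlt : ∀ (i j : Fin (2 * n + 1)) (h : i < j), X i j = MvPolynomial.X ⟨(i, j), h⟩)
    (hXgt : ∀ (i j : Fin (2 * n + 1)) (h : j < i), X i j = -MvPolynomial.X ⟨(j, i), h⟩)
    (hXdiag : ∀ i, X i i = 0)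
    (pf : Matrix (Fin (2 * n)) (Fin (2 * n))
        (MvPolynomial {p : Fin (2 * n + 1) × Fin (2 * n + 1) // p.1 < p.2} K) →
      MvPolynomial {p : Fin (2 * n + 1) × Fin (2 * n + 1) // p.1 < p.2} K)
    (hpf : ∀ A, pf A = (((2 ^ n * Nat.factorial n : ℕ) : K)⁻¹) •
      ∑ σ : Equiv.Perm (Fin (2 * n)), (Equiv.Perm.sign σ : ℤ) •
        ∏ i : Fin n, A (σ ⟨2 * (i : ℕ), by omega⟩) (σ ⟨2 * (i : ℕ) + 1, by omega⟩))
    (I : Ideal (MvPolynomial {p : Fin (2 * n + 1) × Fin (2 * n + 1) // p.1 < p.2} K))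
    (hI : I = Ideal.span (Set.range fun k : Fin (2 * n + 1) =>
      pf (X.submatrix (Fin.succAbove k) (Fin.succAbove k))))
    (𝔪 : Ideal (MvPolynomial {p : Fin (2 * n + 1) × Fin (2 * n + 1) // p.1 < p.2} K))
    (h𝔪 : 𝔪 = Ideal.span (Set.range
      (MvPolynomial.X : {p : Fin (2 * n + 1) × Fin (2 * n + 1) // p.1 < p.2} → MvPolynomial {p : Fin (2 * n + 1) × Fin (2 * n + 1) // p.1 < p.2} K))) :
    Nonempty ((localCohomology I (2 * n + 1)).obj (ModuleCat.of (MvPolynomial {p : Fin (2 * n + 1) × Fin (2 * n + 1) // p.1 < p.2} K) (MvPolynomial {p : Fin (2 * n + 1) × Fin (2 * n + 1) // p.1 < p.2} K)) ≅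
      (localCohomology 𝔪 (n * (2 * n + 1))).obj (ModuleCat.of (MvPolynomial {p : Fin (2 * n + 1) × Fin (2 * n + 1) // p.1 < p.2} K) (MvPolynomial {p : Fin (2 * n + 1) × Fin (2 * n + 1) // p.1 < p.2} K))) := by
  have hX : X = skewExtend MvPolynomial.X := by
    ext1 i j
    obtain h | rfl | h := lt_trichotomy i j
    · rw [hXlt i j h, skewExtend_of_lt _ h]
    · rw [hXdiag, skewExtend_self]
    · rw [hXgt i j h, skewExtend_of_gt _ h]
  simp only [hpf, hX] at hI
  rw [span_range_smul_sum_perm] at hI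
  obtain ⟨P⟩ := exists_partialDerivatives (K := K) (F := FractionRing (SkewRing K n))
    (σ := {p : Fin (2 * n + 1) × Fin (2 * n + 1) // p.1 < p.2})
  have : Nonempty {p : Fin (2 * n + 1) × Fin (2 * n + 1) // p.1 < p.2} :=
    ⟨⟨(⟨0, by omega⟩, ⟨1, by omega⟩), Fin.mk_lt_mk.2 Nat.zero_lt_one⟩⟩
  have h := nonempty_localCohomology_iso _ _ genericSubPf_ne_zero X_ne_zero
    X_mul_prod_genericSubPf_mem (X_mul_prod_X_mem) P (P.lowers_genericSubPf hn) P.lowers_X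
  rw [Fintype.card_fin, card_lt_pairs, ← hI, ← h𝔪] at h
  exact h
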